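/- arXiv:1609.06284 — 3 statements merged into one kernel-verified Lean document; each statement's English description precedes it below -/
import Mathlib

section
/- There exist absolute constants c > 0 and C > 0 such that the following holds. Let F be a field, let A, B ⊆ F be finite sets with |A| = a, |B| = b, a ≤ b, and let L be a finite set of n lines in F^2 with a·b^2 ≤ n^3. If F has positive characteristic p, assume additionally that a·n ≤ c · p^2. Then I(A × B, L) ≤ C · (a^{3/4} b^{1/2} n^{3/4} + n), where A × B = {(x,y) ∈ F^2 : x ∈ A, y ∈ B}. -/
open scoped Classical

/-- A line in `F^2`: the set of points `(x, y)` with `α·x + β·y = γ`, where `(α, β) ≠ (0, 0)`. -/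
def IsLine {F : Type*} [Field F] (ℓ : Set (F × F)) : Prop :=
  ∃ α β γ : F, (α, β) ≠ (0, 0) ∧ ℓ = {p : F × F | α * p.1 + β * p.2 = γ}

/-- The number of incidences between a finite set of points and a finite set of lines. -/
noncomputable def Incidences {F : Type*} [Field F]
    (P : Finset (F × F)) (L : Finset (Set (F × F))) : ℕ :=
  Set.ncard {ql : (F × F) × Set (F × F) | ql.1 ∈ P ∧ ql.2 ∈ L ∧ ql.1 ∈ ql.2}

section Elimination

open Polynomial in
/-- An irreducible polynomial of positive degree over a GCD domain has nonzero resultant with every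
polynomial it does not divide. -/
theorem resultant_ne_zero_of_not_dvd {S : Type*} [CommRing S] [IsDomain S] [IsGCDMonoid S]
    {f g : S[X]} (hf : Irreducible f) (hdeg : f.natDegree ≠ 0) (hfg : ¬ f ∣ g) :
    f.resultant g ≠ 0 := by
  have hprim := hf.isPrimitive hdeg
  have hirr := (hprim.irreducible_iff_irreducible_map_fraction_map (K := FractionRing S)).1 hf
  have hinj := FaithfulSMul.algebraMap_injective S (FractionRing S)
  have hco : IsCoprime (f.map (algebraMap S (FractionRing S)))
      (g.map (algebraMap S (FractionRing S))) := by
    refine (hirr.isCoprime_or_dvd _).resolve_right fun h => hfg ?_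
    exact hprim.dvd_of_fraction_map_dvd_fraction_map h
  intro h0
  have := resultant_ne_zero _ _ hco
  apply this
  rw [natDegree_map_eq_of_injective hinj, natDegree_map_eq_of_injective hinj, resultant_map_map,
    h0, map_zero]

namespace MvPolynomial

variable {F : Type*} [Field F]

theorem totalDegree_coeff_finSuccEquiv_le {R : Type*} [CommSemiring R] {n : ℕ}
    (f : MvPolynomial (Fin (n + 1)) R) (i : ℕ) :
    ((finSuccEquiv R n f).coeff i).totalDegree ≤ f.totalDegree := by
  by_cases h : (finSuccEquiv R n f).coeff i = 0
  · simp [h]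
  · have := totalDegree_coeff_finSuccEquiv_add_le f i h
    omega

theorem natDegree_finSuccEquiv_le {R : Type*} [CommSemiring R] {n : ℕ}
    (f : MvPolynomial (Fin (n + 1)) R) :
    (finSuccEquiv R n f).natDegree ≤ f.totalDegree := by
  rw [natDegree_finSuccEquiv]; exact degreeOf_le_totalDegree f 0

theorem totalDegree_det_le {R σ ι : Type*} [CommRing R] [Fintype ι] [DecidableEq ι]
    (M : Matrix ι ι (MvPolynomial σ R)) (d : ι → ℕ) (hM : ∀ i j, (M i j).totalDegree ≤ d j) :
    M.det.totalDegree ≤ ∑ j, d j := by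
  rw [Matrix.det_apply]
  refine totalDegree_finsetSum_le fun τ _ => ?_
  refine (totalDegree_smul_le _ _).trans ?_
  refine (totalDegree_finsetProd _ _).trans ?_
  exact Finset.sum_le_sum fun j _ => hM _ _

theorem finSuccEquiv_rename_succ_eq {R : Type*} [CommSemiring R] {n : ℕ}
    (r : MvPolynomial (Fin n) R) :
    finSuccEquiv R n (rename Fin.succ r) = Polynomial.C r := by
  induction r using MvPolynomial.induction_on with
  | C a => simp [finSuccEquiv_apply]
  | add p q hp hq => simp [hp, hq]
  | mul_X p i hp => simp only [map_mul, hp, rename_X, finSuccEquiv_X_succ]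

theorem totalDegree_resultant_le {R : Type*} [CommRing R] {n : ℕ}
    (f h : MvPolynomial (Fin (n + 1)) R) :
    ((finSuccEquiv R n f).resultant (finSuccEquiv R n h)).totalDegree ≤
      2 * f.totalDegree * h.totalDegree := by
  refine (totalDegree_det_le (Polynomial.sylvester (finSuccEquiv R n f) (finSuccEquiv R n h) _ _)
    (fun j => Fin.addCases (motive := fun _ => ℕ) (fun _ => h.totalDegree)
    (fun _ => f.totalDegree) j) ?_).trans ?_
  · intro i j
    induction j using Fin.addCases with
    | left j =>
      simp only [Polynomial.sylvester, Matrix.of_apply, Fin.addCases_left]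
      split_ifs
      · exact totalDegree_coeff_finSuccEquiv_le _ _
      · simp
    | right j =>
      simp only [Polynomial.sylvester, Matrix.of_apply, Fin.addCases_right]
      split_ifs
      · exact totalDegree_coeff_finSuccEquiv_le _ _
      · simp
  · rw [Fin.sum_univ_add]
    simp only [Fin.addCases_left, Fin.addCases_right, Finset.sum_const, Finset.card_univ,
      Fintype.card_fin, smul_eq_mul]
    have h1 := natDegree_finSuccEquiv_le f
    have h2 := natDegree_finSuccEquiv_le h
    nlinarith

/-- Elimination of the first variable, with control of the degree of the eliminant. -/
theorem exists_eliminant {n : ℕ} {f h : MvPolynomial (Fin (n + 1)) F} (hf : Irreducible f)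
    (hdeg : f.degreeOf 0 ≠ 0) (hfh : ¬ f ∣ h) :
    ∃ r : MvPolynomial (Fin n) F, r ≠ 0 ∧ r.totalDegree ≤ 2 * f.totalDegree * h.totalDegree ∧
      ∃ u v : MvPolynomial (Fin (n + 1)) F, rename Fin.succ r = f * u + h * v := by
  have hirr : Irreducible (finSuccEquiv F n f) :=
    (MulEquiv.irreducible_iff (finSuccEquiv F n)).2 hf
  have hnd : ¬ finSuccEquiv F n f ∣ finSuccEquiv F n h := by
    rwa [map_dvd_iff]
  rw [← natDegree_finSuccEquiv] at hdeg
  refine ⟨_, resultant_ne_zero_of_not_dvd hirr hdeg hnd, totalDegree_resultant_le f h, ?_⟩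
  obtain ⟨p, q, -, -, e⟩ := Polynomial.exists_mul_add_mul_eq_C_resultant
    (finSuccEquiv F n f) (finSuccEquiv F n h) le_rfl le_rfl (Or.inl hdeg)
  refine ⟨(finSuccEquiv F n).symm p, (finSuccEquiv F n).symm q, ?_⟩
  apply (finSuccEquiv F n).injective
  simp [finSuccEquiv_rename_succ_eq, ← e]

theorem totalDegree_pderiv_lt {R σ : Type*} [CommSemiring R] (i : σ) (f : MvPolynomial σ R)
    (h : pderiv i f ≠ 0) : (pderiv i f).totalDegree < f.totalDegree := by
  have hsum : pderiv i f = ∑ s ∈ f.support,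
      monomial (s - Finsupp.single i 1) (coeff s f * (s i : R)) := by
    conv_lhs => rw [f.as_sum]
    rw [map_sum]
    exact Finset.sum_congr rfl fun s _ => pderiv_monomial
  have hpos : 0 < f.totalDegree := by
    by_contra h0
    apply h
    rw [totalDegree_eq_zero_iff_eq_C.1 (by omega : f.totalDegree = 0)]
    simp
  have : (pderiv i f).totalDegree ≤ f.totalDegree - 1 := by
    rw [hsum]
    refine totalDegree_finsetSum_le fun s hs => ?_
    by_cases hsi : s i = 0
    · simp [hsi]
    · refine (totalDegree_monomial_le _ _).trans ?_
      have h1 : (s.sum fun _ e => e) ≤ f.totalDegree := le_totalDegree hs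
      have h2 : (s - Finsupp.single i 1) + Finsupp.single i 1 = s :=
        tsub_add_cancel_of_le (by simpa using Nat.one_le_iff_ne_zero.2 hsi)
      have h3 := congrArg Finsupp.degree h2
      rw [map_add] at h3
      simp only [Finsupp.degree_single] at h3
      have h4 : (s.sum fun _ e => e) = Finsupp.degree s := rfl
      have h5 : ((s - Finsupp.single i 1).sum fun _ => id) =
        Finsupp.degree (s - Finsupp.single i 1) := rfl
      rw [h5]
      omega
  omega

theorem totalDegree_pderiv_le {R σ : Type*} [CommSemiring R] (i : σ) (f : MvPolynomial σ R) :
    (pderiv i f).totalDegree ≤ f.totalDegree := by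
  by_cases h : pderiv i f = 0
  · simp [h]
  · exact (totalDegree_pderiv_lt i f h).le

/-- Chain rule for substituting univariate polynomials in a multivariate polynomial. -/
theorem derivative_aeval {R S σ : Type*} [CommRing R] [CommRing S] [Algebra R S] [Fintype σ]
    (v : σ → Polynomial S) (f : MvPolynomial σ R) :
    Polynomial.derivative (aeval v f) =
      ∑ i, aeval v (pderiv i f) * Polynomial.derivative (v i) := by
  induction f using MvPolynomial.induction_on with
  | C a => simp [Polynomial.algebraMap_apply]
  | add p q hp hq => simp [hp, hq, add_mul, Finset.sum_add_distrib]
  | mul_X p i hp =>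
    simp only [map_mul, aeval_X, Polynomial.derivative_mul, hp, Derivation.leibniz, pderiv_X,
      smul_eq_mul, map_add, add_mul, Finset.sum_add_distrib]
    rw [add_comm]
    congr 1
    · simp [Pi.single_apply, apply_ite]
    · rw [Finset.sum_mul]
      exact Finset.sum_congr rfl fun j _ => by ring

end MvPolynomial

end Elimination

section Lines

open MvPolynomial

variable {F : Type*} [Field F]

/-- Restriction of a polynomial in `z, x, y` (in this order) to the line
`{(x, y₀, α x + β)}`, where `ℓ = (y₀, α, β)`. -/
noncomputable def lineX (ℓ : F × F × F) : MvPolynomial (Fin 3) F →ₐ[F] Polynomial F :=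
  aeval ![Polynomial.C ℓ.2.1 * Polynomial.X + Polynomial.C ℓ.2.2, Polynomial.X, Polynomial.C ℓ.1]

/-- Restriction of a polynomial in `z, x, y` (in this order) to the line
`{(x₀, y, γ y + δ)}`, where `ℓ = (x₀, γ, δ)`. -/
noncomputable def lineY (ℓ : F × F × F) : MvPolynomial (Fin 3) F →ₐ[F] Polynomial F :=
  aeval ![Polynomial.C ℓ.2.1 * Polynomial.X + Polynomial.C ℓ.2.2, Polynomial.C ℓ.1, Polynomial.X]

/-- Exchange of the variables `x` and `y`. -/
noncomputable def swapXY : MvPolynomial (Fin 3) F ≃ₐ[F] MvPolynomial (Fin 3) F :=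
  renameEquiv F (Equiv.swap 1 2)

/-- The line `ℓ₁` in a plane `y = const` meets the line `ℓ₂` in a plane `x = const`. -/
def Meets (ℓ₁ ℓ₂ : F × F × F) : Prop :=
  ℓ₁.2.1 * ℓ₂.1 + ℓ₁.2.2 = ℓ₂.2.1 * ℓ₁.1 + ℓ₂.2.2

theorem Meets.symm {ℓ₁ ℓ₂ : F × F × F} (h : Meets ℓ₁ ℓ₂) : Meets ℓ₂ ℓ₁ := Eq.symm h

theorem lineX_swapXY (ℓ : F × F × F) (f : MvPolynomial (Fin 3) F) :
    lineX ℓ (swapXY f) = lineY ℓ f := by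
  simp only [lineX, lineY, swapXY, renameEquiv_apply, aeval_rename]
  congr 1
  congr 1
  funext i
  fin_cases i <;> simp [Equiv.swap_apply_def]

theorem swapXY_swapXY (f : MvPolynomial (Fin 3) F) : swapXY (swapXY f) = f := by
  simp only [swapXY, renameEquiv_apply, rename_rename]
  convert rename_id_apply f
  funext i
  fin_cases i <;> simp [Equiv.swap_apply_def]

theorem lineY_swapXY (ℓ : F × F × F) (f : MvPolynomial (Fin 3) F) :
    lineY ℓ (swapXY f) = lineX ℓ f := by
  rw [← lineX_swapXY, swapXY_swapXY]

theorem totalDegree_swapXY (f : MvPolynomial (Fin 3) F) :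
    (swapXY f).totalDegree = f.totalDegree := by
  simp only [swapXY, renameEquiv_apply]
  exact totalDegree_renameEquiv (Equiv.swap 1 2) f

theorem irreducible_swapXY {f : MvPolynomial (Fin 3) F} (hf : Irreducible f) :
    Irreducible (swapXY f) :=
  (MulEquiv.irreducible_iff (swapXY (F := F))).2 hf

theorem swapXY_dvd_swapXY {f h : MvPolynomial (Fin 3) F} : swapXY f ∣ swapXY h ↔ f ∣ h :=
  map_dvd_iff _

theorem degreeOf_zero_swapXY (f : MvPolynomial (Fin 3) F) :
    (swapXY f).degreeOf 0 = f.degreeOf 0 := by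
  have := degreeOf_rename_of_injective (p := f) (Equiv.swap (1 : Fin 3) 2).injective 0
  simpa [Equiv.swap_apply_def, swapXY] using this

theorem natDegree_lineX_le (ℓ : F × F × F) (f : MvPolynomial (Fin 3) F) :
    (lineX ℓ f).natDegree ≤ f.totalDegree := by
  have := aeval_natDegree_le f le_rfl
    ![Polynomial.C ℓ.2.1 * Polynomial.X + Polynomial.C ℓ.2.2, Polynomial.X, Polynomial.C ℓ.1]
    (n := 1) (by
      intro i
      fin_cases i <;> simp [-Polynomial.natDegree_add_C, Polynomial.natDegree_linear_le])
  simpa [lineX] using this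

theorem natDegree_lineY_le (ℓ : F × F × F) (f : MvPolynomial (Fin 3) F) :
    (lineY ℓ f).natDegree ≤ f.totalDegree := by
  rw [← lineX_swapXY, ← totalDegree_swapXY]; exact natDegree_lineX_le _ _

theorem aeval_lineX {T : Type*} [CommRing T] [Algebra F T] (ℓ : F × F × F)
    (f : MvPolynomial (Fin 3) F) (t : T) :
    Polynomial.aeval t (lineX ℓ f) =
      aeval ![algebraMap F T ℓ.2.1 * t + algebraMap F T ℓ.2.2, t, algebraMap F T ℓ.1] f := by
  rw [lineX, comp_aeval_apply]
  congr 1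
  congr 1
  funext i
  fin_cases i <;> simp

theorem aeval_lineY {T : Type*} [CommRing T] [Algebra F T] (ℓ : F × F × F)
    (f : MvPolynomial (Fin 3) F) (t : T) :
    Polynomial.aeval t (lineY ℓ f) =
      aeval ![algebraMap F T ℓ.2.1 * t + algebraMap F T ℓ.2.2, algebraMap F T ℓ.1, t] f := by
  rw [lineY, comp_aeval_apply]
  congr 1
  congr 1
  funext i
  fin_cases i <;> simp

theorem Meets.eval_eq {ℓ₁ ℓ₂ : F × F × F} (h : Meets ℓ₁ ℓ₂) (f : MvPolynomial (Fin 3) F) :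
    (lineX ℓ₁ f).eval ℓ₂.1 = (lineY ℓ₂ f).eval ℓ₁.1 := by
  have h1 := aeval_lineX (T := F) ℓ₁ f ℓ₂.1
  have h2 := aeval_lineY (T := F) ℓ₂ f ℓ₁.1
  simp only [Polynomial.coe_aeval_eq_eval, Algebra.algebraMap_self, RingHom.id_apply] at h1 h2
  rw [h1, h2, show ℓ₁.2.1 * ℓ₂.1 + ℓ₁.2.2 = ℓ₂.2.1 * ℓ₁.1 + ℓ₂.2.2 from h]

/-- A line not contained in a surface meets few lines contained in it. -/
theorem card_meets_le {f : MvPolynomial (Fin 3) F} {ℓ₂ : F × F × F} (hf : lineY ℓ₂ f ≠ 0)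
    (L : Finset (F × F × F)) (hinj : Set.InjOn Prod.fst (L : Set (F × F × F)))
    (hL : ∀ ℓ ∈ L, lineX ℓ f = 0 ∧ Meets ℓ ℓ₂) : L.card ≤ f.totalDegree := by
  calc L.card = (L.image Prod.fst).card := (Finset.card_image_of_injOn hinj).symm
    _ ≤ (lineY ℓ₂ f).roots.toFinset.card := by
        apply Finset.card_le_card
        intro y hy
        obtain ⟨ℓ, hℓ, rfl⟩ := Finset.mem_image.1 hy
        rw [Multiset.mem_toFinset, Polynomial.mem_roots hf, Polynomial.IsRoot.def,
          ← (hL ℓ hℓ).2.eval_eq, (hL ℓ hℓ).1, Polynomial.eval_zero]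
    _ ≤ (lineY ℓ₂ f).natDegree := (Multiset.toFinset_card_le _).trans (Polynomial.card_roots' _)
    _ ≤ f.totalDegree := natDegree_lineY_le _ _

theorem card_meets_le' {f : MvPolynomial (Fin 3) F} {ℓ₁ : F × F × F} (hf : lineX ℓ₁ f ≠ 0)
    (L : Finset (F × F × F)) (hinj : Set.InjOn Prod.fst (L : Set (F × F × F)))
    (hL : ∀ ℓ ∈ L, lineY ℓ f = 0 ∧ Meets ℓ₁ ℓ) : L.card ≤ f.totalDegree := by
  rw [← totalDegree_swapXY]
  refine card_meets_le (ℓ₂ := ℓ₁) (by rwa [lineY_swapXY]) L hinj fun ℓ hℓ => ?_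
  rw [lineX_swapXY]
  exact ⟨(hL ℓ hℓ).1, (hL ℓ hℓ).2.symm⟩

/-- A Bézout type bound for the number of lines common to two surfaces. -/
theorem card_lineY_le {f h : MvPolynomial (Fin 3) F} (hf : Irreducible f)
    (hdeg : f.degreeOf 0 ≠ 0) (hfh : ¬ f ∣ h) (L : Finset (F × F × F))
    (hinj : Set.InjOn Prod.fst (L : Set (F × F × F)))
    (hL : ∀ ℓ ∈ L, lineY ℓ f = 0 ∧ lineY ℓ h = 0) :
    L.card ≤ 2 * f.totalDegree * h.totalDegree := by
  obtain ⟨r, hr0, hrdeg, u, v, huv⟩ := exists_eliminant hf hdeg hfh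
  refine le_trans ?_ hrdeg
  have hP : finSuccEquiv F 1 r ≠ 0 := by simpa using hr0
  have hroot : ∀ ℓ ∈ L, (finSuccEquiv F 1 r).eval (C ℓ.1) = 0 := by
    intro ℓ hℓ
    have h1 : lineY ℓ (rename Fin.succ r) = 0 := by
      rw [huv, map_add, map_mul, map_mul, (hL ℓ hℓ).1, (hL ℓ hℓ).2]; ring
    have h2 := congrArg (Polynomial.aeval (X 0 : MvPolynomial (Fin 1) F)) h1
    rw [aeval_lineY, aeval_rename, map_zero] at h2
    rw [← h2, finSuccEquiv_apply, ← Polynomial.coe_evalRingHom, ← RingHom.comp_apply]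
    have : (Polynomial.evalRingHom (C ℓ.1 : MvPolynomial (Fin 1) F)).comp
        (eval₂Hom (Polynomial.C.comp C) fun i : Fin 2 =>
          Fin.cases Polynomial.X (fun k => Polynomial.C (X k)) i) =
        (aeval (![algebraMap F (MvPolynomial (Fin 1) F) ℓ.2.1 * X 0 +
          algebraMap F (MvPolynomial (Fin 1) F) ℓ.2.2, algebraMap F (MvPolynomial (Fin 1) F) ℓ.1,
          X 0] ∘ Fin.succ) : MvPolynomial (Fin 2) F →ₐ[F] MvPolynomial (Fin 1) F).toRingHom := by
      apply MvPolynomial.ringHom_ext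
      · intro a; simp [algebraMap_eq]
      · intro i
        fin_cases i
        · simp [algebraMap_eq]
        · have h3 : (Fin.cases Polynomial.X (fun k => Polynomial.C (X k)) (1 : Fin 2) :
              Polynomial (MvPolynomial (Fin 1) F)) = Polynomial.C (X 0) := rfl
          simp [h3]
    exact congrArg (fun φ => φ r) this
  calc L.card = (L.image fun ℓ => (C ℓ.1 : MvPolynomial (Fin 1) F)).card := by
        refine (Finset.card_image_of_injOn ?_).symm
        intro a ha b hb hab
        exact hinj ha hb (C_injective _ _ hab)
    _ ≤ (finSuccEquiv F 1 r).roots.toFinset.card := by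
        apply Finset.card_le_card
        intro y hy
        obtain ⟨ℓ, hℓ, rfl⟩ := Finset.mem_image.1 hy
        rw [Multiset.mem_toFinset, Polynomial.mem_roots hP, Polynomial.IsRoot.def, hroot ℓ hℓ]
    _ ≤ (finSuccEquiv F 1 r).natDegree :=
        (Multiset.toFinset_card_le _).trans (Polynomial.card_roots' _)
    _ ≤ r.totalDegree := natDegree_finSuccEquiv_le _

theorem card_lineX_le {f h : MvPolynomial (Fin 3) F} (hf : Irreducible f)
    (hdeg : f.degreeOf 0 ≠ 0) (hfh : ¬ f ∣ h) (L : Finset (F × F × F))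
    (hinj : Set.InjOn Prod.fst (L : Set (F × F × F)))
    (hL : ∀ ℓ ∈ L, lineX ℓ f = 0 ∧ lineX ℓ h = 0) :
    L.card ≤ 2 * f.totalDegree * h.totalDegree := by
  rw [← totalDegree_swapXY f, ← totalDegree_swapXY h]
  refine card_lineY_le (irreducible_swapXY hf) (by rwa [degreeOf_zero_swapXY])
    (by rwa [swapXY_dvd_swapXY]) L hinj fun ℓ hℓ => ?_
  rw [lineY_swapXY, lineY_swapXY]
  exact hL ℓ hℓ

/-- An irreducible surface independent of `z` cannot contain both a line in a plane `y = const`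
and a line in a plane `x = const`. -/
theorem false_of_degreeOf_zero {f : MvPolynomial (Fin 3) F} (hf : Irreducible f)
    (hdeg : f.degreeOf 0 = 0) {ℓ₁ ℓ₂ : F × F × F} (h₁ : lineX ℓ₁ f = 0) (h₂ : lineY ℓ₂ f = 0) :
    False := by
  obtain ⟨f', rfl⟩ : ∃ f', f = rename Fin.succ f' := by
    rw [← natDegree_finSuccEquiv] at hdeg
    refine ⟨(finSuccEquiv F 2 f).coeff 0, (finSuccEquiv F 2).injective ?_⟩
    rw [finSuccEquiv_rename_succ_eq]
    exact Polynomial.eq_C_of_natDegree_eq_zero hdeg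
  have hdvd : (X 2 - C ℓ₁.1 : MvPolynomial (Fin 3) F) ∣ rename Fin.succ f' := by
    have h1 := congrArg (Polynomial.aeval (X 1 : MvPolynomial (Fin 3) F)) h₁
    rw [aeval_lineX, aeval_rename, map_zero] at h1
    rw [← Ideal.mem_span_singleton, ← Ideal.Quotient.eq_zero_iff_mem]
    set I := Ideal.span {(X 2 - C ℓ₁.1 : MvPolynomial (Fin 3) F)}
    have h2 := congrArg (Ideal.Quotient.mkₐ F I) h1
    rw [map_zero, comp_aeval_apply] at h2
    rw [← h2, ← Ideal.Quotient.mkₐ_eq_mk F, rename_eq_aeval, comp_aeval_apply]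
    congr 2
    funext i
    fin_cases i
    · simp
    · simp only [Ideal.Quotient.mkₐ_eq_mk]
      refine Ideal.Quotient.eq.2 (Ideal.mem_span_singleton.2 ?_)
      simp [algebraMap_eq]
  obtain ⟨w, hw⟩ := hdvd
  have hX : (lineY ℓ₂ (X 2 - C ℓ₁.1 : MvPolynomial (Fin 3) F)) =
      Polynomial.X - Polynomial.C ℓ₁.1 := by
    simp [lineY, Polynomial.algebraMap_eq]
  rcases hf.isUnit_or_isUnit hw with h | h
  · have := h.map (lineY ℓ₂)
    rw [hX] at this
    exact Polynomial.not_isUnit_X_sub_C _ this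
  · rw [hw, map_mul, hX] at h₂
    rcases mul_eq_zero.1 h₂ with h3 | h3
    · exact Polynomial.X_sub_C_ne_zero _ h3
    · exact (h.map (lineY ℓ₂)).ne_zero h3

end Lines

section Ruled

open MvPolynomial

variable {F : Type*} [Field F]

theorem pderiv_comm_apply {R σ : Type*} [CommSemiring R] (i j : σ) (f : MvPolynomial σ R) :
    pderiv i (pderiv j f) = pderiv j (pderiv i f) := by
  ext m
  simp only [coeff_pderiv]
  rw [add_right_comm]
  by_cases h : i = j
  · subst h; rfl
  · simp [h, Ne.symm h]; ring

/-- The polynomial vanishing at those points of a surface where the tangent direction in the plane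
`y = const` is asymptotic. -/
noncomputable def flecX (f : MvPolynomial (Fin 3) F) : MvPolynomial (Fin 3) F :=
  pderiv 1 (pderiv 1 f) * pderiv 0 f ^ 2 - 2 * pderiv 1 (pderiv 0 f) * pderiv 1 f * pderiv 0 f +
    pderiv 0 (pderiv 0 f) * pderiv 1 f ^ 2

theorem totalDegree_flecX_le (f : MvPolynomial (Fin 3) F) :
    (flecX f).totalDegree ≤ 3 * f.totalDegree := by
  have h (i) (g : MvPolynomial (Fin 3) F) := totalDegree_pderiv_le i g
  have h0 := h 0 f
  have h1 := h 1 f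
  have h00 := (h 0 _).trans h0
  have h10 := (h 1 _).trans h0
  have h11 := (h 1 _).trans h1
  have e2 : (2 : MvPolynomial (Fin 3) F) = C 2 := (map_ofNat C 2).symm
  unfold flecX
  refine (totalDegree_add _ _).trans (max_le ((totalDegree_sub _ _).trans (max_le ?_ ?_)) ?_)
  · refine (totalDegree_mul _ _).trans ?_
    have := totalDegree_pow (pderiv 0 f) 2
    omega
  · rw [e2]
    have a1 := totalDegree_mul (C 2 * pderiv 1 (pderiv 0 f) * pderiv 1 f) (pderiv 0 f)
    have a2 := totalDegree_mul (C 2 * pderiv 1 (pderiv 0 f)) (pderiv 1 f)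
    have a3 := totalDegree_mul (C 2) (pderiv 1 (pderiv 0 f))
    rw [totalDegree_C] at a3
    omega
  · refine (totalDegree_mul _ _).trans ?_
    have := totalDegree_pow (pderiv 1 f) 2
    omega

theorem derivative_lineX (ℓ : F × F × F) (f : MvPolynomial (Fin 3) F) :
    Polynomial.derivative (lineX ℓ f) =
      lineX ℓ (pderiv 0 f) * Polynomial.C ℓ.2.1 + lineX ℓ (pderiv 1 f) := by
  rw [lineX, derivative_aeval, Fin.sum_univ_three]
  simp

theorem lineX_flecX {ℓ : F × F × F} {f : MvPolynomial (Fin 3) F} (h : lineX ℓ f = 0) :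
    lineX ℓ (flecX f) = 0 := by
  have h1 := derivative_lineX ℓ f
  rw [h, Polynomial.derivative_zero] at h1
  have h2 := congrArg Polynomial.derivative h1
  simp only [Polynomial.derivative_add, Polynomial.derivative_mul, Polynomial.derivative_C,
    Polynomial.derivative_zero, derivative_lineX, mul_zero, add_zero] at h2
  rw [pderiv_comm_apply 0 1 f] at h2
  simp only [flecX, map_add, map_sub, map_mul, map_pow, map_ofNat]
  have h3 : lineX ℓ (pderiv 1 f) = - (lineX ℓ (pderiv 0 f) * Polynomial.C ℓ.2.1) := by
    linear_combination -h1
  rw [h3]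
  linear_combination -(lineX ℓ (pderiv 0 f)) ^ 2 * h2

theorem pderiv_zero_ne_zero {f : MvPolynomial (Fin 3) F} (hdeg : f.degreeOf 0 ≠ 0)
    (hchar : ∀ m : ℕ, 0 < m → m ≤ f.totalDegree → (m : F) ≠ 0) : pderiv 0 f ≠ 0 := by
  obtain ⟨s, hs, hs0⟩ : ∃ s ∈ f.support, s 0 ≠ 0 := by
    by_contra! h
    apply hdeg
    rw [degreeOf_eq_sup]
    exact Nat.le_zero.1 (Finset.sup_le fun s hs => (h s hs).le)
  intro h
  have h1 := congrArg (coeff (s - Finsupp.single 0 1)) h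
  have hle : Finsupp.single 0 1 ≤ s := by
    rw [Finsupp.single_le_iff]; omega
  rw [coeff_pderiv, tsub_add_cancel_of_le hle, coeff_zero] at h1
  have h2 : (((s - Finsupp.single 0 1 : Fin 3 →₀ ℕ) 0 : ℕ) : F) + 1 = ((s 0 : ℕ) : F) := by
    rw [Finsupp.tsub_apply, Finsupp.single_eq_same, Nat.cast_sub (by omega)]; simp
  rw [h2] at h1
  refine (mul_ne_zero (mem_support_iff.1 hs) (hchar (s 0) (by omega) ?_)) h1
  exact (monomial_le_degreeOf 0 hs).trans (degreeOf_le_totalDegree f 0)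

/-- Vanishing of a polynomial in an auxiliary variable `u` satisfying a second order differential
equation with vanishing initial data. -/
theorem eq_zero_of_ode {S : Type*} [CommRing S] [IsDomain S] {H P G W : Polynomial S} {N : ℕ}
    (hN : H.natDegree ≤ N) (hchar : ∀ m : ℕ, 0 < m → m ≤ N → (m : S) ≠ 0)
    (h0 : H.coeff 0 = 0) (h1 : H.coeff 1 = 0) (hP : P.coeff 0 ≠ 0) (hG : H ∣ G)
    (hode : P * Polynomial.derivative (Polynomial.derivative H) =
      G + Polynomial.derivative H * W) : H = 0 := by
  by_contra hH
  obtain ⟨m, hm⟩ : ∃ m, H.natTrailingDegree = m + 2 := by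
    refine Nat.exists_eq_add_of_le' ?_
    by_contra! hlt
    have := Polynomial.trailingCoeff_nonzero_iff_nonzero.2 hH
    rw [Polynomial.trailingCoeff] at this
    interval_cases H.natTrailingDegree <;> contradiction
  have hlow (d : ℕ) (hd : d < m + 2) : H.coeff d = 0 :=
    Polynomial.coeff_eq_zero_of_lt_natTrailingDegree (by omega)
  have hne : H.coeff (m + 2) ≠ 0 := by
    rw [← hm]; exact Polynomial.trailingCoeff_nonzero_iff_nonzero.2 hH
  have hmN : m + 2 ≤ N := by
    rw [← hm]; exact (Polynomial.natTrailingDegree_le_natDegree _).trans hN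
  have hd1 : Polynomial.X ^ (m + 1) ∣ Polynomial.derivative H := by
    rw [Polynomial.X_pow_dvd_iff]
    intro d hd
    rw [Polynomial.coeff_derivative, hlow _ (by omega), zero_mul]
  have hd0 : Polynomial.X ^ (m + 1) ∣ H := by
    rw [Polynomial.X_pow_dvd_iff]
    intro d hd
    exact hlow _ (by omega)
  have hd2 : Polynomial.X ^ m ∣ Polynomial.derivative (Polynomial.derivative H) := by
    rw [Polynomial.X_pow_dvd_iff]
    intro d hd
    rw [Polynomial.coeff_derivative, Polynomial.coeff_derivative, hlow _ (by omega), zero_mul,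
      zero_mul]
  obtain ⟨Q, hQ⟩ := hd2
  have hrhs : (P * Polynomial.derivative (Polynomial.derivative H)).coeff m = 0 := by
    rw [hode]
    exact Polynomial.X_pow_dvd_iff.1 (dvd_add (hd0.trans hG) (hd1.mul_right W)) m (by omega)
  have hQ0 : Q.coeff 0 = H.coeff (m + 2) * (((m + 2 : ℕ) : S) * ((m + 1 : ℕ) : S)) := by
    have := congrArg (fun p => Polynomial.coeff p m) hQ
    simp only [Polynomial.coeff_derivative, Polynomial.coeff_X_pow_mul', le_refl, if_true,
      Nat.sub_self] at this
    rw [← this]; push_cast; ring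
  rw [hQ, mul_left_comm, Polynomial.coeff_X_pow_mul', if_pos le_rfl, Nat.sub_self,
    Polynomial.mul_coeff_zero, hQ0] at hrhs
  exact mul_ne_zero hP (mul_ne_zero hne (mul_ne_zero (hchar _ (by omega) hmN)
    (hchar _ (by omega) (by omega)))) hrhs

/-- Union of the tangent lines, in planes `y = const`, to the surface `f = 0` along the line
`ℓ`. -/
noncomputable def tangentForm (ℓ : F × F × F) (f : MvPolynomial (Fin 3) F) :
    MvPolynomial (Fin 3) F :=
  Polynomial.aeval (X 2) (lineY ℓ (pderiv 0 f)) * (X 0 - C ℓ.2.1 * X 2 - C ℓ.2.2) +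
    Polynomial.aeval (X 2) (lineY ℓ (pderiv 1 f)) * (X 1 - C ℓ.1)

end Ruled

section TangentODE

open Polynomial

variable {F : Type*} [Field F]

theorem aeval_tangent_eq_zero {f : MvPolynomial (Fin 3) F} {ℓ : F × F × F}
    (hflec : f ∣ flecX f) (hchar : ∀ m : ℕ, 0 < m → m ≤ f.totalDegree → (m : F) ≠ 0)
    (hℓ : lineY ℓ f = 0) (hz : lineY ℓ (MvPolynomial.pderiv 0 f) ≠ 0) :
    MvPolynomial.aeval ![C (C ℓ.2.1 * X + C ℓ.2.2) - C (lineY ℓ (MvPolynomial.pderiv 1 f)) * X,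
      C (C ℓ.1) + C (lineY ℓ (MvPolynomial.pderiv 0 f)) * X, (C X : F[X][X])] f = 0 := by
  set e := lineY ℓ (MvPolynomial.pderiv 0 f) with he
  set b := lineY ℓ (MvPolynomial.pderiv 1 f) with hb
  set v : Fin 3 → F[X][X] := ![C (C ℓ.2.1 * X + C ℓ.2.2) - C b * X, C (C ℓ.1) + C e * X, C X]
    with hv
  have hder (g : MvPolynomial (Fin 3) F) : derivative (MvPolynomial.aeval v g) =
      MvPolynomial.aeval v (MvPolynomial.pderiv 1 g) * C e -
        MvPolynomial.aeval v (MvPolynomial.pderiv 0 g) * C b := by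
    rw [MvPolynomial.derivative_aeval, Fin.sum_univ_three]
    simp [hv]
    ring
  have hco (g : MvPolynomial (Fin 3) F) : (MvPolynomial.aeval v g).coeff 0 = lineY ℓ g := by
    have h1 : (MvPolynomial.aeval v g).coeff 0 =
        (Polynomial.aeval (0 : F[X])) (MvPolynomial.aeval v g) := by
      rw [Polynomial.coe_aeval_eq_eval, coeff_zero_eq_eval_zero]
    have h2 : (Polynomial.aeval (0 : F[X])) (MvPolynomial.aeval v g) =
        ((Polynomial.aeval (R := F[X]) (0 : F[X])).restrictScalars F)
          (MvPolynomial.aeval v g) := rfl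
    rw [h1, h2, MvPolynomial.comp_aeval_apply, lineY]
    congr 2
    funext i
    fin_cases i <;> simp [hv]
  refine eq_zero_of_ode (N := f.totalDegree)
    (P := MvPolynomial.aeval v (MvPolynomial.pderiv 0 f) ^ 2)
    (G := C e ^ 2 * MvPolynomial.aeval v (flecX f))
    (W := MvPolynomial.aeval v (MvPolynomial.pderiv 0 (MvPolynomial.pderiv 0 f)) *
      (derivative (MvPolynomial.aeval v f) -
        2 * MvPolynomial.aeval v (MvPolynomial.pderiv 1 f) * C e) +
      2 * MvPolynomial.aeval v (MvPolynomial.pderiv 1 (MvPolynomial.pderiv 0 f)) *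
        MvPolynomial.aeval v (MvPolynomial.pderiv 0 f) * C e)
    ?_ ?_ ?_ ?_ ?_ ?_ ?_
  · have h1 (g : MvPolynomial (Fin 3) F) : MvPolynomial.aeval v g =
      MvPolynomial.aeval v (MvPolynomial.map (algebraMap F F[X]) g) := by
      rw [MvPolynomial.aeval_map_algebraMap]
    rw [h1]
    refine (MvPolynomial.aeval_natDegree_le (m := f.totalDegree) (n := 1) _ ?_ v ?_).trans (by simp)
    · exact Finset.sup_mono (MvPolynomial.support_map_subset _ _)
    · intro i
      fin_cases i
      · refine (natDegree_sub_le _ _).trans (max_le ?_ ?_)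
        · exact (natDegree_C _).le.trans (by simp)
        · exact ((natDegree_C_mul_le _ _).trans natDegree_X_le)
      · exact (natDegree_add_le _ _).trans (max_le ((natDegree_C _).le.trans (by simp))
          (((natDegree_C_mul_le _ _).trans natDegree_X_le)))
      · exact (natDegree_C _).le.trans (by simp)
  · intro m hm hm'
    have := hchar m hm hm'
    rw [← map_natCast (C : F →+* F[X])]
    simpa only [ne_eq, C_eq_zero] using this
  · rw [hco, hℓ]
  · have h1 := congrArg (fun p => coeff p 0) (hder f)
    simp only [coeff_derivative, coeff_sub, coeff_mul_C, hco] at h1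
    rw [← he, ← hb] at h1
    simpa [mul_comm b e] using h1
  · rw [pow_two, mul_coeff_zero, hco]
    exact mul_ne_zero hz hz
  · exact (_root_.map_dvd (MvPolynomial.aeval v) hflec).mul_left _
  · have h2 : derivative (derivative (MvPolynomial.aeval v f)) =
        (MvPolynomial.aeval v (MvPolynomial.pderiv 1 (MvPolynomial.pderiv 1 f)) * C e -
          MvPolynomial.aeval v (MvPolynomial.pderiv 1 (MvPolynomial.pderiv 0 f)) * C b) * C e -
        (MvPolynomial.aeval v (MvPolynomial.pderiv 1 (MvPolynomial.pderiv 0 f)) * C e -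
          MvPolynomial.aeval v (MvPolynomial.pderiv 0 (MvPolynomial.pderiv 0 f)) * C b) * C b := by
      rw [hder, derivative_sub, derivative_mul, derivative_mul, hder, hder, derivative_C,
        derivative_C, pderiv_comm_apply 0 1 f]
      ring
    rw [h2, hder]
    simp only [flecX, map_add, map_sub, map_mul, map_pow, map_ofNat]
    ring

end TangentODE

section TangentForm

open MvPolynomial

variable {F : Type*} [Field F]

theorem dvd_tangentForm {f : MvPolynomial (Fin 3) F} {ℓ : F × F × F} (hf : Irreducible f)
    (hdeg : f.degreeOf 0 ≠ 0)
    (hflec : f ∣ flecX f) (hchar : ∀ m : ℕ, 0 < m → m ≤ f.totalDegree → (m : F) ≠ 0)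
    (hℓ : lineY ℓ f = 0) (hz : lineY ℓ (pderiv 0 f) ≠ 0) :
    f ∣ tangentForm ℓ f := by
  by_contra hnd
  obtain ⟨r, hr0, -, u, w, huw⟩ := exists_eliminant hf hdeg hnd
  let K := FractionRing (MvPolynomial (Fin 2) F)
  let x : K := algebraMap (MvPolynomial (Fin 2) F) K (X 0)
  let y : K := algebraMap (MvPolynomial (Fin 2) F) K (X 1)
  set e := lineY ℓ (pderiv 0 f) with he
  set b := lineY ℓ (pderiv 1 f) with hb
  have hinj := FaithfulSMul.algebraMap_injective (MvPolynomial (Fin 2) F) K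
  have hey : Polynomial.aeval y e ≠ 0 := by
    intro h
    rw [Polynomial.aeval_algebraMap_apply] at h
    have h2 := hinj (h.trans (map_zero _).symm)
    exact hz ((transcendental_iff.1 (MvPolynomial.transcendental_X F (1 : Fin 2))) _ h2)
  let t : K := (x - algebraMap F K ℓ.1) / Polynomial.aeval y e
  let θ : MvPolynomial (Fin 3) F →ₐ[F] K :=
    aeval ![algebraMap F K ℓ.2.1 * y + algebraMap F K ℓ.2.2 - Polynomial.aeval y b * t, x, y]
  have hθf : θ f = 0 := by
    have h1 := aeval_tangent_eq_zero hflec hchar hℓ hz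
    have h2 := congrArg
      (Polynomial.aevalTower (Polynomial.aeval (R := F) y) t) h1
    rw [map_zero, comp_aeval_apply] at h2
    rw [← h2]
    change aeval _ f = aeval _ f
    congr 2
    funext i
    fin_cases i
    · simp [hb]
    · simp [t, ← he, mul_div_cancel₀ _ hey]
    · simp
  have hθl : θ (tangentForm ℓ f) = 0 := by
    have hp (p : Polynomial F) : θ (Polynomial.aeval (X 2) p) = Polynomial.aeval y p := by
      rw [← Polynomial.aeval_algHom_apply]
      simp [θ]
    have h0 : θ (X 0) = algebraMap F K ℓ.2.1 * y + algebraMap F K ℓ.2.2 -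
      Polynomial.aeval y b * t := by simp [θ]
    have h1 : θ (X 1) = x := by simp [θ]
    have h2 : θ (X 2) = y := by simp [θ]
    have hC (a : F) : θ (C a) = algebraMap F K a := θ.commutes a
    have ht : Polynomial.aeval y e * t = x - algebraMap F K ℓ.1 := mul_div_cancel₀ _ hey
    simp only [tangentForm, map_add, map_sub, map_mul, hp, h0, h1, h2, hC]
    rw [← he, ← hb]
    linear_combination (-Polynomial.aeval y b) * ht
  have hθr : θ (rename Fin.succ r) = algebraMap (MvPolynomial (Fin 2) F) K r := by
    simp only [θ, aeval_rename]
    have : (![algebraMap F K ℓ.2.1 * y + algebraMap F K ℓ.2.2 - Polynomial.aeval y b * t, x, y] ∘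
        Fin.succ) = fun i => algebraMap (MvPolynomial (Fin 2) F) K (X i) := by
      funext i
      fin_cases i <;> rfl
    rw [this]
    exact (aeval_algebraMap_apply K X r).trans (by rw [aeval_X_left_apply])
  rw [huw, map_add, map_mul, map_mul, hθf, hθl, zero_mul, zero_mul, add_zero] at hθr
  exact hr0 (hinj (hθr.symm.trans (map_zero _).symm))

end TangentForm

section Bilinear

open MvPolynomial

variable {F : Type*} [Field F]

/-- Scaling of the variables `z` and `x` by a new variable. -/
noncomputable def scaleZX : MvPolynomial (Fin 3) F →ₐ[F] Polynomial (MvPolynomial (Fin 3) F) :=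
  aeval ![Polynomial.C (X 0) * Polynomial.X, Polynomial.C (X 1) * Polynomial.X,
    Polynomial.C (X 2)]

theorem scaleZX_monomial (s : Fin 3 →₀ ℕ) (a : F) :
    scaleZX (monomial s a) = Polynomial.C (monomial s a) * Polynomial.X ^ (s 0 + s 1) := by
  have h : (monomial s a : MvPolynomial (Fin 3) F) = C a * (X 0 ^ s 0 * X 1 ^ s 1 * X 2 ^ s 2) := by
    rw [monomial_eq, Finsupp.prod_fintype _ _ (by simp), Fin.prod_univ_three]
  have h0 : scaleZX (C a : MvPolynomial (Fin 3) F) = Polynomial.C (C a) :=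
    (scaleZX (F := F)).commutes a
  have h1 : scaleZX (X 0 : MvPolynomial (Fin 3) F) = Polynomial.C (X 0) * Polynomial.X := by
    simp [scaleZX]
  have h2 : scaleZX (X 1 : MvPolynomial (Fin 3) F) = Polynomial.C (X 1) * Polynomial.X := by
    simp [scaleZX]
  have h3 : scaleZX (X 2 : MvPolynomial (Fin 3) F) = Polynomial.C (X 2) := by
    simp [scaleZX]
  rw [h]
  simp only [map_mul, map_pow, h0, h1, h2, h3]
  ring

theorem coeff_coeff_scaleZX (f : MvPolynomial (Fin 3) F) (n : ℕ) (s : Fin 3 →₀ ℕ) :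
    ((scaleZX f).coeff n).coeff s = if s 0 + s 1 = n then f.coeff s else 0 := by
  induction f using MvPolynomial.induction_on' with
  | monomial t a =>
    rw [scaleZX_monomial, Polynomial.coeff_C_mul, Polynomial.coeff_X_pow]
    by_cases h : t = s
    · subst h
      by_cases h' : t 0 + t 1 = n
      · simp [h']
      · simp [h', Ne.symm h']
    · split_ifs <;> simp [coeff_monomial, h]
  | add p q hp hq =>
    rw [map_add, Polynomial.coeff_add, coeff_add, hp, hq, coeff_add]
    split_ifs <;> simp

theorem add_le_natDegree_scaleZX {f : MvPolynomial (Fin 3) F} {s : Fin 3 →₀ ℕ}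
    (hs : f.coeff s ≠ 0) : s 0 + s 1 ≤ (scaleZX f).natDegree := by
  apply Polynomial.le_natDegree_of_ne_zero
  intro h
  have := coeff_coeff_scaleZX f (s 0 + s 1) s
  rw [h, if_pos rfl, coeff_zero] at this
  exact hs this.symm

theorem scaleZX_ne_zero {f : MvPolynomial (Fin 3) F} (hf : f ≠ 0) : scaleZX f ≠ 0 := by
  obtain ⟨s, hs⟩ := ne_zero_iff.1 hf
  intro h
  have := coeff_coeff_scaleZX f (s 0 + s 1) s
  rw [h, if_pos rfl, Polynomial.coeff_zero, coeff_zero] at this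
  exact hs this.symm

theorem natDegree_scaleZX_tangentForm_le (ℓ : F × F × F) (f : MvPolynomial (Fin 3) F) :
    (scaleZX (tangentForm ℓ f)).natDegree ≤ 1 := by
  have h2 : scaleZX (X 2 : MvPolynomial (Fin 3) F) = Polynomial.C (X 2) := by
    simp [scaleZX]
  have hp (p : Polynomial F) : scaleZX (Polynomial.aeval (X 2) p) =
      Polynomial.C (Polynomial.aeval (X 2 : MvPolynomial (Fin 3) F) p) := by
    rw [← Polynomial.aeval_algHom_apply, h2]
    exact Polynomial.aeval_algebraMap_apply (Polynomial (MvPolynomial (Fin 3) F)) (X 2) p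
  have h0 (a : F) : scaleZX (C a : MvPolynomial (Fin 3) F) = Polynomial.C (C a) :=
    (scaleZX (F := F)).commutes a
  have hX0 : scaleZX (X 0 : MvPolynomial (Fin 3) F) = Polynomial.C (X 0) * Polynomial.X := by
    simp [scaleZX]
  have hX1 : scaleZX (X 1 : MvPolynomial (Fin 3) F) = Polynomial.C (X 1) * Polynomial.X := by
    simp [scaleZX]
  simp only [tangentForm, map_add, map_sub, map_mul, hp, h0, h2, hX0, hX1]
  compute_degree

theorem tangentForm_ne_zero {ℓ : F × F × F} {f : MvPolynomial (Fin 3) F}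
    (hz : lineY ℓ (pderiv 0 f) ≠ 0) : tangentForm ℓ f ≠ 0 := by
  intro h
  have h1 := congrArg (aeval (R := F) ![Polynomial.C ℓ.2.1 * Polynomial.X + Polynomial.C ℓ.2.2 + 1,
    Polynomial.C ℓ.1, (Polynomial.X : Polynomial F)]) h
  apply hz
  have hp (p : Polynomial F) : (aeval (R := F) ![Polynomial.C ℓ.2.1 * Polynomial.X +
      Polynomial.C ℓ.2.2 + 1, Polynomial.C ℓ.1, (Polynomial.X : Polynomial F)])
      (Polynomial.aeval (X 2) p) = p := by
    rw [← Polynomial.aeval_algHom_apply]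
    simp
  simp only [tangentForm, map_add, map_sub, map_mul, hp, map_zero] at h1
  simp only [aeval_X, Matrix.cons_val, aeval_C, Polynomial.algebraMap_eq] at h1
  linear_combination h1

theorem add_le_one_of_dvd_flecX {f : MvPolynomial (Fin 3) F} {ℓ : F × F × F} (hf : Irreducible f)
    (hdeg : f.degreeOf 0 ≠ 0)
    (hflec : f ∣ flecX f) (hchar : ∀ m : ℕ, 0 < m → m ≤ f.totalDegree → (m : F) ≠ 0)
    (hℓ : lineY ℓ f = 0) (hz : lineY ℓ (pderiv 0 f) ≠ 0) {s : Fin 3 →₀ ℕ} (hs : f.coeff s ≠ 0) :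
    s 0 + s 1 ≤ 1 :=
  (add_le_natDegree_scaleZX hs).trans <| (Polynomial.natDegree_le_of_dvd
    (_root_.map_dvd scaleZX (dvd_tangentForm hf hdeg hflec hchar hℓ hz))
    (scaleZX_ne_zero (tangentForm_ne_zero hz))).trans (natDegree_scaleZX_tangentForm_le ℓ f)

theorem eq_bilinear {f : MvPolynomial (Fin 3) F} (h1 : ∀ s, f.coeff s ≠ 0 → s 0 + s 1 ≤ 1)
    (h2 : ∀ s, f.coeff s ≠ 0 → s 0 + s 2 ≤ 1) :
    ∃ c p q r s : F, f = C c * X 0 + C p * (X 1 * X 2) + C q * X 1 + C r * X 2 + C s := by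
  let e : Fin 5 → (Fin 3 →₀ ℕ) := ![Finsupp.single 0 1, Finsupp.single 1 1 + Finsupp.single 2 1,
    Finsupp.single 1 1, Finsupp.single 2 1, 0]
  have hsum : f = ∑ i, monomial (e i) (f.coeff (e i)) := by
    ext m
    rw [coeff_sum]
    simp only [coeff_monomial]
    by_cases hm : f.coeff m = 0
    · rw [hm]
      refine (Finset.sum_eq_zero fun i _ => ?_).symm
      split_ifs with h
      · rw [h, hm]
      · rfl
    have hinj : Function.Injective e := by
      intro i j hij
      have h0 := DFunLike.congr_fun hij 0
      have h1 := DFunLike.congr_fun hij 1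
      have h2 := DFunLike.congr_fun hij 2
      fin_cases i <;> fin_cases j <;> simp [e] at h0 h1 h2 ⊢
    obtain ⟨i, rfl⟩ : ∃ i, e i = m := by
      have ha := h1 m hm
      have hb := h2 m hm
      have key (i : Fin 5) (h0 : e i 0 = m 0) (h1 : e i 1 = m 1) (h2 : e i 2 = m 2) :
          ∃ i, e i = m := by
        refine ⟨i, Finsupp.ext fun j => ?_⟩
        fin_cases j
        · exact h0
        · exact h1
        · exact h2
      have hc : m 0 = 1 ∧ m 1 = 0 ∧ m 2 = 0 ∨ m 0 = 0 ∧ m 1 = 1 ∧ m 2 = 1 ∨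
          m 0 = 0 ∧ m 1 = 1 ∧ m 2 = 0 ∨ m 0 = 0 ∧ m 1 = 0 ∧ m 2 = 1 ∨
          m 0 = 0 ∧ m 1 = 0 ∧ m 2 = 0 := by omega
      rcases hc with ⟨h0, h1, h2⟩ | ⟨h0, h1, h2⟩ | ⟨h0, h1, h2⟩ | ⟨h0, h1, h2⟩ | ⟨h0, h1, h2⟩
      · exact key 0 (by simp [e, h0]) (by simp [e, h1]) (by simp [e, h2])
      · exact key 1 (by simp [e, h0]) (by simp [e, h1]) (by simp [e, h2])
      · exact key 2 (by simp [e, h0]) (by simp [e, h1]) (by simp [e, h2])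
      · exact key 3 (by simp [e, h0]) (by simp [e, h1]) (by simp [e, h2])
      · exact key 4 (by simp [e, h0]) (by simp [e, h1]) (by simp [e, h2])
    rw [Finset.sum_eq_single i (fun j _ hj => if_neg fun h => hj (hinj h))
      (fun h => absurd (Finset.mem_univ i) h), if_pos rfl]
  refine ⟨f.coeff (e 0), f.coeff (e 1), f.coeff (e 2), f.coeff (e 3), f.coeff (e 4), ?_⟩
  conv_lhs => rw [hsum]
  rw [Fin.sum_univ_five]
  have h (i j : Fin 3) (a : F) : monomial (Finsupp.single i 1 + Finsupp.single j 1) a =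
      C a * (X i * X j) := by
    rw [X, X, monomial_mul, C_mul_monomial]; simp
  have h' (i : Fin 3) (a : F) : monomial (Finsupp.single i 1) a = C a * X i := by
    rw [X, C_mul_monomial, mul_one]
  rw [← h', ← h, ← h', ← h']
  rfl

/-- The lines contained in a quadric `z = p x y + q x + r y + s`. -/
theorem exists_bilinear {f : MvPolynomial (Fin 3) F} (hdeg : f.degreeOf 0 ≠ 0)
    (h1 : ∀ s, f.coeff s ≠ 0 → s 0 + s 1 ≤ 1) (h2 : ∀ s, f.coeff s ≠ 0 → s 0 + s 2 ≤ 1) :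
    ∃ p q r s : F, (∀ ℓ, lineX ℓ f = 0 → ℓ.2.1 = p * ℓ.1 + q ∧ ℓ.2.2 = r * ℓ.1 + s) ∧
      ∀ ℓ, lineY ℓ f = 0 → ℓ.2.1 = p * ℓ.1 + r ∧ ℓ.2.2 = q * ℓ.1 + s := by
  obtain ⟨c, p, q, r, s, rfl⟩ := eq_bilinear h1 h2
  have hc : c ≠ 0 := by
    rintro rfl
    apply hdeg
    have : (C 0 * X 0 + C p * (X 1 * X 2) + C q * X 1 + C r * X 2 + C s : MvPolynomial (Fin 3) F) =
        rename Fin.succ (C p * (X 0 * X 1) + C q * X 0 + C r * X 1 + C s) := by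
      simp
    rw [this, ← natDegree_finSuccEquiv, finSuccEquiv_rename_succ_eq, Polynomial.natDegree_C]
  have key (u v a b : F) (h : Polynomial.C u * Polynomial.X + Polynomial.C v = 0)
      (ha : u = c * a) (hb : v = c * b) : a = 0 ∧ b = 0 := by
    have h0 := congrArg (fun P => Polynomial.coeff P 0) h
    have h1 := congrArg (fun P => Polynomial.coeff P 1) h
    simp at h0 h1
    subst ha hb
    exact ⟨(mul_eq_zero.1 h1).resolve_left hc, (mul_eq_zero.1 h0).resolve_left hc⟩
  refine ⟨-p / c, -q / c, -r / c, -s / c, fun ℓ hℓ => ?_, fun ℓ hℓ => ?_⟩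
  · have := key (c * ℓ.2.1 + p * ℓ.1 + q) (c * ℓ.2.2 + r * ℓ.1 + s)
      (ℓ.2.1 - (-p / c * ℓ.1 + -q / c)) (ℓ.2.2 - (-r / c * ℓ.1 + -s / c)) ?_
      (by field_simp; ring) (by field_simp; ring)
    · exact ⟨sub_eq_zero.1 this.1, sub_eq_zero.1 this.2⟩
    · rw [← hℓ]
      simp only [lineX, map_add, map_mul, aeval_X, aeval_C, Matrix.cons_val,
        Polynomial.algebraMap_eq]
      ring
  · have := key (c * ℓ.2.1 + p * ℓ.1 + r) (c * ℓ.2.2 + q * ℓ.1 + s)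
      (ℓ.2.1 - (-p / c * ℓ.1 + -r / c)) (ℓ.2.2 - (-q / c * ℓ.1 + -s / c)) ?_
      (by field_simp; ring) (by field_simp; ring)
    · exact ⟨sub_eq_zero.1 this.1, sub_eq_zero.1 this.2⟩
    · rw [← hℓ]
      simp only [lineY, map_add, map_mul, aeval_X, aeval_C, Matrix.cons_val,
        Polynomial.algebraMap_eq]
      ring

theorem pderiv_zero_swapXY (f : MvPolynomial (Fin 3) F) :
    pderiv 0 (swapXY f) = swapXY (pderiv 0 f) := by
  have := pderiv_rename (Equiv.swap (1 : Fin 3) 2).injective 0 f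
  simpa [swapXY, Equiv.swap_apply_def] using this

theorem coeff_swapXY (f : MvPolynomial (Fin 3) F) (s : Fin 3 →₀ ℕ) :
    (swapXY f).coeff (s.mapDomain (Equiv.swap 1 2)) = f.coeff s := by
  simp only [swapXY, renameEquiv_apply]
  exact coeff_rename_mapDomain _ (Equiv.swap (1 : Fin 3) 2).injective f s

/-- An irreducible surface containing the given lines is a quadric, or one of the two families
of lines lies on a second surface of comparable degree. -/
theorem surface_dichotomy {f : MvPolynomial (Fin 3) F} (hf : Irreducible f)
    (hdeg : f.degreeOf 0 ≠ 0) (hchar : ∀ m : ℕ, 0 < m → m ≤ f.totalDegree → (m : F) ≠ 0)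
    {L₁ L₂ : Finset (F × F × F)} (hL₁ : ∀ ℓ ∈ L₁, lineX ℓ f = 0) (hL₂ : ∀ ℓ ∈ L₂, lineY ℓ f = 0) :
    (∃ h, ¬ f ∣ h ∧ h.totalDegree ≤ 3 * f.totalDegree ∧
      ((∀ ℓ ∈ L₁, lineX ℓ h = 0) ∨ ∀ ℓ ∈ L₂, lineY ℓ h = 0)) ∨
    ∃ p q r s : F, (∀ ℓ ∈ L₁, ℓ.2.1 = p * ℓ.1 + q ∧ ℓ.2.2 = r * ℓ.1 + s) ∧
      ∀ ℓ ∈ L₂, ℓ.2.1 = p * ℓ.1 + r ∧ ℓ.2.2 = q * ℓ.1 + s := by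
  have hz := pderiv_zero_ne_zero hdeg hchar
  have hzd : ¬ f ∣ pderiv 0 f := fun h => by
    have h1 := totalDegree_le_of_dvd_of_isDomain h hz
    have h2 := totalDegree_pderiv_lt 0 f hz
    omega
  have hzdeg : (pderiv 0 f).totalDegree ≤ 3 * f.totalDegree :=
    (totalDegree_pderiv_le 0 f).trans (by omega)
  by_cases h1 : ∃ ℓ ∈ L₁, lineX ℓ (pderiv 0 f) ≠ 0
  swap
  · push Not at h1
    exact Or.inl ⟨_, hzd, hzdeg, Or.inl h1⟩
  by_cases h2 : ∃ ℓ ∈ L₂, lineY ℓ (pderiv 0 f) ≠ 0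
  swap
  · push Not at h2
    exact Or.inl ⟨_, hzd, hzdeg, Or.inr h2⟩
  by_cases hfx : f ∣ flecX f
  swap
  · exact Or.inl ⟨_, hfx, totalDegree_flecX_le f, Or.inl fun ℓ hℓ => lineX_flecX (hL₁ ℓ hℓ)⟩
  by_cases hfy : swapXY f ∣ flecX (swapXY f)
  swap
  · refine Or.inl ⟨swapXY (flecX (swapXY f)), ?_, ?_, Or.inr fun ℓ hℓ => ?_⟩
    · rw [← swapXY_dvd_swapXY, swapXY_swapXY]
      exact hfy
    · rw [totalDegree_swapXY]
      exact (totalDegree_flecX_le _).trans_eq (by rw [totalDegree_swapXY])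
    · rw [lineY_swapXY]
      apply lineX_flecX
      rw [lineX_swapXY]
      exact hL₂ ℓ hℓ
  obtain ⟨ℓ₁, hℓ₁, hz₁⟩ := h1
  obtain ⟨ℓ₂, hℓ₂, hz₂⟩ := h2
  have hs1 : ∀ s, f.coeff s ≠ 0 → s 0 + s 1 ≤ 1 := fun s hs =>
    add_le_one_of_dvd_flecX hf hdeg hfx hchar (hL₂ _ hℓ₂) hz₂ hs
  have hs2 : ∀ s, f.coeff s ≠ 0 → s 0 + s 2 ≤ 1 := fun s hs => by
    have := add_le_one_of_dvd_flecX (ℓ := ℓ₁) (irreducible_swapXY hf)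
      (by rwa [degreeOf_zero_swapXY]) hfy (by rwa [totalDegree_swapXY])
      (by rw [lineY_swapXY]; exact hL₁ _ hℓ₁) (by rwa [pderiv_zero_swapXY, lineY_swapXY])
      (s := s.mapDomain (Equiv.swap 1 2)) (by rwa [coeff_swapXY])
    have h0 := Finsupp.mapDomain_apply (Equiv.swap (1 : Fin 3) 2).injective s 0
    have h2 := Finsupp.mapDomain_apply (Equiv.swap (1 : Fin 3) 2).injective s 2
    rw [Equiv.swap_apply_right] at h2
    rw [Equiv.swap_apply_of_ne_of_ne (by decide) (by decide)] at h0
    rwa [h0, h2] at this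
  obtain ⟨p, q, r, s, hp1, hp2⟩ := exists_bilinear hdeg hs1 hs2
  exact Or.inr ⟨p, q, r, s, fun ℓ hℓ => hp1 ℓ (hL₁ ℓ hℓ), fun ℓ hℓ => hp2 ℓ (hL₂ ℓ hℓ)⟩

end Bilinear

section Vanishing

open MvPolynomial

variable {F : Type*} [Field F]

/-- Existence of a surface of small degree containing given lines. -/
theorem exists_vanishing (S : Finset (F × F × F)) (d : ℕ)
    (hd : S.card * (3 * d + 1) < (d + 1) ^ 3) :
    ∃ f : MvPolynomial (Fin 3) F, f ≠ 0 ∧ f.totalDegree ≤ 3 * d ∧ ∀ ℓ ∈ S, lineX ℓ f = 0 := by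
  let e : (Fin 3 → Fin (d + 1)) → (Fin 3 →₀ ℕ) := fun a =>
    Finsupp.equivFunOnFinite.symm fun i => (a i : ℕ)
  have he : Function.Injective e := by
    intro a b hab
    funext i
    have := DFunLike.congr_fun hab i
    exact Fin.ext this
  let M : Matrix (S × Fin (3 * d + 1)) (Fin 3 → Fin (d + 1)) F := fun ℓ a =>
    (lineX ℓ.1.1 (monomial (e a) 1)).coeff ℓ.2
  have hker : LinearMap.ker M.mulVecLin ≠ ⊥ := by
    apply LinearMap.ker_ne_bot_of_finrank_lt
    simpa using hd
  obtain ⟨c, hc, hc0⟩ := Submodule.exists_mem_ne_zero_of_ne_bot hker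
  let f : MvPolynomial (Fin 3) F := ∑ a, c a • monomial (e a) 1
  have hfc (a) : f.coeff (e a) = c a := by
    simp only [f, coeff_sum, coeff_smul, coeff_monomial]
    rw [Finset.sum_eq_single a (fun b _ hb => by rw [if_neg fun h => hb (he h), smul_zero])
      (fun h => absurd (Finset.mem_univ a) h), if_pos rfl, smul_eq_mul, mul_one]
  have hfdeg : f.totalDegree ≤ 3 * d := by
    refine totalDegree_finsetSum_le fun a _ => (totalDegree_smul_le _ _).trans ?_
    refine (totalDegree_monomial_le _ _).trans ?_
    rw [Finsupp.sum_fintype _ _ (by simp), Fin.sum_univ_three]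
    have h (i) : e a i ≤ d := Nat.lt_succ_iff.1 (a i).2
    simp only [id]
    have := h 0
    have := h 1
    have := h 2
    omega
  refine ⟨f, ?_, hfdeg, fun ℓ hℓ => ?_⟩
  · obtain ⟨a, ha⟩ := Function.ne_iff.1 hc0
    intro hf
    apply ha
    rw [← hfc, hf, coeff_zero, Pi.zero_apply]
  · ext j
    rw [Polynomial.coeff_zero]
    by_cases hj : j < 3 * d + 1
    · have := congrFun (LinearMap.mem_ker.1 hc) (⟨ℓ, hℓ⟩, ⟨j, hj⟩)
      simp only [M, Pi.zero_apply] at this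
      rw [← this]
      simp only [f, map_sum, map_smul, Polynomial.finsetSum_coeff, Polynomial.coeff_smul,
        smul_eq_mul]
      exact Finset.sum_congr rfl fun a _ => mul_comm _ _
    · apply Polynomial.coeff_eq_zero_of_natDegree_lt
      have := natDegree_lineX_le ℓ f
      omega

end Vanishing

section Sampling

open Finset

/-- A colouring which is equidistributed on average over many weights. -/
theorem exists_equidistributed_coloring {α β : Type*} (A : Finset α) (B : Finset β) (w : β → ℝ)
    (r : α → β → ℝ) (m : ℕ) [NeZero m] :
    ∃ c : α → Fin m, ∑ b ∈ B, w b * ∑ i, (m * (∑ a ∈ A, if c a = i then r a b else 0) -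
      ∑ a ∈ A, r a b) ^ 2 ≤ (m ^ 2 - m) * ∑ b ∈ B, w b * ∑ a ∈ A, r a b ^ 2 := by
  induction A using Finset.induction_on with
  | empty => exact ⟨fun _ => 0, by simp⟩
  | insert x A hx ih =>
    obtain ⟨c, hc⟩ := ih
    set u : β → Fin m → ℝ := fun b i =>
      m * (∑ a ∈ A, if c a = i then r a b else 0) - ∑ a ∈ A, r a b with hu
    have hu0 (b) : ∑ i, u b i = 0 := by
      simp only [hu, sum_sub_distrib, ← mul_sum]
      rw [sum_comm]
      simp
    obtain ⟨i₀, -, hi₀⟩ : ∃ i₀ ∈ (univ : Finset (Fin m)), ∑ b ∈ B, w b * (r x b * u b i₀) ≤ 0 := by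
      apply exists_le_of_sum_le univ_nonempty
      rw [sum_comm]
      simp [← mul_sum, hu0]
    refine ⟨Function.update c x i₀, ?_⟩
    have hsum (b i) : (∑ a ∈ insert x A, if Function.update c x i₀ a = i then r a b else 0) =
        (if i₀ = i then r x b else 0) + ∑ a ∈ A, if c a = i then r a b else 0 := by
      rw [sum_insert hx, Function.update_self]
      congr 1
      refine sum_congr rfl fun a ha => ?_
      rw [Function.update_of_ne (ne_of_mem_of_not_mem ha hx)]
    have hb (b) : ∑ i, (m * (∑ a ∈ insert x A, if Function.update c x i₀ a = i then r a b else 0) -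
        ∑ a ∈ insert x A, r a b) ^ 2 = ∑ i, u b i ^ 2 + 2 * m * (r x b * u b i₀) +
        (m ^ 2 - m) * r x b ^ 2 := by
      have h1 (i) : (m * (∑ a ∈ insert x A, if Function.update c x i₀ a = i then r a b else 0) -
        ∑ a ∈ insert x A, r a b) ^ 2 = u b i ^ 2 - 2 * r x b * u b i + r x b ^ 2 +
          if i₀ = i then 2 * m * r x b * u b i + (m ^ 2 - 2 * m) * r x b ^ 2 else 0 := by
        rw [hsum, sum_insert hx]
        simp only [hu]
        split_ifs <;> ring
      simp only [h1, sum_add_distrib, sum_sub_distrib, ← mul_sum, hu0]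
      simp
      ring
    simp only [hb]
    simp only [sum_insert hx, mul_add, sum_add_distrib]
    have e1 : ∑ b ∈ B, w b * (2 * m * (r x b * u b i₀)) =
        2 * m * ∑ b ∈ B, w b * (r x b * u b i₀) := by
      rw [mul_sum]; exact sum_congr rfl fun _ _ => by ring
    have e2 : ∑ b ∈ B, w b * ((m ^ 2 - m) * r x b ^ 2) =
        (m ^ 2 - m) * ∑ b ∈ B, w b * r x b ^ 2 := by
      rw [mul_sum]; exact sum_congr rfl fun _ _ => by ring
    rw [e1, e2]
    have hm : (0 : ℝ) ≤ 2 * m := by positivity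
    nlinarith [mul_nonneg hm (neg_nonneg.2 hi₀)]

/-- A small sample of the left vertices of a bipartite graph which captures its share of the
neighbours of most right vertices. -/
theorem exists_sample {α β : Type*} (A : Finset α) (B : Finset β) (G : α → β → Prop) (m : ℕ)
    (hm : 0 < m) :
    ∃ S ⊆ A, m * #S ≤ #A ∧
      ∑ b ∈ B with 2 * m * #{a ∈ S | G a b} < #{a ∈ A | G a b}, #{a ∈ A | G a b} ≤
        4 * m ^ 2 * #B := by
  have : NeZero m := ⟨hm.ne'⟩
  set d : β → ℕ := fun b => #{a ∈ A | G a b} with hd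
  obtain ⟨c, hc⟩ := exists_equidistributed_coloring A B (fun b => ((d b : ℝ))⁻¹)
    (fun a b => if G a b then 1 else 0) m
  obtain ⟨i, hi⟩ : ∃ i : Fin m, m * #{a ∈ A | c a = i} ≤ #A := by
    by_contra! h
    have h1 : ∑ i : Fin m, #{a ∈ A | c a = i} = #A :=
      (card_eq_sum_card_fiberwise fun _ _ => mem_univ _).symm
    have h2 : ∑ i : Fin m, #A < ∑ i : Fin m, m * #{a ∈ A | c a = i} :=
      sum_lt_sum_of_nonempty univ_nonempty fun i _ => h i
    rw [← mul_sum, h1] at h2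
    simp at h2
  refine ⟨{a ∈ A | c a = i}, filter_subset _ _, hi, ?_⟩
  set S : Finset α := {a ∈ A | c a = i} with hS
  have hsum (b) : (∑ a ∈ A, if G a b then (1 : ℝ) else 0) = d b := by simp [hd]
  have hsumS (b) : (∑ a ∈ A, if c a = i then (if G a b then (1 : ℝ) else 0) else 0) =
      #{a ∈ S | G a b} := by
    rw [← sum_filter, ← sum_filter, sum_const, nsmul_one]
  have hsq (b) : (∑ a ∈ A, (if G a b then (1 : ℝ) else 0) ^ 2) = d b := by
    rw [← hsum]; exact sum_congr rfl fun _ _ => by split_ifs <;> simp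
  simp only [hsum, hsq] at hc
  have hright : ∑ b ∈ B, ((d b : ℝ))⁻¹ * d b ≤ #B := by
    rw [← nsmul_one, ← sum_const]
    refine sum_le_sum fun b _ => ?_
    by_cases h : (d b : ℝ) = 0
    · simp [h]
    · rw [inv_mul_cancel₀ h]
  have hleft : ∑ b ∈ B with 2 * m * #{a ∈ S | G a b} < d b, (d b : ℝ) / 4 ≤
      ∑ b ∈ B, ((d b : ℝ))⁻¹ * ∑ i, (m * (∑ a ∈ A, if c a = i then
        (if G a b then (1 : ℝ) else 0) else 0) - d b) ^ 2 := by
    rw [sum_filter]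
    refine sum_le_sum fun b _ => ?_
    have hnn : 0 ≤ ∑ i, ((m : ℝ) * (∑ a ∈ A, if c a = i then
        (if G a b then (1 : ℝ) else 0) else 0) - d b) ^ 2 := sum_nonneg fun _ _ => sq_nonneg _
    split_ifs with h
    · have hdpos : (0 : ℝ) < d b := by exact_mod_cast (Nat.zero_le _).trans_lt h
      rw [← div_eq_inv_mul, le_div_iff₀ hdpos]
      refine le_trans ?_ (single_le_sum (f := fun i => ((m : ℝ) * (∑ a ∈ A, if c a = i then
        (if G a b then (1 : ℝ) else 0) else 0) - d b) ^ 2) (fun _ _ => sq_nonneg _) (mem_univ i))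
      simp only [hsumS]
      have h' : 2 * (m * (#{a ∈ S | G a b} : ℝ)) < d b := by
        have : ((2 * m * #{a ∈ S | G a b} : ℕ) : ℝ) < d b := by exact_mod_cast h
        push_cast at this; linarith
      have h0 : 0 ≤ (m * (#{a ∈ S | G a b} : ℝ)) := by positivity
      nlinarith
    · positivity
  rw [← sum_div] at hleft
  have hmB : (0 : ℝ) ≤ m * #B := by positivity
  have hmm : (0 : ℝ) ≤ (m : ℝ) ^ 2 - m := by
    have : (1 : ℝ) ≤ m := by exact_mod_cast hm
    nlinarith
  have := mul_le_mul_of_nonneg_left hright hmm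
  have hfin : ∑ b ∈ B with 2 * m * #{a ∈ S | G a b} < d b, (d b : ℝ) ≤ 4 * m ^ 2 * #B := by
    nlinarith
  exact_mod_cast hfin

end Sampling

section LineIncidences

open MvPolynomial Finset

/-- The number of pairs of `A × B` in the relation `G`. -/
noncomputable def numPairs {α β : Type*} (G : α → β → Prop) (A : Finset α) (B : Finset β) : ℕ :=
  ∑ b ∈ B, #{a ∈ A | G a b}

section NumPairs

variable {α β : Type*} {G : α → β → Prop} {A : Finset α} {B : Finset β}

theorem numPairs_eq_sum_left : numPairs G A B = ∑ a ∈ A, #{b ∈ B | G a b} := by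
  simp only [numPairs, card_filter]
  exact sum_comm

theorem numPairs_filter_right (P : β → Prop) [DecidablePred P] [∀ b, Decidable (¬ P b)] :
    numPairs G A B = numPairs G A {b ∈ B | P b} + numPairs G A {b ∈ B | ¬ P b} :=
  (sum_filter_add_sum_filter_not B P _).symm

theorem numPairs_filter_left (P : α → Prop) [DecidablePred P] [∀ b, Decidable (¬ P b)] :
    numPairs G A B = numPairs G {a ∈ A | P a} B + numPairs G {a ∈ A | ¬ P a} B := by
  simp only [numPairs_eq_sum_left]
  exact (sum_filter_add_sum_filter_not A P _).symm

theorem numPairs_le_of_right {K : ℕ} (h : ∀ b ∈ B, #{a ∈ A | G a b} ≤ K) :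
    numPairs G A B ≤ K * #B := by
  rw [mul_comm]; exact sum_le_card_nsmul _ _ _ h

theorem numPairs_le_of_left {K : ℕ} (h : ∀ a ∈ A, #{b ∈ B | G a b} ≤ K) :
    numPairs G A B ≤ K * #A := by
  rw [mul_comm, numPairs_eq_sum_left]; exact sum_le_card_nsmul _ _ _ h

end NumPairs

/-- The bound for the number of incidences between two families of `t` lines of which at most
`k` lie on a quadric. -/
noncomputable def incidenceBound (k : ℕ) (t : ℝ) : ℝ := 2000000 * (t * √t + k * t)

theorem incidenceBound_add_le (k : ℕ) {s t u : ℝ} (hs : 0 ≤ s) (ht : 0 ≤ t) (h : s + t ≤ u) :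
    incidenceBound k s + incidenceBound k t ≤ incidenceBound k u := by
  have h1 : √s ≤ √u := Real.sqrt_le_sqrt (by linarith)
  have h2 : √t ≤ √u := Real.sqrt_le_sqrt (by linarith)
  have h3 := mul_le_mul_of_nonneg_left h1 hs
  have h4 := mul_le_mul_of_nonneg_left h2 ht
  have h5 := mul_le_mul_of_nonneg_right h (Real.sqrt_nonneg u)
  have h6 := mul_le_mul_of_nonneg_left h (Nat.cast_nonneg (α := ℝ) k)
  unfold incidenceBound
  nlinarith

theorem incidenceBound_nonneg (k : ℕ) {t : ℝ} (ht : 0 ≤ t) : 0 ≤ incidenceBound k t := by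
  unfold incidenceBound; positivity

variable {F : Type*} [Field F] {G : F × F × F → F × F × F → Prop} {M₁ M₂ : Finset (F × F × F)}

theorem numPairs_le_of_not_contained_right (hG : ∀ a b, G a b → Meets a b)
    (hM₁ : Set.InjOn Prod.fst (M₁ : Set (F × F × F))) {f : MvPolynomial (Fin 3) F}
    {L₁ L₂ : Finset (F × F × F)} (hL₁ : L₁ ⊆ M₁) (h₁ : ∀ a ∈ L₁, lineX a f = 0)
    (h₂ : ∀ b ∈ L₂, lineY b f ≠ 0) : numPairs G L₁ L₂ ≤ f.totalDegree * #L₂ := by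
  refine numPairs_le_of_right fun b hb => card_meets_le (h₂ b hb) _ (hM₁.mono ?_) fun a ha => ?_
  · exact coe_subset.2 ((filter_subset _ _).trans hL₁)
  · rw [mem_filter] at ha
    exact ⟨h₁ a ha.1, hG _ _ ha.2⟩

theorem numPairs_le_of_not_contained_left (hG : ∀ a b, G a b → Meets a b)
    (hM₂ : Set.InjOn Prod.fst (M₂ : Set (F × F × F))) {f : MvPolynomial (Fin 3) F}
    {L₁ L₂ : Finset (F × F × F)} (hL₂ : L₂ ⊆ M₂) (h₁ : ∀ a ∈ L₁, lineX a f ≠ 0)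
    (h₂ : ∀ b ∈ L₂, lineY b f = 0) : numPairs G L₁ L₂ ≤ f.totalDegree * #L₁ := by
  refine numPairs_le_of_left fun a ha => card_meets_le' (h₁ a ha) _ (hM₂.mono ?_) fun b hb => ?_
  · exact coe_subset.2 ((filter_subset _ _).trans hL₂)
  · rw [mem_filter] at hb
    exact ⟨h₂ b hb.1, hG _ _ hb.2⟩

/-- At most `k` lines of the first family on a quadric are related to a given line of the second
family. -/
def QuadricBound (G : F × F × F → F × F × F → Prop) (M₁ M₂ : Finset (F × F × F)) (k : ℕ) : Prop :=
  ∀ p q r s : F, ∀ b ∈ M₂, #{a ∈ M₁ | G a b ∧ a.2.1 = p * a.1 + q ∧ a.2.2 = r * a.1 + s} ≤ k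

/-- Incidences between lines on an irreducible surface. -/
theorem numPairs_le_of_irreducible (hG : ∀ a b, G a b → Meets a b)
    (hM₁ : Set.InjOn Prod.fst (M₁ : Set (F × F × F)))
    (hM₂ : Set.InjOn Prod.fst (M₂ : Set (F × F × F))) {k : ℕ} (hk : QuadricBound G M₁ M₂ k)
    {f : MvPolynomial (Fin 3) F} (hf : Irreducible f)
    (hchar : ∀ m : ℕ, 0 < m → m ≤ f.totalDegree → (m : F) ≠ 0)
    (hind : ∀ L₁ ⊆ M₁, ∀ L₂ ⊆ M₂, #L₁ ≤ 6 * f.totalDegree ^ 2 → #L₂ ≤ 6 * f.totalDegree ^ 2 →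
      (numPairs G L₁ L₂ : ℝ) ≤ incidenceBound k (6 * f.totalDegree ^ 2))
    {L₁ L₂ : Finset (F × F × F)} (hL₁ : L₁ ⊆ M₁) (hL₂ : L₂ ⊆ M₂)
    (h₁ : ∀ a ∈ L₁, lineX a f = 0) (h₂ : ∀ b ∈ L₂, lineY b f = 0) :
    (numPairs G L₁ L₂ : ℝ) ≤ 3 * f.totalDegree * (#L₁ + #L₂) + k * #L₂ +
      incidenceBound k (6 * f.totalDegree ^ 2) := by
  have hB : 0 ≤ incidenceBound k (6 * (f.totalDegree : ℝ) ^ 2) :=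
    incidenceBound_nonneg k (by positivity)
  by_cases hdeg : f.degreeOf 0 = 0
  · have h0 : numPairs G L₁ L₂ = 0 := by
      refine sum_eq_zero fun b hb => ?_
      rw [card_eq_zero, filter_eq_empty_iff]
      intro a ha
      exact (false_of_degreeOf_zero hf hdeg (h₁ a ha) (h₂ b hb)).elim
    rw [h0, Nat.cast_zero]
    positivity
  rcases surface_dichotomy hf hdeg hchar h₁ h₂ with ⟨h, hfh, hhdeg, hh⟩ | ⟨p, q, r, s, hq₁, hq₂⟩
  · have hbez : 2 * f.totalDegree * h.totalDegree ≤ 6 * f.totalDegree ^ 2 := by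
      nlinarith
    have hhdeg' : (h.totalDegree : ℝ) ≤ 3 * f.totalDegree := by exact_mod_cast hhdeg
    rcases hh with hh | hh
    · have hc₁ := (card_lineX_le hf hdeg hfh L₁ (hM₁.mono (coe_subset.2 hL₁))
        fun a ha => ⟨h₁ a ha, hh a ha⟩).trans hbez
      have hsub : {b ∈ L₂ | lineY b h = 0} ⊆ M₂ := (filter_subset _ _).trans hL₂
      have hc₂ := (card_lineY_le hf hdeg hfh {b ∈ L₂ | lineY b h = 0}
        (hM₂.mono (coe_subset.2 hsub)) fun b hb => by
          rw [mem_filter] at hb; exact ⟨h₂ b hb.1, hb.2⟩).trans hbez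
      have e1 := hind L₁ hL₁ _ hsub hc₁ hc₂
      have e2 := numPairs_le_of_not_contained_right (L₂ := {b ∈ L₂ | ¬ lineY b h = 0}) hG hM₁ hL₁
        hh (fun b hb => (mem_filter.1 hb).2)
      have e2' := e2.trans (Nat.mul_le_mul hhdeg (card_filter_le L₂ _))
      have e3 : (numPairs G L₁ {b ∈ L₂ | ¬ lineY b h = 0} : ℝ) ≤ 3 * f.totalDegree * #L₂ := by
        exact_mod_cast e2'
      rw [numPairs_filter_right fun b => lineY b h = 0, Nat.cast_add]
      have : 0 ≤ 3 * (f.totalDegree : ℝ) * #L₁ + k * #L₂ := by positivity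
      linarith
    · have hc₂ := (card_lineY_le hf hdeg hfh L₂ (hM₂.mono (coe_subset.2 hL₂))
        fun a ha => ⟨h₂ a ha, hh a ha⟩).trans hbez
      have hsub : {b ∈ L₁ | lineX b h = 0} ⊆ M₁ := (filter_subset _ _).trans hL₁
      have hc₁ := (card_lineX_le hf hdeg hfh {b ∈ L₁ | lineX b h = 0}
        (hM₁.mono (coe_subset.2 hsub)) fun b hb => by
          rw [mem_filter] at hb; exact ⟨h₁ b hb.1, hb.2⟩).trans hbez
      have e1 := hind _ hsub L₂ hL₂ hc₁ hc₂
      have e2 := numPairs_le_of_not_contained_left (L₁ := {b ∈ L₁ | ¬ lineX b h = 0}) hG hM₂ hL₂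
        (fun b hb => (mem_filter.1 hb).2) hh
      have e2' := e2.trans (Nat.mul_le_mul hhdeg (card_filter_le L₁ _))
      have e3 : (numPairs G {b ∈ L₁ | ¬ lineX b h = 0} L₂ : ℝ) ≤ 3 * f.totalDegree * #L₁ := by
        exact_mod_cast e2'
      rw [numPairs_filter_left fun b => lineX b h = 0, Nat.cast_add]
      have : 0 ≤ 3 * (f.totalDegree : ℝ) * #L₂ + k * #L₂ := by positivity
      linarith
  · have e1 : numPairs G L₁ L₂ ≤ k * #L₂ := by
      refine numPairs_le_of_right fun b hb => le_trans (card_le_card fun a ha => ?_)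
        (hk p q r s b (hL₂ hb))
      rw [mem_filter] at ha ⊢
      exact ⟨hL₁ ha.1, ha.2, hq₁ a ha.1⟩
    have e2 : (numPairs G L₁ L₂ : ℝ) ≤ k * #L₂ := by exact_mod_cast e1
    have : 0 ≤ 3 * (f.totalDegree : ℝ) * (#L₁ + #L₂) := by positivity
    linarith

/-- Incidences between lines on a surface. -/
theorem numPairs_le_of_contained (hG : ∀ a b, G a b → Meets a b)
    (hM₁ : Set.InjOn Prod.fst (M₁ : Set (F × F × F)))
    (hM₂ : Set.InjOn Prod.fst (M₂ : Set (F × F × F))) {k D : ℕ} (hk : QuadricBound G M₁ M₂ k)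
    (hchar : ∀ m : ℕ, 0 < m → m ≤ D → (m : F) ≠ 0)
    (hind : ∀ d ≤ D, ∀ L₁ ⊆ M₁, ∀ L₂ ⊆ M₂, #L₁ ≤ 6 * d ^ 2 → #L₂ ≤ 6 * d ^ 2 →
      (numPairs G L₁ L₂ : ℝ) ≤ incidenceBound k (6 * d ^ 2))
    (f : MvPolynomial (Fin 3) F) : f ≠ 0 → f.totalDegree ≤ D →
    ∀ L₁ ⊆ M₁, ∀ L₂ ⊆ M₂, (∀ a ∈ L₁, lineX a f = 0) → (∀ b ∈ L₂, lineY b f = 0) →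
    (numPairs G L₁ L₂ : ℝ) ≤ 3 * f.totalDegree * (#L₁ + #L₂) + k * #L₂ +
      incidenceBound k (6 * f.totalDegree ^ 2) := by
  induction f using UniqueFactorizationMonoid.induction_on_prime with
  | h₁ => exact fun h => absurd rfl h
  | h₂ f hf =>
    intro _ _ L₁ _ L₂ _ _ h₂
    have hB : 0 ≤ incidenceBound k (6 * (f.totalDegree : ℝ) ^ 2) :=
      incidenceBound_nonneg k (by positivity)
    have hempty : L₂ = ∅ := eq_empty_of_forall_notMem fun b hb =>
      (hf.map (lineY b)).ne_zero (h₂ b hb)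
    have h0 : numPairs G L₁ L₂ = 0 := by rw [hempty]; rfl
    rw [h0, Nat.cast_zero]
    positivity
  | h₃ a q ha hq ih =>
    intro _ hdeg L₁ hL₁ L₂ hL₂ h₁ h₂
    have hmul := totalDegree_mul_of_isDomain hq.ne_zero ha
    rw [hmul] at hdeg ⊢
    have hsub₁ (P : F × F × F → Prop) : {a ∈ L₁ | P a} ⊆ M₁ := (filter_subset _ _).trans hL₁
    have hsub₂ (P : F × F × F → Prop) : {a ∈ L₂ | P a} ⊆ M₂ := (filter_subset _ _).trans hL₂
    obtain ⟨P, hP⟩ : ∃ P : F × F × F → Prop, ∀ b, P b ↔ lineX b q = 0 := ⟨_, fun _ => Iff.rfl⟩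
    obtain ⟨Q, hQ⟩ : ∃ Q : F × F × F → Prop, ∀ b, Q b ↔ lineY b q = 0 := ⟨_, fun _ => Iff.rfl⟩
    have h₁a : ∀ b ∈ {b ∈ L₁ | ¬ P b}, lineX b a = 0 := fun b hb => by
      rw [mem_filter] at hb
      have := h₁ b hb.1
      rw [map_mul] at this
      exact (mul_eq_zero.1 this).resolve_left (mt (hP b).2 hb.2)
    have h₂a : ∀ b ∈ {b ∈ L₂ | ¬ Q b}, lineY b a = 0 := fun b hb => by
      rw [mem_filter] at hb
      have := h₂ b hb.1
      rw [map_mul] at this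
      exact (mul_eq_zero.1 this).resolve_left (mt (hQ b).2 hb.2)
    have e1 := numPairs_le_of_irreducible hG hM₁ hM₂ hk hq.irreducible
      (fun m h0 hm => hchar m h0 (by omega)) (by exact hind _ (by omega))
      (hsub₁ P) (hsub₂ Q) (fun b hb => (hP b).1 (mem_filter.1 hb).2)
      (fun b hb => (hQ b).1 (mem_filter.1 hb).2)
    have e2 : (numPairs G {b ∈ L₁ | P b} {b ∈ L₂ | ¬ Q b} : ℝ) ≤
        q.totalDegree * #{b ∈ L₂ | ¬ Q b} := by
      exact_mod_cast numPairs_le_of_not_contained_right hG hM₁ (hsub₁ _)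
        (fun b hb => (hP b).1 (mem_filter.1 hb).2) (fun b hb => mt (hQ b).2 (mem_filter.1 hb).2)
    have e3 : (numPairs G {b ∈ L₁ | ¬ P b} {b ∈ L₂ | Q b} : ℝ) ≤
        q.totalDegree * #{b ∈ L₁ | ¬ P b} := by
      exact_mod_cast numPairs_le_of_not_contained_left hG hM₂ (hsub₂ _)
        (fun b hb => mt (hP b).2 (mem_filter.1 hb).2) (fun b hb => (hQ b).1 (mem_filter.1 hb).2)
    have e4 := ih ha (by omega) _ ((filter_subset _ _).trans hL₁) _
      ((filter_subset _ _).trans hL₂) h₁a h₂a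
    have e5 : numPairs G L₁ L₂ = numPairs G {b ∈ L₁ | P b} {b ∈ L₂ | Q b} +
        numPairs G {b ∈ L₁ | P b} {b ∈ L₂ | ¬ Q b} +
        (numPairs G {b ∈ L₁ | ¬ P b} {b ∈ L₂ | Q b} +
        numPairs G {b ∈ L₁ | ¬ P b} {b ∈ L₂ | ¬ Q b}) := by
      rw [numPairs_filter_left P,
        numPairs_filter_right (A := {b ∈ L₁ | P b}) Q,
        numPairs_filter_right (A := {b ∈ L₁ | ¬ P b}) Q]
    have e6 := incidenceBound_add_le k (s := 6 * (q.totalDegree : ℝ) ^ 2)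
      (t := 6 * (a.totalDegree : ℝ) ^ 2)
      (u := 6 * ((q.totalDegree + a.totalDegree : ℕ) : ℝ) ^ 2) (by positivity) (by positivity) (by
        push_cast
        nlinarith [mul_nonneg (Nat.cast_nonneg (α := ℝ) q.totalDegree)
          (Nat.cast_nonneg (α := ℝ) a.totalDegree)])
    have c1 : (#L₁ : ℝ) = #{b ∈ L₁ | P b} + #{b ∈ L₁ | ¬ P b} := by
      exact_mod_cast (card_filter_add_card_filter_not (s := L₁) P).symm
    have c2 : (#L₂ : ℝ) = #{b ∈ L₂ | Q b} + #{b ∈ L₂ | ¬ Q b} := by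
      exact_mod_cast (card_filter_add_card_filter_not (s := L₂) Q).symm
    rw [e5, c1, c2]
    push_cast at e6 ⊢
    have n₁ : 0 ≤ (q.totalDegree : ℝ) * #{b ∈ L₁ | ¬ P b} := by positivity
    have n₂ : 0 ≤ (q.totalDegree : ℝ) * #{b ∈ L₂ | ¬ Q b} := by positivity
    have n₃ : 0 ≤ (a.totalDegree : ℝ) * #{b ∈ L₁ | P b} := by positivity
    have n₄ : 0 ≤ (a.totalDegree : ℝ) * #{b ∈ L₂ | Q b} := by positivity
    linarith

theorem numPairs_le_of_sample (hG : ∀ a b, G a b → Meets a b)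
    (hM₁ : Set.InjOn Prod.fst (M₁ : Set (F × F × F))) {f : MvPolynomial (Fin 3) F}
    {L₁ L₂ S : Finset (F × F × F)} (hL₁ : L₁ ⊆ M₁) (hS : S ⊆ L₁)
    (h₁ : ∀ a ∈ S, lineX a f = 0) (h₂ : ∀ b ∈ L₂, lineY b f ≠ 0) (m : ℕ) :
    numPairs G L₁ L₂ ≤
      ∑ b ∈ L₂ with 2 * m * #{a ∈ S | G a b} < #{a ∈ L₁ | G a b}, #{a ∈ L₁ | G a b} +
      2 * m * f.totalDegree * #L₂ := by
  unfold numPairs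
  rw [← sum_filter_add_sum_filter_not L₂
    (fun b => 2 * m * #{a ∈ S | G a b} < #{a ∈ L₁ | G a b})]
  refine Nat.add_le_add_left ?_ _
  refine (sum_le_card_nsmul _ _ (2 * m * f.totalDegree) fun b hb => ?_).trans ?_
  · rw [mem_filter, not_lt] at hb
    refine hb.2.trans (Nat.mul_le_mul_left _ ?_)
    refine card_meets_le (h₂ b hb.1) _ (hM₁.mono ?_) fun a ha => ?_
    · exact coe_subset.2 (((filter_subset _ _).trans hS).trans hL₁)
    · rw [mem_filter] at ha
      exact ⟨h₁ a ha.1, hG _ _ ha.2⟩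
  · rw [smul_eq_mul, mul_comm]
    exact Nat.mul_le_mul_left _ (card_filter_le _ _)

/-- Incidences between two families of at most `N` lines of which at most `k` lie on a quadric. -/
theorem numPairs_le (hG : ∀ a b, G a b → Meets a b)
    (hM₁ : Set.InjOn Prod.fst (M₁ : Set (F × F × F)))
    (hM₂ : Set.InjOn Prod.fst (M₂ : Set (F × F × F))) {k : ℕ} (hk : QuadricBound G M₁ M₂ k)
    (N : ℕ) : (∀ m : ℕ, 0 < m → m ^ 2 ≤ N → (m : F) ≠ 0) →
    ∀ L₁ ⊆ M₁, ∀ L₂ ⊆ M₂, #L₁ ≤ N → #L₂ ≤ N →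
      (numPairs G L₁ L₂ : ℝ) ≤ incidenceBound k N := by
  induction N using Nat.strong_induction_on with
  | _ N ih =>
  intro hchar L₁ hL₁ L₂ hL₂ hc₁ hc₂
  rcases Nat.eq_zero_or_pos N with rfl | hN
  · rw [Nat.le_zero, card_eq_zero] at hc₂
    subst hc₂
    simpa [numPairs] using incidenceBound_nonneg k le_rfl
  obtain ⟨S, hS, hSc, hbad⟩ := exists_sample L₁ L₂ G 648 (by norm_num)
  obtain ⟨d, hd⟩ : ∃ d, d = Nat.sqrt (3 * #S) := ⟨_, rfl⟩
  have hd₁ : d ^ 2 ≤ 3 * #S := hd ▸ Nat.sqrt_le' _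
  have hd₂ : 3 * #S < (d + 1) ^ 2 := hd ▸ Nat.lt_succ_sqrt' _
  obtain ⟨f, hf₀, hfd, hfS⟩ := exists_vanishing S d (by nlinarith)
  have hdN : 216 * d ^ 2 ≤ N := by omega
  have hD : 24 * f.totalDegree ^ 2 ≤ N := by nlinarith
  have hind : ∀ d ≤ f.totalDegree, ∀ L₁ ⊆ M₁, ∀ L₂ ⊆ M₂, #L₁ ≤ 6 * d ^ 2 → #L₂ ≤ 6 * d ^ 2 →
      (numPairs G L₁ L₂ : ℝ) ≤ incidenceBound k (6 * d ^ 2) := by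
    intro d hd L₁ hL₁ L₂ hL₂ h₁ h₂
    have hd' : d ^ 2 ≤ f.totalDegree ^ 2 := Nat.pow_le_pow_left hd 2
    have := ih (6 * d ^ 2) (by omega) (fun m hm hmd => hchar m hm (by omega)) L₁ hL₁ L₂ hL₂ h₁ h₂
    exact_mod_cast this
  obtain ⟨P, hP⟩ : ∃ P : F × F × F → Prop, ∀ b, P b ↔ lineX b f = 0 := ⟨_, fun _ => Iff.rfl⟩
  obtain ⟨Q, hQ⟩ : ∃ Q : F × F × F → Prop, ∀ b, Q b ↔ lineY b f = 0 := ⟨_, fun _ => Iff.rfl⟩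
  have e1 := numPairs_le_of_contained hG hM₁ hM₂ hk (D := f.totalDegree)
    (fun m hm hmd => hchar m hm (by
      have := Nat.pow_le_pow_left hmd 2
      omega)) hind f hf₀ le_rfl {a ∈ L₁ | P a} ((filter_subset _ _).trans hL₁)
    {b ∈ L₂ | Q b} ((filter_subset _ _).trans hL₂) (fun a ha => (hP a).1 (mem_filter.1 ha).2)
    (fun a ha => (hQ a).1 (mem_filter.1 ha).2)
  have e2 : numPairs G {a ∈ L₁ | ¬ P a} {b ∈ L₂ | Q b} ≤ f.totalDegree * #{a ∈ L₁ | ¬ P a} :=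
    numPairs_le_of_not_contained_left hG hM₂ ((filter_subset _ _).trans hL₂)
      (fun b hb => mt (hP b).2 (mem_filter.1 hb).2) (fun b hb => (hQ b).1 (mem_filter.1 hb).2)
  have e3 := numPairs_le_of_sample (L₂ := {b ∈ L₂ | ¬ Q b}) hG hM₁ hL₁ hS hfS
    (fun b hb => mt (hQ b).2 (mem_filter.1 hb).2) 648
  have e4 : numPairs G L₁ L₂ = numPairs G {a ∈ L₁ | P a} {b ∈ L₂ | Q b} +
      numPairs G {a ∈ L₁ | ¬ P a} {b ∈ L₂ | Q b} + numPairs G L₁ {b ∈ L₂ | ¬ Q b} := by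
    rw [numPairs_filter_right Q, numPairs_filter_left (B := {b ∈ L₂ | Q b}) P]
  have e5 : numPairs G L₁ {b ∈ L₂ | ¬ Q b} ≤ 4 * 648 ^ 2 * N + 2 * 648 * f.totalDegree * N := by
    refine e3.trans (Nat.add_le_add (le_trans (sum_le_sum_of_subset ?_)
      (hbad.trans (Nat.mul_le_mul_left _ hc₂))) (Nat.mul_le_mul_left _
      ((card_filter_le _ _).trans hc₂)))
    exact filter_subset_filter _ (filter_subset _ _)
  have e6 : numPairs G {a ∈ L₁ | ¬ P a} {b ∈ L₂ | Q b} ≤ f.totalDegree * N :=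
    e2.trans (Nat.mul_le_mul_left _ ((card_filter_le _ _).trans hc₁))
  have c1 : (#{a ∈ L₁ | P a} : ℝ) ≤ N := by exact_mod_cast (card_filter_le _ _).trans hc₁
  have c2 : (#{a ∈ L₂ | Q a} : ℝ) ≤ N := by exact_mod_cast (card_filter_le _ _).trans hc₂
  have c3 : 0 ≤ (#{a ∈ L₁ | P a} : ℝ) := Nat.cast_nonneg _
  have c4 : 0 ≤ (#{a ∈ L₂ | Q a} : ℝ) := Nat.cast_nonneg _
  rw [e4]
  generalize numPairs G {a ∈ L₁ | P a} {b ∈ L₂ | Q b} = x₁ at *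
  generalize numPairs G {a ∈ L₁ | ¬ P a} {b ∈ L₂ | Q b} = x₂ at *
  generalize numPairs G L₁ {b ∈ L₂ | ¬ Q b} = x₃ at *
  generalize (#{a ∈ L₁ | P a} : ℝ) = u at *
  generalize (#{a ∈ L₂ | Q a} : ℝ) = v at *
  generalize f.totalDegree = D at *
  have e5' : (x₃ : ℝ) ≤ 4 * 648 ^ 2 * N + 2 * 648 * D * N := by exact_mod_cast e5
  have e6' : (x₂ : ℝ) ≤ D * N := by exact_mod_cast e6
  have hD' : 24 * (D : ℝ) ^ 2 ≤ N := by exact_mod_cast hD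
  have hN' : (1 : ℝ) ≤ N := by exact_mod_cast hN
  have hs1 : 1 ≤ √(N : ℝ) := Real.one_le_sqrt.2 hN'
  have hs2 : √(N : ℝ) ^ 2 = N := Real.sq_sqrt (by positivity)
  have hDs : (D : ℝ) ≤ √N / 4 := abs_le_of_sq_le_sq' (by nlinarith) (by positivity) |>.2
  have hB : √(6 * (D : ℝ) ^ 2) ≤ √N / 2 := by
    rw [Real.sqrt_le_left (by positivity)]
    nlinarith
  have hB2 : 6 * (D : ℝ) ^ 2 * √(6 * (D : ℝ) ^ 2) ≤ N / 4 * (√N / 2) :=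
    mul_le_mul (by linarith) hB (by positivity) (by positivity)
  have hk0 : (0 : ℝ) ≤ k := by positivity
  have hB3 : (k : ℝ) * (6 * (D : ℝ) ^ 2) ≤ k * (N / 4) :=
    mul_le_mul_of_nonneg_left (by linarith) hk0
  have hu : 3 * (D : ℝ) * (u + v) ≤ 3 * (√N / 4) * (N + N) := by gcongr
  have hv : (k : ℝ) * v ≤ k * N := by gcongr
  have hDN : (D : ℝ) * N ≤ √N / 4 * N := by gcongr
  have hNs : (N : ℝ) ≤ N * √N := le_mul_of_one_le_right (by positivity) hs1
  have hkN : 0 ≤ (k : ℝ) * N := by positivity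
  unfold incidenceBound at *
  push_cast
  linarith

end LineIncidences

section GenericProjection

open Finset

variable {F : Type*} [Field F]

theorem one_add_X_mul_C_ne_zero (s : F) : 1 + RatFunc.X * RatFunc.C s ≠ 0 := by
  have h : (1 + Polynomial.X * Polynomial.C s : Polynomial F) ≠ 0 := fun h => by
    simpa using congrArg (Polynomial.coeff · 0) h
  have := (map_ne_zero_iff _ (RatFunc.algebraMap_injective F)).2 h
  rwa [map_add, map_mul, map_one, RatFunc.algebraMap_X, RatFunc.algebraMap_C] at this

/-- A linear change of coordinates, with generic coefficients, of the line
`z = σ y + τ` in the plane of abscissa `x`. -/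
noncomputable def genericLine (a : F × F × F) : RatFunc F × RatFunc F × RatFunc F :=
  ((RatFunc.C a.1 + RatFunc.X ^ 3 * RatFunc.C a.2.1 + RatFunc.X * RatFunc.C a.2.2) /
      (1 + RatFunc.X * RatFunc.C a.2.1),
    RatFunc.C a.2.1 / (1 + RatFunc.X * RatFunc.C a.2.1),
    RatFunc.C a.2.2 / (1 + RatFunc.X * RatFunc.C a.2.1))

theorem genericLine_fst_injective :
    Function.Injective fun a : F × F × F => (genericLine a).1 := by
  rintro ⟨x, s, t⟩ ⟨x', s', t'⟩ h
  simp only [genericLine] at h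
  rw [div_eq_div_iff (one_add_X_mul_C_ne_zero s) (one_add_X_mul_C_ne_zero s')] at h
  have h' : ((Polynomial.C x + Polynomial.X ^ 3 * Polynomial.C s + Polynomial.X * Polynomial.C t) *
      (1 + Polynomial.X * Polynomial.C s') : Polynomial F) =
      (Polynomial.C x' + Polynomial.X ^ 3 * Polynomial.C s' + Polynomial.X * Polynomial.C t') *
      (1 + Polynomial.X * Polynomial.C s) := by
    apply RatFunc.algebraMap_injective F
    simpa only [map_add, map_mul, map_one, map_pow, RatFunc.algebraMap_X, RatFunc.algebraMap_C]
      using h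
  have e : (Polynomial.C x + Polynomial.C (t + x * s') * Polynomial.X +
      Polynomial.C (t * s') * Polynomial.X ^ 2 + Polynomial.C s * Polynomial.X ^ 3 +
      Polynomial.C (s * s') * Polynomial.X ^ 4 : Polynomial F) =
      Polynomial.C x' + Polynomial.C (t' + x' * s) * Polynomial.X +
      Polynomial.C (t' * s) * Polynomial.X ^ 2 + Polynomial.C s' * Polynomial.X ^ 3 +
      Polynomial.C (s' * s) * Polynomial.X ^ 4 := by
    simp only [map_add, map_mul]
    linear_combination h'
  have c (i : ℕ) := congrArg (Polynomial.coeff · i) e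
  have c0 := c 0
  have c1 := c 1
  have c3 := c 3
  simp [-map_mul, -map_add, Polynomial.coeff_X, Polynomial.coeff_C,
    Polynomial.coeff_X_pow] at c0 c1 c3
  subst c0 c3
  simpa using c1

theorem genericLine_injective : Function.Injective (genericLine (F := F)) :=
  Function.Injective.of_comp (f := Prod.fst) genericLine_fst_injective

theorem Meets.genericLine {a b : F × F × F} (h : Meets a b) :
    Meets (genericLine a) (genericLine b) := by
  have ha := one_add_X_mul_C_ne_zero a.2.1
  have hb := one_add_X_mul_C_ne_zero b.2.1
  have hF : (RatFunc.C a.2.1 * RatFunc.C b.1 + RatFunc.C a.2.2 : RatFunc F) =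
      RatFunc.C b.2.1 * RatFunc.C a.1 + RatFunc.C b.2.2 := by
    simp only [← map_mul, ← map_add]
    exact congrArg _ h
  simp only [Meets, _root_.genericLine]
  generalize (RatFunc.C a.2.1 : RatFunc F) = s at *
  generalize (RatFunc.C b.2.1 : RatFunc F) = s' at *
  rw [div_mul_div_comm, div_mul_div_comm, div_add_div _ _ (mul_ne_zero ha hb) ha,
    div_add_div _ _ (mul_ne_zero hb ha) hb, div_eq_div_iff (mul_ne_zero (mul_ne_zero ha hb) ha)
    (mul_ne_zero (mul_ne_zero hb ha) hb)]
  linear_combination (1 + RatFunc.X * s) ^ 2 * (1 + RatFunc.X * s') ^ 2 * hF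

/-- The relation satisfied by a generic line in a quadric. -/
theorem genericLine_mul_eq (a : F × F × F) :
    RatFunc.C a.1 * (1 - RatFunc.X * (genericLine a).2.1) = (genericLine a).1 -
      RatFunc.X ^ 3 * (genericLine a).2.1 - RatFunc.X * (genericLine a).2.2 := by
  have ha := one_add_X_mul_C_ne_zero a.2.1
  unfold genericLine
  field_simp
  ring

theorem one_sub_X_mul_genericLine_ne_zero (a : F × F × F) :
    1 - RatFunc.X * (genericLine a).2.1 ≠ 0 := by
  have ha := one_add_X_mul_C_ne_zero a.2.1
  have : (1 - RatFunc.X * (genericLine a).2.1) * (1 + RatFunc.X * RatFunc.C a.2.1) = 1 := by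
    unfold genericLine
    field_simp
    ring
  exact left_ne_zero_of_mul_eq_one this

/-- Distinct generic lines in a quadric lie in distinct planes, unless all lie in one plane. -/
theorem genericLine_quadric {p q r s : RatFunc F} {a b c : F × F × F}
    (ha : (genericLine a).2.1 = p * (genericLine a).1 + q ∧
      (genericLine a).2.2 = r * (genericLine a).1 + s)
    (hb : (genericLine b).2.1 = p * (genericLine b).1 + q ∧
      (genericLine b).2.2 = r * (genericLine b).1 + s)
    (hc : (genericLine c).2.1 = p * (genericLine c).1 + q ∧
      (genericLine c).2.2 = r * (genericLine c).1 + s)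
    (hab : a ≠ b) (h : a.1 = b.1) : c.1 = a.1 := by
  have ea := genericLine_mul_eq a
  have eb := genericLine_mul_eq b
  have ec := genericLine_mul_eq c
  have hne := one_sub_X_mul_genericLine_ne_zero c
  have hY : (genericLine a).1 - (genericLine b).1 ≠ 0 :=
    sub_ne_zero.2 (genericLine_fst_injective.ne hab)
  rw [ha.1, ha.2] at ea
  rw [hb.1, hb.2, ← h] at eb
  rw [hc.1] at hne
  rw [hc.1, hc.2] at ec
  generalize (genericLine a).1 = u at *
  generalize (genericLine b).1 = v at *
  generalize (genericLine c).1 = w at *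
  have hk : 1 - RatFunc.X ^ 3 * p - RatFunc.X * r + RatFunc.C a.1 * RatFunc.X * p = 0 := by
    apply (mul_eq_zero.1 _).resolve_left hY
    linear_combination eb - ea
  have : RatFunc.C c.1 - RatFunc.C a.1 = 0 := by
    apply (mul_eq_zero.1 _).resolve_right hne
    linear_combination ec - ea + (w - u) * hk
  exact RatFunc.C_injective (sub_eq_zero.1 this)

/-- Incidences between lines contained in planes of given abscissae. -/
theorem numPairs_le_of_planes {G : F × F × F → F × F × F → Prop} (hG : ∀ a b, G a b → Meets a b)
    {M : Finset (F × F × F)} {k : ℕ} (hx : #(M.image Prod.fst) ≤ k)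
    (hk : ∀ x, ∀ b ∈ M, #{a ∈ M | G a b ∧ a.1 = x} ≤ k) {N : ℕ} (hM : #M ≤ N)
    (hchar : ∀ m : ℕ, 0 < m → m ^ 2 ≤ N → (m : F) ≠ 0) :
    (numPairs G M M : ℝ) ≤ incidenceBound k N := by
  let H : RatFunc F × RatFunc F × RatFunc F → RatFunc F × RatFunc F × RatFunc F → Prop :=
    fun u v => ∃ a b, genericLine a = u ∧ genericLine b = v ∧ G a b
  have hH (a b : F × F × F) : H (genericLine a) (genericLine b) ↔ G a b := by
    refine ⟨?_, fun h => ⟨a, b, rfl, rfl, h⟩⟩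
    rintro ⟨a', b', ha, hb, h⟩
    rwa [genericLine_injective ha, genericLine_injective hb] at h
  have hfilter (P : RatFunc F × RatFunc F × RatFunc F → Prop) [DecidablePred P] :
      #{u ∈ M.image genericLine | P u} = #{a ∈ M | P (genericLine a)} := by
    rw [filter_image, card_image_of_injective _ genericLine_injective]
  have hinj : Set.InjOn Prod.fst
      (M.image genericLine : Set (RatFunc F × RatFunc F × RatFunc F)) := by
    intro u hu v hv huv
    obtain ⟨a, -, rfl⟩ := mem_image.1 (mem_coe.1 hu)
    obtain ⟨b, -, rfl⟩ := mem_image.1 (mem_coe.1 hv)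
    rw [genericLine_fst_injective huv]
  have hcard : #(M.image genericLine) ≤ N := card_image_le.trans hM
  have key := numPairs_le (G := H) (M₁ := M.image genericLine) (M₂ := M.image genericLine)
    (k := k) ?_ hinj hinj ?_ N ?_ _ Subset.rfl _ Subset.rfl hcard hcard
  · refine le_trans (le_of_eq ?_) key
    unfold numPairs
    rw [sum_image genericLine_injective.injOn]
    simp only [hfilter, hH]
  · rintro u v ⟨a, b, rfl, rfl, h⟩
    exact (hG a b h).genericLine
  · intro p q r s v hv
    obtain ⟨b, hb, rfl⟩ := mem_image.1 hv
    rw [hfilter]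
    simp only [hH]
    suffices hT : ∀ T : Finset (F × F × F), (∀ a ∈ T, a ∈ M ∧ G a b ∧
        (genericLine a).2.1 = p * (genericLine a).1 + q ∧
        (genericLine a).2.2 = r * (genericLine a).1 + s) → #T ≤ k from
      hT _ fun a ha => mem_filter.1 ha
    intro T hT
    by_cases h : Set.InjOn Prod.fst (T : Set (F × F × F))
    · rw [← card_image_of_injOn h]
      exact (card_le_card (image_subset_image fun a ha => (hT a ha).1)).trans hx
    · simp only [Set.InjOn, not_forall] at h
      obtain ⟨a, ha, a', ha', haa', hne⟩ := h
      refine le_trans (card_le_card fun c hc => ?_) (hk a.1 b hb)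
      have hc' := hT c hc
      rw [mem_filter]
      exact ⟨hc'.1, hc'.2.1, genericLine_quadric (hT a ha).2.2 (hT a' ha').2.2 hc'.2.2 hne haa'⟩
  · intro m hm hmN h
    refine hchar m hm hmN (RatFunc.C_injective ?_)
    rw [map_natCast, h, map_zero]

end GenericProjection

section GridIncidences

open Finset

/-- Rich points have few incidences. -/
theorem sum_card_rich_le {α β : Type*} (R : Finset α) (Λ : Finset β) (J : α → β → Prop) {r : ℕ}
    (hJ : ∀ p q, p ≠ q → #{l ∈ Λ | J p l ∧ J q l} ≤ 1)
    (hr : ∀ p ∈ R, r ≤ #{l ∈ Λ | J p l}) (hΛ : 4 * #Λ ≤ r ^ 2) :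
    ∑ p ∈ R, #{l ∈ Λ | J p l} ≤ 2 * #Λ := by
  obtain ⟨s, hs⟩ : ∃ s, s = ∑ p ∈ R, #{l ∈ Λ | J p l} := ⟨_, rfl⟩
  have hs' : s = ∑ l ∈ Λ, #{p ∈ R | J p l} := by
    rw [hs]
    simp only [card_filter]
    exact sum_comm
  have h1 : s ^ 2 ≤ #Λ * ∑ l ∈ Λ, #{p ∈ R | J p l} ^ 2 := by
    rw [hs']; exact sq_sum_le_card_mul_sum_sq
  have h2 : ∑ l ∈ Λ, #{p ∈ R | J p l} ^ 2 = ∑ p ∈ R, ∑ q ∈ R, #{l ∈ Λ | J p l ∧ J q l} := by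
    simp only [sq, card_filter, sum_mul_sum, ite_and, ite_mul, one_mul, zero_mul]
    rw [sum_comm]
    refine sum_congr rfl fun p _ => sum_comm.trans ?_
    rfl
  have h3 : ∑ p ∈ R, ∑ q ∈ R, #{l ∈ Λ | J p l ∧ J q l} ≤ s + #R ^ 2 := by
    have : ∀ p ∈ R, ∑ q ∈ R, #{l ∈ Λ | J p l ∧ J q l} ≤ #{l ∈ Λ | J p l} + #R := by
      intro p hp
      calc ∑ q ∈ R, #{l ∈ Λ | J p l ∧ J q l}
          ≤ ∑ q ∈ R, ((if p = q then #{l ∈ Λ | J p l} else 0) + 1) := by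
            refine sum_le_sum fun q _ => ?_
            split_ifs with h
            · exact (card_le_card fun l hl => by
                rw [mem_filter] at hl ⊢; exact ⟨hl.1, hl.2.1⟩).trans (Nat.le_succ _)
            · simpa using hJ p q h
        _ = _ := by simp [sum_add_distrib, hp]
    refine (sum_le_sum this).trans ?_
    rw [sum_add_distrib, ← hs, sum_const, smul_eq_mul, sq]
  have h4 : r * #R ≤ s := by
    rw [hs, mul_comm]; exact card_nsmul_le_sum _ _ _ hr
  rw [← hs]
  rw [h2] at h1
  have h5 := h1.trans (Nat.mul_le_mul_left _ h3)
  have h6 : 4 * (#Λ * #R ^ 2) ≤ s ^ 2 := by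
    calc 4 * (#Λ * #R ^ 2) = 4 * #Λ * #R ^ 2 := by ring
      _ ≤ r ^ 2 * #R ^ 2 := Nat.mul_le_mul_right _ hΛ
      _ = (r * #R) ^ 2 := by ring
      _ ≤ s ^ 2 := Nat.pow_le_pow_left h4 2
  by_contra! h
  nlinarith

variable {F : Type*} [Field F]

/-- The lines `z = σ y + τ` in the plane of abscissa `x` and `z = σ' x + τ'` in the plane of
ordinate `y` meet at a point both of whose projections satisfy `P`. -/
def GridRel (P : F × F → Prop) (a b : F × F × F) : Prop :=
  Meets a b ∧ P (a.1, b.2.1 * a.1 + b.2.2) ∧ P (b.1, b.2.1 * a.1 + b.2.2)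

/-- Cauchy–Schwarz for the incidences between a grid and non-vertical lines. -/
theorem sq_card_incidences_le (A B : Finset F) (Λ : Finset (F × F)) (P : F × F → Prop)
    (hP : ∀ p, P p → p.2 ∈ B) :
    #{a ∈ A ×ˢ Λ | P (a.1, a.2.1 * a.1 + a.2.2)} ^ 2 ≤
      #B * numPairs (GridRel P) (A ×ˢ Λ) (A ×ˢ Λ) := by
  let U : F → Finset (F × F × F) := fun z =>
    {a ∈ A ×ˢ Λ | P (a.1, a.2.1 * a.1 + a.2.2) ∧ a.2.1 * a.1 + a.2.2 = z}
  have h1 : #{a ∈ A ×ˢ Λ | P (a.1, a.2.1 * a.1 + a.2.2)} = ∑ z ∈ B, #(U z) := by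
    rw [card_eq_sum_card_fiberwise (f := fun a => a.2.1 * a.1 + a.2.2) (t := B)]
    · simp only [filter_filter, U]
    · intro a ha
      rw [mem_coe, mem_filter] at ha
      exact hP _ ha.2
  rw [h1]
  refine sq_sum_le_card_mul_sum_sq.trans (Nat.mul_le_mul_left _ ?_)
  have h2 (G : F × F × F → F × F × F → Prop) :
      numPairs G (A ×ˢ Λ) (A ×ˢ Λ) = #{c ∈ (A ×ˢ Λ) ×ˢ (A ×ˢ Λ) | G c.1 c.2} := by
    simp only [numPairs, card_filter]
    exact (sum_product_right (A ×ˢ Λ) (A ×ˢ Λ) fun c => if G c.1 c.2 then 1 else 0).symm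
  have h3 : ∑ z ∈ B, #(U z) ^ 2 = #(B.sigma fun z => U z ×ˢ U z) := by
    simp [card_sigma, sq]
  rw [h2, h3]
  refine card_le_card_of_injOn
    (fun c => ((c.2.1.1, c.2.2.2), (c.2.2.1, c.2.1.2))) ?_ ?_
  · rintro ⟨z, ⟨x, l⟩, ⟨y, l'⟩⟩ hc
    simp only [coe_sigma, Set.mem_sigma_iff, mem_coe, mem_product, U, mem_filter] at hc
    obtain ⟨-, ⟨⟨hx, hl⟩, hPx, hz⟩, ⟨hy, hl'⟩, hPy, hz'⟩ := hc
    rw [hz] at hPx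
    rw [hz'] at hPy
    rw [mem_coe, mem_filter]
    refine ⟨mem_product.2 ⟨mem_product.2 ⟨hx, hl'⟩, mem_product.2 ⟨hy, hl⟩⟩,
      hz'.trans hz.symm, ?_, ?_⟩
    · change P (x, l.1 * x + l.2)
      rwa [hz]
    · change P (y, l.1 * x + l.2)
      rwa [hz]
  · rintro ⟨z, ⟨x, l⟩, ⟨y, l'⟩⟩ hc ⟨z₁, ⟨x₁, l₁⟩, ⟨y₁, l₁'⟩⟩ hc₁ h
    simp only [coe_sigma, Set.mem_sigma_iff, mem_coe, mem_product, U, mem_filter] at hc hc₁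
    simp only [Prod.mk.injEq] at h
    obtain ⟨⟨rfl, rfl⟩, rfl, rfl⟩ := h
    obtain rfl := hc.2.1.2.2.symm.trans hc₁.2.1.2.2
    rfl

theorem card_lines_through_le_one (Λ : Finset (F × F)) {p q : F × F} (h : p ≠ q) :
    #{l ∈ Λ | l.1 * p.1 + l.2 = p.2 ∧ l.1 * q.1 + l.2 = q.2} ≤ 1 := by
  rw [card_le_one]
  intro l hl l' hl'
  rw [mem_filter] at hl hl'
  obtain ⟨-, h1, h2⟩ := hl
  obtain ⟨-, h3, h4⟩ := hl'
  have hx : p.1 - q.1 ≠ 0 := by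
    intro h0
    have h0 := sub_eq_zero.1 h0
    exact h (Prod.ext h0 (by rw [← h1, ← h2, h0]))
  have h5 : l.1 = l'.1 := by
    rw [← sub_eq_zero]
    apply (mul_eq_zero.1 _).resolve_right hx
    linear_combination h1 - h2 - h3 + h4
  refine Prod.ext h5 ?_
  linear_combination h1 - h3 - p.1 * h5

/-- Incidences between a grid and non-vertical lines, in terms of a bound `r` for the number of
lines through a poor point. -/
theorem card_incidences_le (A B : Finset F) (Λ : Finset (F × F)) {r N : ℕ} (hΛ : 4 * #Λ ≤ r ^ 2)
    (hN : #A * #Λ ≤ N) (hchar : ∀ m : ℕ, 0 < m → m ^ 2 ≤ N → (m : F) ≠ 0) :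
    (#{a ∈ A ×ˢ Λ | a.2.1 * a.1 + a.2.2 ∈ B} : ℝ) ≤
      √(#B * incidenceBound (max #A r) N) + 2 * #Λ := by
  let J : F × F → F × F → Prop := fun p l => l.1 * p.1 + l.2 = p.2
  obtain ⟨P, hP⟩ : ∃ P : F × F → Prop, ∀ p, P p ↔ p.2 ∈ B ∧ #{l ∈ Λ | J p l} < r :=
    ⟨_, fun _ => Iff.rfl⟩
  let R : Finset (F × F) := {p ∈ A ×ˢ B | r ≤ #{l ∈ Λ | J p l}}
  have h1 : #{a ∈ A ×ˢ Λ | a.2.1 * a.1 + a.2.2 ∈ B} ≤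
      #{a ∈ A ×ˢ Λ | P (a.1, a.2.1 * a.1 + a.2.2)} + 2 * #Λ := by
    have hR := sum_card_rich_le R Λ J (fun p q h => card_lines_through_le_one Λ h)
      (fun p hp => (mem_filter.1 hp).2) hΛ
    rw [← card_sigma] at hR
    refine le_trans ?_ (Nat.add_le_add_left hR _)
    rw [← card_filter_add_card_filter_not (s := {a ∈ A ×ˢ Λ | a.2.1 * a.1 + a.2.2 ∈ B})
      fun a => P (a.1, a.2.1 * a.1 + a.2.2)]
    refine Nat.add_le_add (card_le_card (filter_subset_filter _ (filter_subset _ _))) ?_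
    refine card_le_card_of_injOn (fun a => ⟨(a.1, a.2.1 * a.1 + a.2.2), a.2⟩) ?_ ?_
    · intro a ha
      simp only [mem_coe, mem_filter, mem_product, hP, not_and, not_lt] at ha
      simp only [coe_sigma, Set.mem_sigma_iff, mem_coe, mem_filter, R, mem_product]
      exact ⟨⟨⟨ha.1.1.1, ha.1.2⟩, ha.2 ha.1.2⟩, ha.1.1.2, rfl⟩
    · rintro ⟨x, l⟩ - ⟨y, l'⟩ - h
      simp only [Sigma.mk.injEq, Prod.mk.injEq, heq_eq_eq] at h
      rw [h.1.1, h.2]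
  have h2 := sq_card_incidences_le A B Λ P fun p hp => ((hP p).1 hp).1
  have h3 := numPairs_le_of_planes (G := GridRel P) (fun a b h => h.1)
    (M := A ×ˢ Λ) (k := max #A r) (N := N) ?_ ?_ (by rwa [card_product]) hchar
  · have h4 : (#{a ∈ A ×ˢ Λ | P (a.1, a.2.1 * a.1 + a.2.2)} : ℝ) ≤
        √(#B * incidenceBound (max #A r) N) := by
      apply Real.le_sqrt_of_sq_le
      refine le_trans (by exact_mod_cast h2) (mul_le_mul_of_nonneg_left h3 (Nat.cast_nonneg _))
    refine le_trans (by exact_mod_cast h1) (add_le_add_left h4 _)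
  · refine (card_le_card fun x hx => ?_).trans (le_max_left _ _)
    obtain ⟨a, ha, rfl⟩ := mem_image.1 hx
    exact (mem_product.1 ha).1
  · intro x b hb
    refine le_trans ?_ (le_max_right _ _)
    by_cases h : P (b.1, b.2.1 * x + b.2.2)
    · refine le_trans ?_ ((hP _).1 h).2.le
      refine card_le_card_of_injOn Prod.snd ?_ ?_
      · intro a ha
        rw [mem_coe, mem_filter] at ha
        rw [mem_coe, mem_filter]
        refine ⟨(mem_product.1 ha.1).2, ?_⟩
        have := ha.2.1.1
        rw [Meets, ha.2.2] at this
        exact this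
      · intro a ha a' ha' h
        rw [mem_coe, mem_filter] at ha ha'
        exact Prod.ext (ha.2.2.trans ha'.2.2.symm) h
    · rw [card_eq_zero.2 (filter_eq_empty_iff.2 ?_)]
      · exact Nat.zero_le _
      · rintro a ha ⟨h', rfl⟩
        exact h h'.2.2

end GridIncidences

section LinesOfThePlane

variable {F : Type*} [Field F]

/-- The non-vertical line of slope `l.1` and intercept `l.2`. -/
def slopeLine (l : F × F) : Set (F × F) := {p | l.1 * p.1 + l.2 = p.2}

theorem slopeLine_injective : Function.Injective (slopeLine (F := F)) := by
  intro l l' h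
  have h0 : ((0, l.2) : F × F) ∈ slopeLine l' := h ▸ (by simp [slopeLine])
  have h1 : ((1, l.1 + l.2) : F × F) ∈ slopeLine l' := h ▸ (by simp [slopeLine])
  simp only [slopeLine, Set.mem_ofPred_eq, mul_zero, zero_add, mul_one] at h0 h1
  rw [h0] at h1
  exact Prod.ext (add_right_cancel h1).symm h0.symm

theorem IsLine.vertical_or_slopeLine {ℓ : Set (F × F)} (h : IsLine ℓ) :
    (∃ c, ℓ = {p | p.1 = c}) ∨ ∃ l, ℓ = slopeLine l := by
  obtain ⟨α, β, γ, hne, rfl⟩ := h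
  by_cases hβ : β = 0
  · have hα : α ≠ 0 := fun hα => hne (by rw [hα, hβ])
    refine Or.inl ⟨γ / α, ?_⟩
    ext p
    simp only [hβ, Set.mem_ofPred_eq, zero_mul, add_zero]
    rw [eq_div_iff hα, mul_comm]
  · refine Or.inr ⟨(-α / β, γ / β), ?_⟩
    ext p
    simp only [slopeLine, Set.mem_ofPred_eq]
    constructor
    · rintro rfl
      field_simp
      ring
    · intro h
      rw [← h]
      field_simp
      ring

open Finset in
/-- Reduction of the incidences with a grid to incidences with non-vertical lines. -/
theorem exists_incidences_le (A B : Finset F) (L : Finset (Set (F × F)))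
    (hL : ∀ ℓ ∈ L, IsLine ℓ) : ∃ Λ : Finset (F × F), #Λ ≤ #L ∧
      Incidences (A ×ˢ B) L ≤ #A * #B + #{a ∈ A ×ˢ Λ | a.2.1 * a.1 + a.2.2 ∈ B} := by
  refine ⟨L.preimage slopeLine slopeLine_injective.injOn,
    card_le_card_of_injOn slopeLine (fun l hl => mem_preimage.1 hl) slopeLine_injective.injOn, ?_⟩
  obtain ⟨V, hV⟩ : ∃ V : Set (F × F) → Prop, ∀ ℓ, V ℓ ↔ ∃ c, ℓ = {p | p.1 = c} :=
    ⟨_, fun _ => Iff.rfl⟩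
  have h1 : Incidences (A ×ˢ B) L = #{ql ∈ (A ×ˢ B) ×ˢ L | ql.1 ∈ ql.2} := by
    rw [Incidences, ← Set.ncard_coe_finset]
    congr 1
    ext ql
    rw [mem_coe, mem_filter, mem_product (s := A ×ˢ B), and_assoc, Set.mem_ofPred_eq]
  rw [h1, ← card_filter_add_card_filter_not (s := {ql ∈ (A ×ˢ B) ×ˢ L | ql.1 ∈ ql.2})
    fun ql => V ql.2]
  refine Nat.add_le_add ?_ ?_
  · rw [← card_product]
    refine card_le_card_of_injOn Prod.fst (fun ql h => ?_) ?_
    · rw [mem_coe, mem_filter, mem_filter, mem_product] at h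
      exact h.1.1.1
    · rintro ⟨p, ℓ⟩ h ⟨q, ℓ'⟩ h' hpq
      rw [mem_coe, mem_filter, mem_filter, hV] at h h'
      obtain ⟨⟨-, h⟩, c, hc⟩ := h
      obtain ⟨⟨-, h'⟩, c', hc'⟩ := h'
      simp only at h h' hc hc' hpq
      subst hc hc' hpq
      rw [Set.mem_ofPred_eq] at h h'
      rw [← h, ← h']
  · refine le_trans (card_le_card fun ql h => ?_) (card_image_le
      (f := fun a : F × F × F => ((a.1, a.2.1 * a.1 + a.2.2), slopeLine a.2)))
    rw [mem_filter, mem_filter, mem_product, mem_product, hV] at h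
    obtain ⟨⟨⟨⟨hA, hB⟩, hℓ⟩, hq⟩, hv⟩ := h
    obtain ⟨⟨x, y⟩, ℓ⟩ := ql
    obtain ⟨l, hl⟩ := (hL ℓ hℓ).vertical_or_slopeLine.resolve_left hv
    simp only at hA hB hℓ hq hl
    subst hl
    have hq' : l.1 * x + l.2 = y := hq
    rw [mem_image]
    refine ⟨(x, l), mem_filter.2 ⟨mem_product.2 ⟨hA, mem_preimage.2 hℓ⟩, ?_⟩, ?_⟩
    · simpa only [hq'] using hB
    · simp only [hq']

theorem natCast_ne_zero_of_sq_le {N : ℕ}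
    (h : ∀ p : ℕ, p.Prime → CharP F p → N < p ^ 2) {m : ℕ} (hm : 0 < m) (hmN : m ^ 2 ≤ N) :
    (m : F) ≠ 0 := by
  intro h0
  obtain ⟨p, hp⟩ := CharP.exists F
  have hdvd := (CharP.cast_eq_zero_iff F p m).1 h0
  rcases CharP.char_is_prime_or_zero F p with hprime | rfl
  · have h1 := h p hprime hp
    have h2 := Nat.pow_le_pow_left (Nat.le_of_dvd hm hdvd) 2
    omega
  · exact hm.ne' (zero_dvd_iff.1 hdvd)

end LinesOfThePlane

/-- The numerical comparison concluding the proof of the incidence bound. -/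
theorem sqrt_mul_incidenceBound_le {a b n : ℕ} {w : ℝ} (hw : 0 ≤ w)
    (hw4 : w ^ 4 = (a : ℝ) ^ 3 * b ^ 2 * n ^ 3) (ha : 0 < a) (han : a ≤ n) :
    √(b * incidenceBound (max a (Nat.sqrt (4 * n) + 1)) (a * n : ℕ)) ≤ 3000 * w := by
  obtain ⟨N, hN⟩ : ∃ N : ℝ, N = a * n := ⟨_, rfl⟩
  have ha1 : (1 : ℝ) ≤ a := by exact_mod_cast ha
  have han' : (a : ℝ) ≤ n := by exact_mod_cast han
  have hN1 : 1 ≤ N := by rw [hN]; nlinarith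
  have hs1 : 1 ≤ √N := Real.one_le_sqrt.2 hN1
  have hs2 : √N ^ 2 = N := Real.sq_sqrt (by positivity)
  have hk : ((max a (Nat.sqrt (4 * n) + 1) : ℕ) : ℝ) ≤ 3 * √N := by
    rw [Nat.cast_max]
    refine max_le ?_ ?_
    · have : (a : ℝ) ≤ √N := Real.le_sqrt_of_sq_le (by rw [hN]; nlinarith)
      linarith
    · have h1 : ((Nat.sqrt (4 * n) : ℕ) : ℝ) ^ 2 ≤ 4 * n := by exact_mod_cast Nat.sqrt_le' (4 * n)
      have h2 : ((Nat.sqrt (4 * n) : ℕ) : ℝ) ≤ 2 * √N := by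
        refine (abs_le_of_sq_le_sq' ?_ (by positivity)).2
        nlinarith
      push_cast
      linarith
  have hb : (0 : ℝ) ≤ b := by positivity
  have h1 : incidenceBound (max a (Nat.sqrt (4 * n) + 1)) (a * n : ℕ) ≤ 8000000 * (N * √N) := by
    have := mul_le_mul_of_nonneg_right hk (by positivity : 0 ≤ N)
    rw [incidenceBound, Nat.cast_mul, ← hN]
    linarith
  have h2 : b * (N * √N) ≤ w ^ 2 := by
    refine (pow_le_pow_iff_left₀ (by positivity) (by positivity) two_ne_zero).1 (le_of_eq ?_)
    calc (b * (N * √N)) ^ 2 = b ^ 2 * N ^ 2 * √N ^ 2 := by ring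
      _ = w ^ 4 := by rw [hs2, hw4, hN]; ring
      _ = (w ^ 2) ^ 2 := by ring
  refine Real.sqrt_le_iff.2 ⟨by positivity, ?_⟩
  have h3 := mul_le_mul_of_nonneg_left h1 hb
  nlinarith

theorem stmt_1 :
    ∃ c C : ℝ, 0 < c ∧ 0 < C ∧
      ∀ (F : Type) [Field F] (A B : Finset F) (L : Finset (Set (F × F))) (a b n : ℕ),
        A.card = a → B.card = b → a ≤ b → L.card = n → (∀ ℓ ∈ L, IsLine ℓ) →
        a * b ^ 2 ≤ n ^ 3 →
        (∀ p : ℕ, p.Prime → CharP F p → (a * n : ℝ) ≤ c * (p : ℝ) ^ 2) →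
        (Incidences (A ×ˢ B) L : ℝ) ≤
          C * ((a : ℝ) ^ ((3 : ℝ) / 4) * (b : ℝ) ^ ((1 : ℝ) / 2) * (n : ℝ) ^ ((3 : ℝ) / 4)
            + (n : ℝ)) := by
  refine ⟨1 / 2, 4000, by norm_num, by norm_num, ?_⟩
  intro F _ A B L a b n hA hB hab hn hL hlarge hchar
  obtain ⟨Λ, hΛ, hI⟩ := exists_incidences_le A B L hL
  rw [hn] at hΛ
  rw [hA, hB] at hI
  have hI' : (Incidences (A ×ˢ B) L : ℝ) ≤
      a * b + (Finset.card {a ∈ A ×ˢ Λ | a.2.1 * a.1 + a.2.2 ∈ B} : ℕ) := by exact_mod_cast hI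
  obtain ⟨w, hw⟩ : ∃ w : ℝ, w = (a : ℝ) ^ ((3 : ℝ) / 4) * (b : ℝ) ^ ((1 : ℝ) / 2) *
    (n : ℝ) ^ ((3 : ℝ) / 4) := ⟨_, rfl⟩
  have hw0 : 0 ≤ w := by rw [hw]; positivity
  have hw4 : w ^ 4 = (a : ℝ) ^ 3 * b ^ 2 * n ^ 3 := by
    have h34 (x : ℕ) : ((x : ℝ) ^ ((3 : ℝ) / 4)) ^ 4 = (x : ℝ) ^ 3 := by
      rw [← Real.rpow_natCast, ← Real.rpow_mul (Nat.cast_nonneg x), ← Real.rpow_natCast]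
      norm_num
    have h12 (x : ℕ) : ((x : ℝ) ^ ((1 : ℝ) / 2)) ^ 4 = (x : ℝ) ^ 2 := by
      rw [← Real.rpow_natCast, ← Real.rpow_mul (Nat.cast_nonneg x), ← Real.rpow_natCast]
      norm_num
    rw [hw, mul_pow, mul_pow, h34, h12, h34]
  rw [← hw]
  have hlarge' : (a : ℝ) * b ^ 2 ≤ n ^ 3 := by exact_mod_cast hlarge
  have habw : (a : ℝ) * b ≤ w := by
    refine (pow_le_pow_iff_left₀ (by positivity) hw0 four_ne_zero).1 ?_
    rw [hw4]
    calc ((a : ℝ) * b) ^ 4 = (a : ℝ) ^ 3 * b ^ 2 * (a * b ^ 2) := by ring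
      _ ≤ (a : ℝ) ^ 3 * b ^ 2 * n ^ 3 := by gcongr
  have hn0 : (0 : ℝ) ≤ n := Nat.cast_nonneg n
  rcases le_or_gt (a * n) (b ^ 2) with h | h
  · have h1 : (Finset.card {a ∈ A ×ˢ Λ | a.2.1 * a.1 + a.2.2 ∈ B} : ℝ) ≤ a * n := by
      have := (Finset.card_filter_le (A ×ˢ Λ) fun a => a.2.1 * a.1 + a.2.2 ∈ B).trans
        (Finset.card_product A Λ).le
      rw [hA] at this
      exact_mod_cast this.trans (Nat.mul_le_mul_left a hΛ)
    have h' : (a : ℝ) * n ≤ b ^ 2 := by exact_mod_cast h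
    have h2 : (a : ℝ) * n ≤ w := by
      refine (pow_le_pow_iff_left₀ (by positivity) hw0 four_ne_zero).1 ?_
      rw [hw4]
      calc ((a : ℝ) * n) ^ 4 = (a : ℝ) ^ 3 * n ^ 3 * (a * n) := by ring
        _ ≤ (a : ℝ) ^ 3 * n ^ 3 * b ^ 2 := by gcongr
        _ = (a : ℝ) ^ 3 * b ^ 2 * n ^ 3 := by ring
    linarith
  · have ha : 0 < a := Nat.pos_of_ne_zero fun h0 => by simp [h0] at h
    have han : a ≤ n := by
      by_contra! hna
      nlinarith
    have h1 := card_incidences_le A B Λ (r := Nat.sqrt (4 * n) + 1) (N := a * n)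
      ((Nat.mul_le_mul_left 4 hΛ).trans (Nat.lt_succ_sqrt' (4 * n)).le)
      (by rw [hA]; exact Nat.mul_le_mul_left a hΛ)
      (fun m hm hmN => natCast_ne_zero_of_sq_le (fun p hp hpF => by
        have := hchar p hp hpF
        have hp0 : (0 : ℝ) < p ^ 2 := by have := hp.pos; positivity
        have h3 : ((a * n : ℕ) : ℝ) < (p ^ 2 : ℕ) := by push_cast; linarith
        exact_mod_cast h3) hm hmN)
    rw [hA, hB] at h1
    have h2 := sqrt_mul_incidenceBound_le hw0 hw4 ha han
    have h3 : (Λ.card : ℝ) ≤ n := by exact_mod_cast hΛ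
    linarith
end

section
/- Let a and c be positive integers and let F be a field; if F has positive characteristic p, assume 2ac < p. Identify integers with their images in F under the natural ring map ℤ → F. Let P = {(i,j) ∈ F^2 : i = 1,…,a and j = 1,…,2ac} and let L = { {(x,y) ∈ F^2 : y = s·x + t} : s = 1,…,c and t = 1,…,ac }. Then |P| = 2a^2 c, |L| = a c^2, every line of L contains exactly a points of P, and I(P,L) = a^2 c^2. -/
open scoped Classical

/-- Natural numbers below the characteristic (if positive) have distinct images in a field. -/
theorem natCast_injOn_Iic_of_lt_char {F : Type*} [Field F] {N : ℕ}
    (hN : ∀ p : ℕ, p.Prime → CharP F p → N < p) :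
    Set.InjOn (fun n : ℕ => (n : F)) (Set.Iic N) := by
  intro m hm n hn h
  obtain ⟨q, hq⟩ := CharP.exists F
  have hmod : m ≡ n [MOD q] := (CharP.natCast_eq_natCast F q).1 h
  rcases CharP.char_is_prime_or_zero F q with hp | rfl
  · have hlt := hN q hp hq
    exact hmod.eq_of_lt_of_lt (lt_of_le_of_lt hm hlt) (lt_of_le_of_lt hn hlt)
  · simpa [Nat.ModEq] using hmod

/-- A non-vertical line determines its slope and its intercept. -/
theorem slope_intercept_injective {F : Type*} [Field F] {s t s' t' : F}
    (h : {p : F × F | p.2 = s * p.1 + t} = {p : F × F | p.2 = s' * p.1 + t'}) :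
    s = s' ∧ t = t' := by
  have h0 : ((0, t) : F × F) ∈ {p : F × F | p.2 = s' * p.1 + t'} := by
    rw [← h]; simp
  have h1 : ((1, s + t) : F × F) ∈ {p : F × F | p.2 = s' * p.1 + t'} := by
    rw [← h]; simp
  simp only [Set.mem_ofPred_eq, mul_zero, zero_add, mul_one] at h0 h1
  subst h0
  exact ⟨add_right_cancel h1, rfl⟩

/-- Counting incidences line by line. -/
theorem Incidences_eq_sum {F : Type*} [Field F] (P : Finset (F × F)) (L : Finset (Set (F × F))) :
    Incidences P L = ∑ ℓ ∈ L, Set.ncard {p : F × F | p ∈ P ∧ p ∈ ℓ} := by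
  have h : {ql : (F × F) × Set (F × F) | ql.1 ∈ P ∧ ql.2 ∈ L ∧ ql.1 ∈ ql.2} =
      ((P ×ˢ L).filter fun ql => ql.1 ∈ ql.2 : Finset ((F × F) × Set (F × F))) := by
    ext ql
    simp [and_assoc]
  rw [Incidences, h, Set.ncard_coe_finset, Finset.card_filter, Finset.sum_product_right]
  refine Finset.sum_congr rfl fun ℓ _ => ?_
  rw [← Finset.card_filter, ← Set.ncard_coe_finset]
  simp

theorem stmt_5 (F : Type) [Field F] (a c : ℕ) (ha : 0 < a) (hc : 0 < c)
    (hchar : ∀ p : ℕ, p.Prime → CharP F p → 2 * a * c < p)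
    (P : Finset (F × F)) (L : Finset (Set (F × F)))
    (hP : P = ((Finset.Icc 1 a) ×ˢ (Finset.Icc 1 (2 * a * c))).image
      (fun ij => ((ij.1 : F), (ij.2 : F))))
    (hL : L = ((Finset.Icc 1 c) ×ˢ (Finset.Icc 1 (a * c))).image
      (fun st => {p : F × F | p.2 = (st.1 : F) * p.1 + (st.2 : F)})) :
    P.card = 2 * a ^ 2 * c ∧ L.card = a * c ^ 2 ∧
      (∀ ℓ ∈ L, Set.ncard {p : F × F | p ∈ P ∧ p ∈ ℓ} = a) ∧
      Incidences P L = a ^ 2 * c ^ 2 := by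
  have hinj := natCast_injOn_Iic_of_lt_char hchar
  have hcast : ∀ m n : ℕ, m ≤ 2 * a * c → n ≤ 2 * a * c → (m : F) = n → m = n :=
    fun m n hm hn h => hinj hm hn h
  have hale : a ≤ 2 * a * c := by nlinarith
  have hcle : c ≤ 2 * a * c := by nlinarith
  have hacle : a * c ≤ 2 * a * c := by nlinarith
  have hPcard : P.card = 2 * a ^ 2 * c := by
    rw [hP, Finset.card_image_of_injOn]
    · simp only [Finset.card_product, Nat.card_Icc, Nat.add_sub_cancel]
      ring
    · rintro ⟨i, j⟩ hij ⟨i', j'⟩ hij' h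
      simp only [Finset.coe_product, Finset.coe_Icc, Set.mem_prod, Set.mem_Icc] at hij hij'
      simp only [Prod.mk.injEq] at h ⊢
      exact ⟨hcast _ _ (by omega) (by omega) h.1, hcast _ _ (by omega) (by omega) h.2⟩
  have hLcard : L.card = a * c ^ 2 := by
    rw [hL, Finset.card_image_of_injOn]
    · simp only [Finset.card_product, Nat.card_Icc, Nat.add_sub_cancel]
      ring
    · rintro ⟨s, t⟩ hst ⟨s', t'⟩ hst' h
      simp only [Finset.coe_product, Finset.coe_Icc, Set.mem_prod, Set.mem_Icc] at hst hst'
      obtain ⟨hs, ht⟩ := slope_intercept_injective h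
      simp only [Prod.mk.injEq]
      exact ⟨hcast _ _ (by omega) (by omega) hs, hcast _ _ (by omega) (by omega) ht⟩
  have hline : ∀ ℓ ∈ L, Set.ncard {p : F × F | p ∈ P ∧ p ∈ ℓ} = a := by
    intro ℓ hℓ
    rw [hL, Finset.mem_image] at hℓ
    obtain ⟨⟨s, t⟩, hst, rfl⟩ := hℓ
    simp only [Finset.mem_product, Finset.mem_Icc] at hst
    have himage : {p : F × F | p ∈ P ∧ p ∈ {p : F × F | p.2 = (s : F) * p.1 + (t : F)}} =
        ((Finset.Icc 1 a).image fun i : ℕ => ((i : F), ((s * i + t : ℕ) : F)) :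
          Finset (F × F)) := by
      ext ⟨x, y⟩
      simp only [hP, Finset.mem_image, Finset.mem_product, Finset.mem_Icc, Set.mem_ofPred_eq,
        Finset.mem_coe, Prod.mk.injEq, Prod.exists]
      constructor
      · rintro ⟨⟨i, j, ⟨hi, -⟩, rfl, rfl⟩, h⟩
        exact ⟨i, hi, rfl, by rw [h]; push_cast; rfl⟩
      · rintro ⟨i, hi, rfl, rfl⟩
        have hsi : s * i ≤ c * a := Nat.mul_le_mul hst.1.2 hi.2
        exact ⟨⟨i, s * i + t, ⟨hi, by omega, by nlinarith⟩, rfl, rfl⟩, by push_cast; rfl⟩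
    rw [himage, Set.ncard_coe_finset, Finset.card_image_of_injOn]
    · simp
    · intro i hi i' hi' h
      simp only [Finset.coe_Icc, Set.mem_Icc] at hi hi'
      exact hcast _ _ (by omega) (by omega) (Prod.ext_iff.1 h).1
  refine ⟨hPcard, hLcard, hline, ?_⟩
  rw [Incidences_eq_sum, Finset.sum_congr rfl hline, Finset.sum_const, hLcard, smul_eq_mul]
  ring
end

section
/- There exist absolute constants c > 0 and C > 0 such that the following holds. Let F be a field and let A ⊆ F be a finite nonempty set. If F has positive characteristic p, assume |A| ≤ c · p^{5/8}. Then max{ |A+A| , |A·A| } ≥ C · |A|^{6/5}. -/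
open scoped Classical Pointwise

namespace LightLine

open Polynomial in
/-- Two polynomials with vanishing Wronskian are proportional when their degrees are smaller than
the characteristic. -/
theorem exists_eq_C_mul_of_derivative_mul_eq {K : Type*} [Field K] {D : ℕ}
    (hD : ∀ i : ℕ, 0 < i → i ≤ D → (i : K) ≠ 0) {U V : K[X]} (hV : V ≠ 0)
    (hUD : U.natDegree ≤ D) (hVD : V.natDegree ≤ D)
    (h : derivative U * V = U * derivative V) : ∃ c : K, U = C c * V := by
  set c : K := U.coeff V.natDegree / V.leadingCoeff with hc
  have hlV : V.leadingCoeff ≠ 0 := leadingCoeff_ne_zero.mpr hV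
  refine ⟨c, ?_⟩
  by_contra hne
  set W : K[X] := U - C c * V with hW
  have hW0 : W ≠ 0 := fun h0 => hne (sub_eq_zero.mp h0)
  have hWc : W.coeff V.natDegree = 0 := by
    rw [hW, coeff_sub, coeff_C_mul, coeff_natDegree, hc, div_mul_cancel₀ _ hlV, sub_self]
  have hWD : W.natDegree ≤ D :=
    (natDegree_sub_le _ _).trans (max_le hUD ((natDegree_C_mul_le _ _).trans hVD))
  have hWV : derivative W * V = W * derivative V := by
    rw [hW, derivative_sub, derivative_C_mul]
    linear_combination h
  have hX (Q : K[X]) : (X * derivative Q).coeff Q.natDegree = Q.natDegree * Q.leadingCoeff := by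
    rcases Nat.eq_zero_or_pos Q.natDegree with h0 | h0
    · simp [h0]
    · obtain ⟨n, hn⟩ := Nat.exists_eq_add_of_lt h0
      rw [zero_add] at hn
      rw [leadingCoeff, hn, coeff_X_mul, coeff_derivative]
      push_cast
      ring
  have hXd (Q : K[X]) : (X * derivative Q).natDegree ≤ Q.natDegree := by
    rcases Nat.eq_zero_or_pos Q.natDegree with h0 | h0
    · rw [natDegree_eq_zero.mp h0 |>.choose_spec.symm]
      simp
    · refine natDegree_mul_le.trans ?_
      have := natDegree_derivative_le Q
      have := natDegree_X_le (R := K)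
      omega
  have h1 := congrArg (fun Q => coeff Q (W.natDegree + V.natDegree))
    (show (X * derivative W) * V = W * (X * derivative V) by linear_combination X * hWV)
  rw [coeff_mul_add_eq_of_natDegree_le (hXd W) le_rfl, coeff_mul_add_eq_of_natDegree_le le_rfl (hXd V), hX,
    hX,
    coeff_natDegree, coeff_natDegree] at h1
  have hlW : W.leadingCoeff ≠ 0 := leadingCoeff_ne_zero.mpr hW0
  have h2 : (W.natDegree : K) = V.natDegree := by
    have h3 : ((W.natDegree : K) - V.natDegree) * (W.leadingCoeff * V.leadingCoeff) = 0 := by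
      linear_combination h1
    exact sub_eq_zero.mp ((mul_eq_zero.mp h3).resolve_right (mul_ne_zero hlW hlV))
  rcases lt_trichotomy W.natDegree V.natDegree with h3 | h3 | h3
  · refine hD (V.natDegree - W.natDegree) (by omega) (by omega) ?_
    rw [Nat.cast_sub h3.le, h2, sub_self]
  · exact hlW (by rw [leadingCoeff, h3, hWc])
  · refine hD (W.natDegree - V.natDegree) (by omega) (by omega) ?_
    rw [Nat.cast_sub h3.le, h2, sub_self]

open Polynomial in
/-- If the second derivative of the rational function `b / a` vanishes and the degrees are small
compared with the characteristic, then `b / a` is a polynomial of degree at most one. -/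
theorem exists_eq_linear_mul {K : Type*} [Field K] {d : ℕ} (hd : 1 ≤ d)
    (hK : ∀ i : ℕ, 0 < i → i ≤ 2 * d → (i : K) ≠ 0) {a b : K[X]} (ha : a ≠ 0)
    (had : a.natDegree ≤ d) (hbd : b.natDegree ≤ d)
    (h : (derivative (derivative b) * a - b * derivative (derivative a)) * a
      - (derivative a + derivative a) * (derivative b * a - b * derivative a) = 0) :
    ∃ l m : K, b = (C l * X + C m) * a := by
  have had' := (natDegree_derivative_le a).trans (Nat.sub_le _ _)
  have hbd' := (natDegree_derivative_le b).trans (Nat.sub_le _ _)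
  have hdeg {p q : K[X]} (hp : p.natDegree ≤ d) (hq : q.natDegree ≤ d) :
      (p * q).natDegree ≤ 2 * d := natDegree_mul_le.trans (by omega)
  obtain ⟨l, hl⟩ := exists_eq_C_mul_of_derivative_mul_eq hK
    (U := derivative b * a - b * derivative a) (V := a * a) (mul_ne_zero ha ha)
    ((natDegree_sub_le _ _).trans (max_le (hdeg (hbd'.trans hbd) had)
      (hdeg hbd (had'.trans had)))) (hdeg had had) (by
      simp only [derivative_sub, derivative_mul]
      linear_combination a * h)
  have key : derivative (b - C l * X * a) * a = (b - C l * X * a) * derivative a := by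
    simp only [derivative_sub, derivative_mul, derivative_C, derivative_X]
    linear_combination hl
  have hX : (C l * X * a).natDegree ≤ 2 * d := by
    refine natDegree_mul_le.trans ?_
    have : (C l * X).natDegree ≤ 1 := by compute_degree
    omega
  obtain ⟨m, hm⟩ := exists_eq_C_mul_of_derivative_mul_eq hK ha
    ((natDegree_sub_le _ _).trans (max_le (by omega) hX)) (by omega) key
  exact ⟨l, m, by linear_combination hm⟩

variable {K : Type*} [Field K]

open MvPolynomial

/-- The derivative of a trivariate polynomial in a constant direction. -/
noncomputable def dirDeriv (w : Fin 3 → K) :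
    Derivation K (MvPolynomial (Fin 3) K) (MvPolynomial (Fin 3) K) :=
  mkDerivation K fun i => C (w i)

theorem dirDeriv_apply (w : Fin 3 → K) (f : MvPolynomial (Fin 3) K) :
    dirDeriv w f = C (w 0) * pderiv 0 f + C (w 1) * pderiv 1 f + C (w 2) * pderiv 2 f := by
  have h : dirDeriv w = (C (w 0) : MvPolynomial (Fin 3) K) • pderiv (R := K) 0
      + (C (w 1) : MvPolynomial (Fin 3) K) • pderiv (R := K) 1
      + (C (w 2) : MvPolynomial (Fin 3) K) • pderiv (R := K) 2 := by
    ext1 i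
    fin_cases i <;> simp [dirDeriv, mkDerivation_X, pderiv_X]
  rw [h]
  simp only [Derivation.add_apply, Derivation.smul_apply, smul_eq_mul]

theorem dirDeriv_comm (u w : Fin 3 → K) (f : MvPolynomial (Fin 3) K) :
    dirDeriv u (dirDeriv w f) = dirDeriv w (dirDeriv u f) := by
  have h : ⁅dirDeriv u, dirDeriv w⁆ = 0 := by
    ext1 i
    simp [Derivation.commutator_apply, dirDeriv, mkDerivation_X]
  have := congrArg (fun D => D f) h
  simpa [Derivation.commutator_apply, sub_eq_zero] using this

theorem totalDegree_pderiv_le (i : Fin 3) (f : MvPolynomial (Fin 3) K) :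
    (pderiv i f).totalDegree ≤ f.totalDegree - 1 := by
  refine Finset.sup_le fun s hs => ?_
  have h1 : f.coeff (s + Finsupp.single i 1) ≠ 0 := by
    intro h0
    rw [mem_support_iff, coeff_pderiv, h0] at hs
    simp at hs
  have h2 := le_totalDegree (mem_support_iff.mpr h1)
  rw [Finsupp.sum_add_index' (by simp) (by simp), Finsupp.sum_single_index rfl] at h2
  omega

theorem totalDegree_dirDeriv_le (w : Fin 3 → K) (f : MvPolynomial (Fin 3) K) :
    (dirDeriv w f).totalDegree ≤ f.totalDegree := by
  have h (i : Fin 3) : (C (w i) * pderiv i f).totalDegree ≤ f.totalDegree := by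
    refine (totalDegree_mul _ _).trans ?_
    rw [totalDegree_C, zero_add]
    exact (totalDegree_pderiv_le i f).trans (Nat.sub_le _ _)
  rw [dirDeriv_apply]
  exact (totalDegree_add _ _).trans
    (max_le ((totalDegree_add _ _).trans (max_le (h 0) (h 1))) (h 2))

/-- A polynomial of degree smaller than the characteristic whose partial derivatives all vanish is
constant. -/
theorem eq_C_of_forall_pderiv_eq_zero {f : MvPolynomial (Fin 3) K}
    (hK : ∀ i : ℕ, 0 < i → i ≤ f.totalDegree → (i : K) ≠ 0) (h : ∀ i, pderiv i f = 0) :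
    f = C (f.coeff 0) := by
  ext s
  rw [coeff_C]
  split_ifs with hs
  · rw [hs]
  by_contra hne
  obtain ⟨i, hi⟩ : ∃ i, s i ≠ 0 := by
    by_contra! h0
    exact hs (Finsupp.ext fun i => (h0 i).symm)
  have hle : Finsupp.single i 1 ≤ s := by
    rw [Finsupp.single_le_iff]
    omega
  have h1 := congrArg (coeff (s - Finsupp.single i 1)) (h i)
  rw [coeff_pderiv, tsub_add_cancel_of_le hle, coeff_zero] at h1
  have h2 : (((s - Finsupp.single i 1 : Fin 3 →₀ ℕ) i : ℕ) : K) + 1 = (s i : ℕ) := by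
    rw [Finsupp.tsub_apply, Finsupp.single_eq_same, ← Nat.cast_add_one]
    congr 1
    omega
  rw [h2] at h1
  refine hK (s i) (by omega) ?_ ((mul_eq_zero.mp h1).resolve_left hne)
  have h3 := le_totalDegree (mem_support_iff.mpr hne)
  refine le_trans ?_ h3
  by_cases hi' : i ∈ s.support
  · exact Finset.single_le_sum (f := fun j => s j) (fun _ _ => Nat.zero_le _) hi'
  · simp_all

/-- The restriction of a trivariate polynomial to the line through `v` with direction `w`. -/
noncomputable def restrictLine (v w : Fin 3 → K) : MvPolynomial (Fin 3) K →ₐ[K] Polynomial K :=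
  aeval fun i => Polynomial.C (v i) + Polynomial.C (w i) * Polynomial.X

theorem derivative_restrictLine (v w : Fin 3 → K) (f : MvPolynomial (Fin 3) K) :
    Polynomial.derivative (restrictLine v w f) = restrictLine v w (dirDeriv w f) := by
  induction f using MvPolynomial.induction_on with
  | C a => simp [restrictLine, dirDeriv]
  | add p q hp hq => simp [hp, hq]
  | mul_X p i hp =>
    rw [Derivation.leibniz, map_mul, Polynomial.derivative_mul, hp]
    simp [restrictLine, dirDeriv, mkDerivation_X]
    ring

theorem eval_restrictLine (v w : Fin 3 → K) (f : MvPolynomial (Fin 3) K) (t : K) :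
    (restrictLine v w f).eval t = eval (fun i => v i + t * w i) f := by
  induction f using MvPolynomial.induction_on with
  | C a => simp [restrictLine]
  | add p q hp hq => simp [hp, hq]
  | mul_X p i hp =>
    rw [map_mul, Polynomial.eval_mul, hp, map_mul, eval_X]
    congr 1
    simp only [restrictLine, aeval_X, Polynomial.eval_add, Polynomial.eval_mul, Polynomial.eval_C,
      Polynomial.eval_X]
    ring

theorem natDegree_restrictLine_le (v w : Fin 3 → K) (f : MvPolynomial (Fin 3) K) :
    (restrictLine v w f).natDegree ≤ f.totalDegree := by
  rw [restrictLine, aeval_def, eval₂_eq']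
  refine Polynomial.natDegree_sum_le_of_forall_le _ _ fun s hs => ?_
  rw [Polynomial.algebraMap_eq]
  refine (Polynomial.natDegree_C_mul_le _ _).trans ((Polynomial.natDegree_prod_le _ _).trans ?_)
  refine le_trans (Finset.sum_le_sum fun i _ => ?_) (b := ∑ i, s i) ?_
  · refine Polynomial.natDegree_pow_le.trans ?_
    have : (Polynomial.C (v i) + Polynomial.C (w i) * Polynomial.X).natDegree ≤ 1 := by
      compute_degree
    nlinarith
  · have := le_totalDegree hs
    rwa [Finsupp.sum_fintype _ _ (by simp)] at this


/-- The isotropic direction of slope `m`. -/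
def dir (m : K) : Fin 3 → K := ![1, -m, -m ^ 2]

/-- The polarization of the quadratic family of isotropic directions. -/
def polarDir (m n : K) : Fin 3 → K := ![2, -(m + n), -(2 * m * n)]

/-- The derivative of the isotropic direction with respect to the slope. -/
def tanDir (m : K) : Fin 3 → K := ![0, -1, -(2 * m)]

/-- Half of the second derivative of the isotropic direction with respect to the slope. -/
def vertDir : Fin 3 → K := ![0, 0, -1]

theorem dirDeriv_dir_eq_polar (m n l : K) (f : MvPolynomial (Fin 3) K) :
    C ((m - n) ^ 2) * dirDeriv (dir l) f =
      C ((l - n) ^ 2) * dirDeriv (dir m) f + C ((m - l) ^ 2) * dirDeriv (dir n) f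
        + C ((l - n) * (m - l)) * dirDeriv (polarDir m n) f := by
  simp only [dirDeriv_apply, dir, polarDir, Matrix.cons_val, map_mul, map_sub, map_pow, map_neg,
    map_add, map_one, map_ofNat]
  ring

theorem dirDeriv_dir_eq_taylor (m n : K) (f : MvPolynomial (Fin 3) K) :
    dirDeriv (dir n) f = dirDeriv (dir m) f + C (n - m) * dirDeriv (tanDir m) f
      + C ((n - m) ^ 2) * dirDeriv vertDir f := by
  simp only [dirDeriv_apply, dir, tanDir, vertDir, Matrix.cons_val, map_mul, map_sub, map_pow,
    map_neg, map_one, map_ofNat, map_zero]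
  ring

theorem dirDeriv_polarDir (m n : K) (f : MvPolynomial (Fin 3) K) :
    dirDeriv (polarDir m n) f = C 2 * dirDeriv (dir m) f
      + C (n - m) * dirDeriv (tanDir m) f := by
  simp only [dirDeriv_apply, dir, tanDir, polarDir, Matrix.cons_val, map_mul, map_sub, map_pow,
    map_neg, map_add, map_one, map_ofNat, map_zero]
  ring

/-- The polynomial which, along an isotropic line of slope `n` on the surface `f = 0`, expresses
that the other isotropic tangent direction is asymptotic. -/
noncomputable def umbilic (m n : K) (f : MvPolynomial (Fin 3) K) : MvPolynomial (Fin 3) K :=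
  dirDeriv (polarDir m n) f ^ 4 * dirDeriv (dir m) (dirDeriv (dir m) f)
    + dirDeriv (dir m) f ^ 4 * dirDeriv (dir n) (dirDeriv (dir n) f)
    + dirDeriv (polarDir m n) f ^ 2 * dirDeriv (dir m) f ^ 2
      * (dirDeriv (polarDir m n) (dirDeriv (polarDir m n) f)
        + (dirDeriv (dir n) (dirDeriv (dir m) f) + dirDeriv (dir n) (dirDeriv (dir m) f)))
    - dirDeriv (polarDir m n) f ^ 3 * dirDeriv (dir m) f
      * (dirDeriv (polarDir m n) (dirDeriv (dir m) f)
        + dirDeriv (polarDir m n) (dirDeriv (dir m) f))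
    - dirDeriv (polarDir m n) f * dirDeriv (dir m) f ^ 3
      * (dirDeriv (polarDir m n) (dirDeriv (dir n) f)
        + dirDeriv (polarDir m n) (dirDeriv (dir n) f))

/-- The numerator of the second derivative, in the isotropic direction of slope `m`, of the ratio
which determines the other isotropic tangent direction of the surface `f = 0`. -/
noncomputable def slopeCurvature (m : K) (f : MvPolynomial (Fin 3) K) : MvPolynomial (Fin 3) K :=
  (dirDeriv (dir m) (dirDeriv (dir m) (dirDeriv vertDir f)) * dirDeriv (tanDir m) f
      - dirDeriv vertDir f * dirDeriv (dir m) (dirDeriv (dir m) (dirDeriv (tanDir m) f)))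
      * dirDeriv (tanDir m) f
    - (dirDeriv (dir m) (dirDeriv (tanDir m) f) + dirDeriv (dir m) (dirDeriv (tanDir m) f))
      * (dirDeriv (dir m) (dirDeriv vertDir f) * dirDeriv (tanDir m) f
        - dirDeriv vertDir f * dirDeriv (dir m) (dirDeriv (tanDir m) f))

theorem eval_umbilic_eq_zero {m n l : K} (hln : l ≠ n) {f : MvPolynomial (Fin 3) K}
    {v : Fin 3 → K} (hn : eval v (dirDeriv (dir n) f) = 0)
    (hnn : eval v (dirDeriv (dir n) (dirDeriv (dir n) f)) = 0)
    (hl : eval v (dirDeriv (dir l) f) = 0)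
    (hll : eval v (dirDeriv (dir l) (dirDeriv (dir l) f)) = 0) :
    eval v (umbilic m n f) = 0 := by
  have hr : l - n ≠ 0 := sub_ne_zero.mpr hln
  have hdec (g : MvPolynomial (Fin 3) K) := congrArg (eval v) (dirDeriv_dir_eq_polar m n l g)
  simp only [map_mul, map_add, eval_C] at hdec
  have e1 := hdec f
  have e2 := hdec (dirDeriv (dir l) f)
  have e3 := hdec (dirDeriv (dir m) f)
  have e4 := hdec (dirDeriv (dir n) f)
  have e5 := hdec (dirDeriv (polarDir m n) f)
  rw [dirDeriv_comm (dir m) (dir l), dirDeriv_comm (dir n) (dir l),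
    dirDeriv_comm (polarDir m n) (dir l)] at e2
  rw [dirDeriv_comm (dir m) (dir n)] at e4
  rw [dirDeriv_comm (dir m) (polarDir m n), dirDeriv_comm (dir n) (polarDir m n)] at e5
  simp only [umbilic, map_mul, map_add, map_sub, map_pow]
  rw [hn, hl] at e1
  rw [hll] at e2
  rw [hnn] at e4 ⊢
  generalize eval v (dirDeriv (dir m) f) = f1 at *
  generalize eval v (dirDeriv (polarDir m n) f) = N at *
  generalize eval v (dirDeriv (dir m) (dirDeriv (dir m) f)) = f11 at *
  generalize eval v (dirDeriv (dir n) (dirDeriv (dir m) f)) = f12 at *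
  generalize eval v (dirDeriv (polarDir m n) (dirDeriv (dir m) f)) = f1n at *
  generalize eval v (dirDeriv (polarDir m n) (dirDeriv (dir n) f)) = f2n at *
  generalize eval v (dirDeriv (polarDir m n) (dirDeriv (polarDir m n) f)) = fnn at *
  generalize eval v (dirDeriv (dir l) (dirDeriv (dir m) f)) = fl1 at *
  generalize eval v (dirDeriv (dir l) (dirDeriv (dir n) f)) = fl2 at *
  generalize eval v (dirDeriv (dir l) (dirDeriv (polarDir m n) f)) = fln at *
  obtain ⟨u, hu⟩ : ∃ u, m - l = -u * (l - n) := ⟨-((m - l) / (l - n)), by field_simp⟩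
  generalize l - n = r at *
  have hf1 : f1 = u * N := by
    have : r ^ 2 * (f1 - u * N) = 0 := by
      rw [hu] at e1
      linear_combination -e1
    exact sub_eq_zero.mp ((mul_eq_zero.mp this).resolve_left (pow_ne_zero 2 hr))
  have hq : f11 + u ^ 2 * (fnn + 2 * f12) - 2 * u * f1n - 2 * u ^ 3 * f2n = 0 := by
    have : r ^ 4 * (f11 + u ^ 2 * (fnn + 2 * f12) - 2 * u * f1n - 2 * u ^ 3 * f2n) = 0 := by
      rw [hu] at e2 e3 e4 e5
      linear_combination (-(m - n) ^ 2) * e2 - r ^ 2 * e3 - (u * r) ^ 2 * e4 + u * r ^ 2 * e5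
    exact (mul_eq_zero.mp this).resolve_left (pow_ne_zero 4 hr)
  rw [hf1]
  linear_combination N ^ 4 * hq

theorem eval_slopeCurvature_eq_zero {m n : K} (hmn : m ≠ n) {f : MvPolynomial (Fin 3) K}
    {v : Fin 3 → K} (hm : eval v (dirDeriv (dir m) f) = 0)
    (hmm : eval v (dirDeriv (dir m) (dirDeriv (dir m) f)) = 0)
    (hmmm : eval v (dirDeriv (dir m) (dirDeriv (dir m) (dirDeriv (dir m) f))) = 0)
    (hn : eval v (dirDeriv (dir n) f) = 0)
    (hu : eval v (dirDeriv (dir n) (umbilic m n f)) = 0) :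
    eval v (slopeCurvature m f) = 0 := by
  have hh : n - m ≠ 0 := sub_ne_zero.mpr hmn.symm
  have htay (g : MvPolynomial (Fin 3) K) := congrArg (eval v) (dirDeriv_dir_eq_taylor m n g)
  have hpol (g : MvPolynomial (Fin 3) K) := congrArg (eval v) (dirDeriv_polarDir m n g)
  simp only [map_mul, map_add, eval_C] at htay hpol
  have e1 := htay f
  have e2 := htay (dirDeriv (dir m) f)
  have e3 := htay (dirDeriv (dir m) (dirDeriv (dir m) f))
  have e4 := hpol f
  have e5 := hpol (dirDeriv (dir m) f)
  simp only [dirDeriv_comm vertDir (dir m), dirDeriv_comm (tanDir m) (dir m)] at e2 e3 e5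
  simp only [umbilic, map_mul, map_add, map_sub, Derivation.leibniz, Derivation.leibniz_pow,
    smul_eq_mul, nsmul_eq_mul, map_pow, map_natCast, hm, hmm] at hu
  simp only [slopeCurvature, map_mul, map_add, map_sub]
  rw [hm, hn] at e1
  rw [hmm] at e2 e5
  rw [hmmm] at e3
  rw [hm] at e4
  generalize eval v (dirDeriv (dir n) (dirDeriv (dir m) f)) = f12 at *
  generalize eval v (dirDeriv (dir n) (dirDeriv (dir m) (dirDeriv (dir m) f))) = f112 at *
  generalize eval v (dirDeriv (polarDir m n) (dirDeriv (dir m) f)) = f1n at *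
  generalize eval v (dirDeriv (polarDir m n) f) = N at *
  generalize eval v (dirDeriv (tanDir m) f) = A at *
  generalize eval v (dirDeriv vertDir f) = B at *
  generalize eval v (dirDeriv (dir m) (dirDeriv (tanDir m) f)) = A1 at *
  generalize eval v (dirDeriv (dir m) (dirDeriv vertDir f)) = B1 at *
  generalize eval v (dirDeriv (dir m) (dirDeriv (dir m) (dirDeriv (tanDir m) f))) = A2 at *
  generalize eval v (dirDeriv (dir m) (dirDeriv (dir m) (dirDeriv vertDir f))) = B2 at *
  generalize n - m = h at *
  have hA : A = -h * B := by
    have : h * (A + h * B) = 0 := by linear_combination -e1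
    linear_combination (mul_eq_zero.mp this).resolve_left hh
  have key : N ^ 3 * (N * f112 - 2 * f12 * f1n) = 0 := by
    norm_num at hu
    linear_combination hu
  rcases mul_eq_zero.mp key with h0 | h0
  · have hN : N = 0 := by simpa using h0
    have hA0 : A = 0 := by
      have : h * A = 0 := by linear_combination hN - e4
      exact (mul_eq_zero.mp this).resolve_left hh
    have hB0 : B = 0 := by
      have : h * B = 0 := by linear_combination hA - hA0
      exact (mul_eq_zero.mp this).resolve_left hh
    rw [hA0, hB0]
    ring
  · rw [e4, e3, e2, e5] at h0
    have h1 : A * (A2 + h * B2) - 2 * (A1 + h * B1) * A1 = 0 := by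
      have : h ^ 2 * (A * (A2 + h * B2) - 2 * (A1 + h * B1) * A1) = 0 := by
        linear_combination h0
      exact (mul_eq_zero.mp this).resolve_left (pow_ne_zero 2 hh)
    have h2 : h * ((B2 * A - B * A2) * A - (A1 + A1) * (B1 * A - B * A1)) = 0 := by
      linear_combination A * h1 - (A2 * A - 2 * A1 ^ 2) * hA
    exact (mul_eq_zero.mp h2).resolve_left hh


/-- The symplectic pairing on affine space, in the coordinates `(slope, position, height)`. -/
def pairing (p q : K × K × K) : K := p.1 * q.2.1 - p.2.1 * q.1 + p.2.2 - q.2.2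

theorem pairing_swap (p q : K × K × K) : pairing q p = -pairing p q := by
  simp only [pairing]
  ring

/-- The point at parameter `t` of the isotropic line attached to `p`. -/
def linePoint (p : K × K × K) (t : K) : Fin 3 → K :=
  fun i => (![0, p.2.1, p.2.2 + p.2.1 * p.1] : Fin 3 → K) i + t * dir p.1 i

/-- The restriction of a trivariate polynomial to the isotropic line attached to `p`. -/
noncomputable def toLine (p : K × K × K) : MvPolynomial (Fin 3) K →ₐ[K] Polynomial K :=
  restrictLine ![0, p.2.1, p.2.2 + p.2.1 * p.1] (dir p.1)

theorem eval_toLine (p : K × K × K) (f : MvPolynomial (Fin 3) K) (t : K) :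
    (toLine p f).eval t = eval (linePoint p t) f := eval_restrictLine _ _ _ _

theorem derivative_toLine (p : K × K × K) (f : MvPolynomial (Fin 3) K) :
    Polynomial.derivative (toLine p f) = toLine p (dirDeriv (dir p.1) f) :=
  derivative_restrictLine _ _ _

theorem natDegree_toLine_le (p : K × K × K) (f : MvPolynomial (Fin 3) K) :
    (toLine p f).natDegree ≤ f.totalDegree := natDegree_restrictLine_le _ _ _

/-- The parameter of the intersection point of the isotropic lines attached to `p` and `q`. -/
def meetParam (p q : K × K × K) : K := (p.2.1 - q.2.1) / (p.1 - q.1)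

theorem linePoint_meetParam {p q : K × K × K} (hpq : pairing p q = 0) (hm : p.1 ≠ q.1) :
    linePoint p (meetParam p q) = linePoint q (meetParam p q) := by
  have hm' := sub_ne_zero.mpr hm
  have ht : meetParam p q * (p.1 - q.1) = p.2.1 - q.2.1 := div_mul_cancel₀ _ hm'
  rw [pairing] at hpq
  ext i
  fin_cases i
  · simp [linePoint, dir]
  · simp only [linePoint, dir, Fin.mk_one, Matrix.cons_val]
    linear_combination -ht
  · simp only [linePoint, dir, Fin.reduceFinMk, Matrix.cons_val]
    linear_combination hpq - (p.1 + q.1) * ht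

theorem pairing_eq_zero_of_linePoint_eq {p q : K × K × K} {t : K}
    (h : linePoint p t = linePoint q t) : pairing p q = 0 := by
  have h1 := congrFun h 1
  have h2 := congrFun h 2
  simp only [linePoint, dir, Matrix.cons_val] at h1 h2
  rw [pairing]
  linear_combination h2 - (p.1 + q.1) * h1

/-- The elements of `L` other than `p` which are orthogonal to `p`. -/
noncomputable def neighbors (L : Finset (K × K × K)) (p : K × K × K) : Finset (K × K × K) :=
  L.filter fun q => p ≠ q ∧ pairing p q = 0

theorem mem_neighbors {L : Finset (K × K × K)} {p q : K × K × K} :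
    q ∈ neighbors L p ↔ q ∈ L ∧ p ≠ q ∧ pairing p q = 0 := Finset.mem_filter

theorem mem_neighbors_symm {L : Finset (K × K × K)} {p q : K × K × K} (hp : p ∈ L)
    (hq : q ∈ neighbors L p) : p ∈ neighbors L q := by
  rw [mem_neighbors] at hq ⊢
  exact ⟨hp, hq.2.1.symm, by rw [pairing_swap, hq.2.2, neg_zero]⟩

/-- A finite family of isotropic lines in which no two distinct concurrent lines are parallel and no
three lines are concurrent. -/
structure IsGeneric (L : Finset (K × K × K)) : Prop where
  slope_ne : ∀ p ∈ L, ∀ q ∈ neighbors L p, p.1 ≠ q.1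
  pairing_ne : ∀ p ∈ L, ∀ q ∈ neighbors L p, ∀ r ∈ neighbors L p, q ≠ r → pairing q r ≠ 0

theorem IsGeneric.mono {L M : Finset (K × K × K)} (hL : IsGeneric L) (hM : M ⊆ L) :
    IsGeneric M := by
  have h (p : K × K × K) : neighbors M p ⊆ neighbors L p := Finset.filter_subset_filter _ hM
  exact ⟨fun p hp q hq => hL.slope_ne p (hM hp) q (h p hq),
    fun p hp q hq r hr => hL.pairing_ne p (hM hp) q (h p hq) r (h p hr)⟩

theorem IsGeneric.meetParam_injOn {L : Finset (K × K × K)} (hL : IsGeneric L) {p : K × K × K}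
    (hp : p ∈ L) : Set.InjOn (meetParam p) (neighbors L p) := by
  intro q hq r hr h
  by_contra hne
  refine hL.pairing_ne p hp q hq r hr hne (pairing_eq_zero_of_linePoint_eq (t := meetParam p q) ?_)
  rw [← linePoint_meetParam (mem_neighbors.mp hq).2.2 (hL.slope_ne p hp q hq), h,
    ← linePoint_meetParam (mem_neighbors.mp hr).2.2 (hL.slope_ne p hp r hr)]

theorem IsGeneric.eq_zero_of_eval {L : Finset (K × K × K)} (hL : IsGeneric L) {p : K × K × K}
    (hp : p ∈ L) (g : Polynomial K) (hg : g.natDegree < (neighbors L p).card)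
    (h : ∀ q ∈ neighbors L p, g.eval (meetParam p q) = 0) : g = 0 := by
  refine Polynomial.eq_zero_of_natDegree_lt_card_of_eval_eq_zero' g
    ((neighbors L p).image (meetParam p)) ?_ ?_
  · intro t ht
    obtain ⟨q, hq, rfl⟩ := Finset.mem_image.mp ht
    exact h q hq
  · rwa [Finset.card_image_of_injOn (hL.meetParam_injOn hp)]

theorem natDegree_toLine_umbilic_le (p : K × K × K) (m n : K) {f : MvPolynomial (Fin 3) K} {d : ℕ}
    (hf : f.totalDegree ≤ d) : (toLine p (umbilic m n f)).natDegree ≤ 5 * d := by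
  have h1 (u : Fin 3 → K) : (dirDeriv u f).totalDegree ≤ d := (totalDegree_dirDeriv_le u f).trans hf
  have h2 (u w : Fin 3 → K) : (dirDeriv u (dirDeriv w f)).totalDegree ≤ d :=
    (totalDegree_dirDeriv_le _ _).trans (h1 w)
  have hmul {g h : MvPolynomial (Fin 3) K} {a b c : ℕ} (hg : g.totalDegree ≤ a)
      (hh : h.totalDegree ≤ b) (hc : a + b ≤ c) : (g * h).totalDegree ≤ c :=
    (totalDegree_mul _ _).trans (by omega)
  have hpow {g : MvPolynomial (Fin 3) K} (hg : g.totalDegree ≤ d) (k : ℕ) :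
      (g ^ k).totalDegree ≤ k * d := (totalDegree_pow _ _).trans (Nat.mul_le_mul_left _ hg)
  have hadd {g h : MvPolynomial (Fin 3) K} {a : ℕ} (hg : g.totalDegree ≤ a)
      (hh : h.totalDegree ≤ a) : (g + h).totalDegree ≤ a :=
    (totalDegree_add _ _).trans (max_le hg hh)
  have hsub {g h : MvPolynomial (Fin 3) K} {a : ℕ} (hg : g.totalDegree ≤ a)
      (hh : h.totalDegree ≤ a) : (g - h).totalDegree ≤ a :=
    (totalDegree_sub _ _).trans (max_le hg hh)
  refine (natDegree_toLine_le _ _).trans ?_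
  refine hsub (hsub (hadd (hadd ?_ ?_) ?_) ?_) ?_
  · exact hmul (hpow (h1 _) 4) (h2 _ _) (by omega)
  · exact hmul (hpow (h1 _) 4) (h2 _ _) (by omega)
  · exact hmul (hmul (hpow (h1 _) 2) (hpow (h1 _) 2) le_rfl)
      (hadd (h2 _ _) (hadd (h2 _ _) (h2 _ _))) (by omega)
  · exact hmul (hmul (hpow (h1 _) 3) (h1 _) le_rfl) (hadd (h2 _ _) (h2 _ _)) (by omega)
  · exact hmul (hmul (h1 _) (hpow (h1 _) 3) le_rfl) (hadd (h2 _ _) (h2 _ _)) (by omega)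

theorem natDegree_toLine_slopeCurvature_le (p : K × K × K) (m : K) {f : MvPolynomial (Fin 3) K}
    {d : ℕ} (hf : f.totalDegree ≤ d) : (toLine p (slopeCurvature m f)).natDegree ≤ 3 * d := by
  have h0 {g : MvPolynomial (Fin 3) K} (u : Fin 3 → K) (hg : g.totalDegree ≤ d) :
      (dirDeriv u g).totalDegree ≤ d := (totalDegree_dirDeriv_le _ _).trans hg
  have h1 (u : Fin 3 → K) := h0 u hf
  have h2 (u w : Fin 3 → K) := h0 u (h1 w)
  have h3 (u w z : Fin 3 → K) := h0 u (h2 w z)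
  have hmul {g h : MvPolynomial (Fin 3) K} {a b c : ℕ} (hg : g.totalDegree ≤ a)
      (hh : h.totalDegree ≤ b) (hc : a + b ≤ c) : (g * h).totalDegree ≤ c :=
    (totalDegree_mul _ _).trans (by omega)
  have hadd {g h : MvPolynomial (Fin 3) K} {a : ℕ} (hg : g.totalDegree ≤ a)
      (hh : h.totalDegree ≤ a) : (g + h).totalDegree ≤ a :=
    (totalDegree_add _ _).trans (max_le hg hh)
  have hsub {g h : MvPolynomial (Fin 3) K} {a : ℕ} (hg : g.totalDegree ≤ a)
      (hh : h.totalDegree ≤ a) : (g - h).totalDegree ≤ a :=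
    (totalDegree_sub _ _).trans (max_le hg hh)
  refine (natDegree_toLine_le _ _).trans ?_
  refine hsub (hmul (a := 2 * d) (b := d) (hsub ?_ ?_) (h1 _) (by omega))
    (hmul (a := d) (b := 2 * d) (hadd (h2 _ _) (h2 _ _)) (hsub ?_ ?_) (by omega))
  · exact hmul (h3 _ _ _) (h1 _) (by omega)
  · exact hmul (h1 _) (h3 _ _ _) (by omega)
  · exact hmul (h2 _ _) (h1 _) (by omega)
  · exact hmul (h1 _) (h2 _ _) (by omega)

theorem toLine_dirDeriv_dir_eq_zero {p : K × K × K} {f : MvPolynomial (Fin 3) K}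
    (hf : toLine p f = 0) : toLine p (dirDeriv (dir p.1) f) = 0 := by
  rw [← derivative_toLine, hf, Polynomial.derivative_zero]

theorem toLine_umbilic_eq_zero {L : Finset (K × K × K)} (hL : IsGeneric L)
    {f : MvPolynomial (Fin 3) K} {d : ℕ} (hfd : f.totalDegree ≤ d)
    (hf : ∀ p ∈ L, toLine p f = 0) {q : K × K × K} (hq : q ∈ L)
    (hdeg : 5 * d < (neighbors L q).card) (m : K) : toLine q (umbilic m q.1 f) = 0 := by
  refine hL.eq_zero_of_eval hq _
    ((natDegree_toLine_umbilic_le q m q.1 hfd).trans_lt hdeg) fun r hr => ?_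
  have hrL := (mem_neighbors.mp hr).1
  have hne := hL.slope_ne q hq r hr
  have hpt := linePoint_meetParam (mem_neighbors.mp hr).2.2 hne
  have hq1 := toLine_dirDeriv_dir_eq_zero (hf q hq)
  have hr1 := toLine_dirDeriv_dir_eq_zero (hf r hrL)
  rw [eval_toLine]
  refine eval_umbilic_eq_zero hne.symm ?_ ?_ ?_ ?_
  · rw [← eval_toLine, hq1, Polynomial.eval_zero]
  · rw [← eval_toLine, toLine_dirDeriv_dir_eq_zero hq1, Polynomial.eval_zero]
  · rw [hpt, ← eval_toLine, hr1, Polynomial.eval_zero]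
  · rw [hpt, ← eval_toLine, toLine_dirDeriv_dir_eq_zero hr1, Polynomial.eval_zero]

theorem toLine_slopeCurvature_eq_zero {L : Finset (K × K × K)} (hL : IsGeneric L)
    {f : MvPolynomial (Fin 3) K} {d : ℕ} (hfd : f.totalDegree ≤ d)
    (hf : ∀ p ∈ L, toLine p f = 0) (hdeg : ∀ p ∈ L, 5 * d < (neighbors L p).card)
    {p : K × K × K} (hp : p ∈ L) : toLine p (slopeCurvature p.1 f) = 0 := by
  refine hL.eq_zero_of_eval hp _ ((natDegree_toLine_slopeCurvature_le p p.1 hfd).trans_lt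
    ((Nat.mul_le_mul_right d (by norm_num)).trans_lt (hdeg p hp))) fun q hq => ?_
  have hqL := (mem_neighbors.mp hq).1
  have hne := hL.slope_ne p hp q hq
  have hpt := linePoint_meetParam (mem_neighbors.mp hq).2.2 hne
  have hp1 := toLine_dirDeriv_dir_eq_zero (hf p hp)
  have hp2 := toLine_dirDeriv_dir_eq_zero hp1
  rw [eval_toLine]
  refine eval_slopeCurvature_eq_zero hne ?_ ?_ ?_ ?_ ?_
  · rw [← eval_toLine, hp1, Polynomial.eval_zero]
  · rw [← eval_toLine, hp2, Polynomial.eval_zero]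
  · rw [← eval_toLine, toLine_dirDeriv_dir_eq_zero hp2, Polynomial.eval_zero]
  · rw [hpt, ← eval_toLine, toLine_dirDeriv_dir_eq_zero (hf q hqL), Polynomial.eval_zero]
  · rw [hpt, ← eval_toLine, toLine_dirDeriv_dir_eq_zero
      (toLine_umbilic_eq_zero hL hfd hf hqL (hdeg q hqL) p.1), Polynomial.eval_zero]

/-- The elements orthogonal to `p` which satisfy a nontrivial relation between slope and position
are determined by one of these two coordinates. -/
theorem card_le_of_linear_relation {k : ℕ} {p : K × K × K} {l m : K} {S : Finset (K × K × K)}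
    (hslope : (S.image fun q => q.1).card ≤ k) (hpos : (S.image fun q => q.2.1).card ≤ k)
    (horth : ∀ q ∈ S, pairing p q = 0)
    (hrel : ∀ q ∈ S, l * (q.2.1 - p.2.1) + m * (q.1 - p.1) = -1) : S.card ≤ k := by
  have hheight {q r : K × K × K} (hq : q ∈ S) (hr : r ∈ S) (h1 : q.1 = r.1)
      (h2 : q.2.1 = r.2.1) : q = r := by
    refine Prod.ext h1 (Prod.ext h2 ?_)
    have hq' := horth q hq
    have hr' := horth r hr
    rw [pairing] at hq' hr'
    rw [h1, h2] at hq'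
    linear_combination hr' - hq'
  by_cases hl : l = 0
  · subst hl
    have hm : m ≠ 0 ∨ S = ∅ := by
      by_contra! h
      obtain ⟨q, hq⟩ := h.2
      have := hrel q hq
      simp [h.1] at this
    rcases hm with hm | rfl
    · refine le_trans (le_of_eq (Finset.card_image_of_injOn ?_).symm) hpos
      intro q hq r hr h
      refine hheight hq hr (mul_left_cancel₀ hm ?_) h
      linear_combination hrel q hq - hrel r hr
    · simp
  · refine le_trans (le_of_eq (Finset.card_image_of_injOn ?_).symm) hslope
    intro q hq r hr h
    refine hheight hq hr h (mul_left_cancel₀ hl ?_)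
    simp only at h
    have h1 := hrel q hq
    have h2 := hrel r hr
    rw [h] at h1
    linear_combination h1 - h2

/-- If every line of a generic family is rich, then the gradient of a low degree polynomial
vanishing on the family vanishes on the family as well. -/
theorem toLine_pderiv_eq_zero {L : Finset (K × K × K)} (hL : IsGeneric L)
    {f : MvPolynomial (Fin 3) K} {d k : ℕ} (hd : 1 ≤ d)
    (hK : ∀ i : ℕ, 0 < i → i ≤ 2 * d → (i : K) ≠ 0) (hfd : f.totalDegree ≤ d)
    (hf : ∀ p ∈ L, toLine p f = 0)
    (hslope : (L.image fun q => q.1).card ≤ k) (hpos : (L.image fun q => q.2.1).card ≤ k)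
    (hdeg : ∀ p ∈ L, 5 * d + k < (neighbors L p).card) {p : K × K × K} (hp : p ∈ L) (i : Fin 3) :
    toLine p (pderiv i f) = 0 := by
  have hcurv := toLine_slopeCurvature_eq_zero hL hfd hf
    (fun p hp => (Nat.le_add_right _ _).trans_lt (hdeg p hp)) hp
  have hp1 := toLine_dirDeriv_dir_eq_zero (hf p hp)
  set a := toLine p (dirDeriv (tanDir p.1) f) with ha
  set b := toLine p (dirDeriv vertDir f) with hb
  have had : a.natDegree ≤ d :=
    (natDegree_toLine_le _ _).trans ((totalDegree_dirDeriv_le _ _).trans hfd)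
  have hbd : b.natDegree ≤ d :=
    (natDegree_toLine_le _ _).trans ((totalDegree_dirDeriv_le _ _).trans hfd)
  have hmeet : ∀ q ∈ neighbors L p,
      a.eval (meetParam p q) + (q.1 - p.1) * b.eval (meetParam p q) = 0 := by
    intro q hq
    have hne := hL.slope_ne p hp q hq
    have hpt := linePoint_meetParam (mem_neighbors.mp hq).2.2 hne
    have hq1 := toLine_dirDeriv_dir_eq_zero (hf q (mem_neighbors.mp hq).1)
    have h1 := congrArg (eval (linePoint p (meetParam p q))) (dirDeriv_dir_eq_taylor p.1 q.1 f)
    simp only [map_add, map_mul, eval_C] at h1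
    rw [← eval_toLine p (dirDeriv (dir p.1) f), hp1, hpt, ← eval_toLine q, hq1, ← hpt,
      ← eval_toLine, ← eval_toLine, Polynomial.eval_zero] at h1
    refine (mul_eq_zero.mp (?_ : (q.1 - p.1) * _ = 0)).resolve_left (sub_ne_zero.mpr hne.symm)
    linear_combination -h1
  have ha0 : a = 0 := by
    by_contra ha0
    simp only [slopeCurvature, map_sub, map_mul, map_add, ← derivative_toLine] at hcurv
    obtain ⟨l, m, hlm⟩ := exists_eq_linear_mul hd hK ha0 had hbd hcurv
    have hsplit := Finset.card_filter_add_card_filter_not (s := neighbors L p)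
      (fun q => a.eval (meetParam p q) = 0)
    have h1 : ((neighbors L p).filter fun q => a.eval (meetParam p q) = 0).card ≤ d := by
      by_contra! hlt
      refine ha0 (Polynomial.eq_zero_of_natDegree_lt_card_of_eval_eq_zero' a
        (((neighbors L p).filter fun q => a.eval (meetParam p q) = 0).image (meetParam p)) ?_ ?_)
      · intro t ht
        obtain ⟨q, hq, rfl⟩ := Finset.mem_image.mp ht
        exact (Finset.mem_filter.mp hq).2
      · rw [Finset.card_image_of_injOn
          ((hL.meetParam_injOn hp).mono (Finset.coe_subset.mpr (Finset.filter_subset _ _)))]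
        exact had.trans_lt hlt
    have hsub : ((neighbors L p).filter fun q => ¬ a.eval (meetParam p q) = 0) ⊆ L :=
      (Finset.filter_subset _ _).trans (Finset.filter_subset _ _)
    have h2 : ((neighbors L p).filter fun q => ¬ a.eval (meetParam p q) = 0).card ≤ k := by
      refine card_le_of_linear_relation (p := p) (l := l) (m := m)
        ((Finset.card_le_card (Finset.image_subset_image hsub)).trans hslope)
        ((Finset.card_le_card (Finset.image_subset_image hsub)).trans hpos)
        (fun q hq => (mem_neighbors.mp (Finset.mem_filter.mp hq).1).2.2) fun q hq => ?_
      obtain ⟨hq, hqa⟩ := Finset.mem_filter.mp hq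
      have h3 := hmeet q hq
      have hne := sub_ne_zero.mpr (hL.slope_ne p hp q hq)
      have ht : meetParam p q * (p.1 - q.1) = p.2.1 - q.2.1 := div_mul_cancel₀ _ hne
      rw [hlm, Polynomial.eval_mul, Polynomial.eval_add, Polynomial.eval_mul, Polynomial.eval_C,
        Polynomial.eval_X, Polynomial.eval_C] at h3
      have h4 : a.eval (meetParam p q) *
          (1 + (l * (q.2.1 - p.2.1) + m * (q.1 - p.1))) = 0 := by
        linear_combination h3 + a.eval (meetParam p q) * l * ht
      linear_combination (mul_eq_zero.mp h4).resolve_left hqa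
    have := hdeg p hp
    omega
  have hb0 : b = 0 := by
    refine hL.eq_zero_of_eval hp b (hbd.trans_lt (lt_of_le_of_lt (by omega) (hdeg p hp)))
      fun q hq => ?_
    have h1 := hmeet q hq
    rw [ha0, Polynomial.eval_zero, zero_add] at h1
    exact (mul_eq_zero.mp h1).resolve_left (sub_ne_zero.mpr (hL.slope_ne p hp q hq).symm)
  have e2 : toLine p (pderiv 2 f) = 0 := by
    simpa [dirDeriv_apply, vertDir] using hb.symm.trans hb0
  have e1 : toLine p (pderiv 1 f) = 0 := by
    simpa [dirDeriv_apply, tanDir, e2] using ha.symm.trans ha0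
  have e0 : toLine p (pderiv 0 f) = 0 := by
    simpa [dirDeriv_apply, dir, e1, e2] using hp1
  fin_cases i
  exacts [e0, e1, e2]


/-- Parameter counting: a small family of lines lies on a surface of low degree. -/
theorem exists_toLine_eq_zero (L : Finset (K × K × K)) {e : ℕ}
    (he : (3 * e + 1) * L.card < (e + 1) ^ 3) :
    ∃ f : MvPolynomial (Fin 3) K, f ≠ 0 ∧ f.totalDegree ≤ 3 * e ∧ ∀ p ∈ L, toLine p f = 0 := by
  let expo : (Fin 3 → Fin (e + 1)) → (Fin 3 →₀ ℕ) :=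
    fun s => Finsupp.equivFunOnFinite.symm fun i => (s i : ℕ)
  have hexpo : Function.Injective expo := by
    intro s t hst
    funext i
    exact Fin.ext (by simpa [expo] using DFunLike.congr_fun hst i)
  let Φ : ((Fin 3 → Fin (e + 1)) → K) →ₗ[K] MvPolynomial (Fin 3) K :=
    Fintype.linearCombination K fun s => monomial (expo s) (1 : K)
  have hΦ (c : (Fin 3 → Fin (e + 1)) → K) : Φ c = ∑ s, monomial (expo s) (c s) := by
    simp [Φ, Fintype.linearCombination_apply, smul_monomial]
  let T : ((Fin 3 → Fin (e + 1)) → K) →ₗ[K] (L × Fin (3 * e + 1) → K) :=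
    LinearMap.pi fun pj => Polynomial.lcoeff K (pj.2 : ℕ) ∘ₗ (toLine pj.1.1).toLinearMap ∘ₗ Φ
  have hker : LinearMap.ker T ≠ ⊥ := by
    refine LinearMap.ker_ne_bot_of_finrank_lt ?_
    simp only [Module.finrank_fintype_fun_eq_card, Fintype.card_prod, Fintype.card_coe,
      Fintype.card_fin, Fintype.card_pi, Finset.prod_const, Finset.card_univ]
    linarith
  obtain ⟨c, hc, hc0⟩ := Submodule.exists_mem_ne_zero_of_ne_bot hker
  have hdeg : (Φ c).totalDegree ≤ 3 * e := by
    rw [hΦ]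
    refine totalDegree_finsetSum_le fun s _ => (totalDegree_monomial_le _ _).trans ?_
    rw [Finsupp.sum_fintype _ _ (by simp), Fin.sum_univ_three]
    have h0 := (s 0).is_lt
    have h1 := (s 1).is_lt
    have h2 := (s 2).is_lt
    simp only [expo, Finsupp.equivFunOnFinite_symm_apply_apply, id]
    omega
  refine ⟨Φ c, fun h0 => hc0 ?_, hdeg, fun p hp => ?_⟩
  · funext s
    have h1 := congrArg (coeff (expo s)) (hΦ c)
    rw [h0, coeff_zero, coeff_sum] at h1
    simp only [coeff_monomial, hexpo.eq_iff] at h1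
    simpa using h1.symm
  · ext j
    rw [Polynomial.coeff_zero]
    by_cases hj : j < 3 * e + 1
    · exact congrFun (LinearMap.mem_ker.mp hc) (⟨p, hp⟩, ⟨j, hj⟩)
    · exact Polynomial.coeff_eq_zero_of_natDegree_lt
        (((natDegree_toLine_le _ _).trans hdeg).trans_lt (by omega))

theorem IsGeneric.exists_card_neighbors_le {L : Finset (K × K × K)} (hL : IsGeneric L)
    (hne : L.Nonempty) {d k : ℕ} (hd : 1 ≤ d)
    (hK : ∀ i : ℕ, 0 < i → i ≤ 2 * d → (i : K) ≠ 0)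
    (hf : ∃ f : MvPolynomial (Fin 3) K, f ≠ 0 ∧ f.totalDegree ≤ d ∧ ∀ p ∈ L, toLine p f = 0)
    (hslope : (L.image fun q => q.1).card ≤ k) (hpos : (L.image fun q => q.2.1).card ≤ k) :
    ∃ p ∈ L, (neighbors L p).card ≤ 5 * d + k := by
  by_contra! hdeg
  have hex : ∃ n : ℕ, ∃ f : MvPolynomial (Fin 3) K,
      f ≠ 0 ∧ f.totalDegree = n ∧ ∀ p ∈ L, toLine p f = 0 := by
    obtain ⟨f, h0, -, h⟩ := hf
    exact ⟨_, f, h0, rfl, h⟩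
  obtain ⟨f, hf0, hfn, hfL⟩ := Nat.find_spec hex
  have hfd : f.totalDegree ≤ d := by
    obtain ⟨g, h0, hgd, h⟩ := hf
    rw [hfn]
    exact (Nat.find_min' hex ⟨g, h0, rfl, h⟩).trans hgd
  have hder (i : Fin 3) : pderiv i f = 0 := by
    by_contra hi
    have h1 := Nat.find_min' hex ⟨pderiv i f, hi, rfl, fun p hp =>
      toLine_pderiv_eq_zero hL hd hK hfd hfL hslope hpos hdeg hp i⟩
    have h2 := totalDegree_pderiv_le i f
    have h3 : f.totalDegree = 0 := by omega
    rw [totalDegree_eq_zero_iff_eq_C.mp h3, pderiv_C] at hi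
    exact hi rfl
  have hC := eq_C_of_forall_pderiv_eq_zero (fun i h0 hi => hK i h0 (by omega)) hder
  obtain ⟨p, hp⟩ := hne
  have h1 := hfL p hp
  rw [hC, toLine, restrictLine, aeval_C, Polynomial.algebraMap_eq, Polynomial.C_eq_zero] at h1
  exact hf0 (by rw [hC, h1, C_0])

/-- A graph all of whose nonempty induced subgraphs have a vertex of degree at most `T` has few
edges. -/
theorem sum_card_neighbors_le {T : ℕ} (L : Finset (K × K × K))
    (h : ∀ M ⊆ L, M.Nonempty → ∃ p ∈ M, (neighbors M p).card ≤ T) :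
    ∑ p ∈ L, (neighbors L p).card ≤ 2 * T * L.card := by
  induction L using Finset.strongInduction with
  | H L ih =>
    rcases L.eq_empty_or_nonempty with rfl | hne
    · simp
    obtain ⟨p, hp, hpT⟩ := h L subset_rfl hne
    have hM := ih (L.erase p) (Finset.erase_ssubset hp)
      fun M hM => h M (hM.trans (Finset.erase_subset _ _))
    have hq : ∀ q ∈ L.erase p, (neighbors L q).card ≤
        (neighbors (L.erase p) q).card + if q ∈ neighbors L p then 1 else 0 := by
      intro q hq
      split_ifs with hqp
      · have hsub : neighbors L q ⊆ insert p (neighbors (L.erase p) q) := by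
          intro r hr
          rw [Finset.mem_insert, or_iff_not_imp_left]
          intro hrp
          rw [mem_neighbors] at hr ⊢
          exact ⟨Finset.mem_erase.mpr ⟨hrp, hr.1⟩, hr.2⟩
        exact (Finset.card_le_card hsub).trans (Finset.card_insert_le _ _)
      · refine Finset.card_le_card fun r hr => ?_
        have hrp : r ≠ p := by
          rintro rfl
          exact hqp (mem_neighbors_symm (Finset.mem_of_mem_erase hq) hr)
        rw [mem_neighbors] at hr ⊢
        exact ⟨Finset.mem_erase.mpr ⟨hrp, hr.1⟩, hr.2⟩
    have hind : (∑ q ∈ L.erase p, if q ∈ neighbors L p then 1 else 0) ≤ T := by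
      rw [← Finset.card_filter]
      refine (Finset.card_le_card fun q hq => ?_).trans hpT
      exact (Finset.mem_filter.mp hq).2
    have hsum := Finset.sum_le_sum hq
    rw [Finset.sum_add_distrib] at hsum
    rw [← Finset.add_sum_erase L _ hp, ← Finset.card_erase_add_one hp]
    linarith

/-- The incidence bound for generic families of isotropic lines. -/
theorem IsGeneric.sum_card_neighbors_le {L : Finset (K × K × K)} (hL : IsGeneric L) {e k : ℕ}
    (he1 : 1 ≤ e) (he : (3 * e + 1) * L.card < (e + 1) ^ 3)
    (hK : ∀ i : ℕ, 0 < i → i ≤ 6 * e → (i : K) ≠ 0)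
    (hslope : (L.image fun q => q.1).card ≤ k) (hpos : (L.image fun q => q.2.1).card ≤ k) :
    ∑ p ∈ L, (neighbors L p).card ≤ 2 * (15 * e + k) * L.card := by
  obtain ⟨f, hf0, hfd, hf⟩ := exists_toLine_eq_zero L he
  refine LightLine.sum_card_neighbors_le L fun M hM hne => ?_
  have := (hL.mono hM).exists_card_neighbors_le hne (d := 3 * e) (k := k) (by omega)
    (fun i h0 hi => hK i h0 (by omega)) ⟨f, hf0, hfd, fun p hp => hf p (hM hp)⟩
    ((Finset.card_le_card (Finset.image_subset_image hM)).trans hslope)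
    ((Finset.card_le_card (Finset.image_subset_image hM)).trans hpos)
  rwa [← mul_assoc] at this

theorem isGeneric_union {R B : Finset (K × K × K)}
    (hR : ∀ p ∈ R, ∀ q ∈ R, pairing p q = 0 → p = q)
    (hB : ∀ p ∈ B, ∀ q ∈ B, pairing p q = 0 → p = q)
    (hRB : ∀ p ∈ R, ∀ q ∈ B, p.1 ≠ q.1) : IsGeneric (R ∪ B) := by
  refine ⟨fun p hp q hq => ?_, fun p hp q hq r hr hqr h0 => ?_⟩
  · obtain ⟨hq, hpq, h0⟩ := mem_neighbors.mp hq
    rcases Finset.mem_union.mp hp with hp | hp <;> rcases Finset.mem_union.mp hq with hq | hq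
    · exact absurd (hR p hp q hq h0) hpq
    · exact hRB p hp q hq
    · exact (hRB q hq p hp).symm
    · exact absurd (hB p hp q hq h0) hpq
  · obtain ⟨hq, hpq, hpq0⟩ := mem_neighbors.mp hq
    obtain ⟨hr, hpr, hpr0⟩ := mem_neighbors.mp hr
    rcases Finset.mem_union.mp hp with hp | hp <;> rcases Finset.mem_union.mp hq with hq | hq <;>
      rcases Finset.mem_union.mp hr with hr | hr
    · exact hpq (hR p hp q hq hpq0)
    · exact hpq (hR p hp q hq hpq0)
    · exact hpr (hR p hp r hr hpr0)
    · exact hqr (hB q hq r hr h0)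
    · exact hqr (hR q hq r hr h0)
    · exact hpr (hB p hp r hr hpr0)
    · exact hpq (hB p hp q hq hpq0)
    · exact hpq (hB p hp q hq hpq0)

theorem card_filter_pairing_le {R B : Finset (K × K × K)}
    (hRB : ∀ p ∈ R, ∀ q ∈ B, p.1 ≠ q.1) :
    ((R ×ˢ B).filter fun pq => pairing pq.1 pq.2 = 0).card ≤
      ∑ p ∈ R ∪ B, (neighbors (R ∪ B) p).card := by
  rw [← Finset.card_sigma]
  refine Finset.card_le_card_of_injOn (fun pq => ⟨pq.1, pq.2⟩) ?_ ?_
  · intro pq hpq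
    obtain ⟨hpq, h0⟩ := Finset.mem_filter.mp hpq
    obtain ⟨hp, hq⟩ := Finset.mem_product.mp hpq
    refine Finset.mem_coe.mpr (Finset.mem_sigma.mpr ⟨Finset.mem_union_left _ hp,
      mem_neighbors.mpr ⟨Finset.mem_union_right _ hq, fun h => hRB _ hp _ hq ?_, h0⟩⟩)
    exact congrArg Prod.fst h
  · rintro ⟨p, q⟩ - ⟨p', q'⟩ - h
    simpa using h


/-- The element `s` satisfies no nontrivial quadratic equation with coefficients in the image of
`ι`. -/
def NoQuadraticRelation {F K : Type*} [Field F] [Field K] (ι : F →+* K) (s : K) : Prop :=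
  ∀ a b c : F, ι a * s ^ 2 + ι b * s + ι c = 0 → a = 0 ∧ b = 0 ∧ c = 0

/-- Every field embeds into a field containing an element which satisfies no quadratic equation
over the smaller field. -/
theorem exists_generic_extension.{u} (F : Type u) [Field F] :
    ∃ (K : Type u) (_ : Field K) (ι : F →+* K) (s : K), NoQuadraticRelation ι s := by
  refine ⟨RatFunc F, inferInstance, RatFunc.C, RatFunc.X, fun a b c h => ?_⟩
  have h1 : algebraMap (Polynomial F) (RatFunc F) (Polynomial.C a * Polynomial.X ^ 2
      + Polynomial.C b * Polynomial.X + Polynomial.C c) = 0 := by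
    simpa using h
  rw [map_eq_zero_iff _ (RatFunc.algebraMap_injective F)] at h1
  have h2 (i : ℕ) := congrArg (fun P => Polynomial.coeff P i) h1
  have h20 := h2 0
  have h21 := h2 1
  have h22 := h2 2
  simp [Polynomial.coeff_X, Polynomial.coeff_C] at h20 h21 h22
  exact ⟨h22, h21, h20⟩

section Application

variable {F : Type*} [Field F] (ι : F →+* K) (s : K)

/-- The first family of points encoding the solutions of `a * (x - c) = b * (y - d)`. -/
def redPoint (t : F × F × F) : K × K × K :=
  (ι t.1, s * ι t.2.1, -ι (t.1 * t.2.2) - ι t.1 * s ^ 2)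

/-- The second family of points encoding the solutions of `a * (x - c) = b * (y - d)`. -/
def bluePoint (t : F × F × F) : K × K × K :=
  (ι t.1 / s, ι t.2.1 + s ^ 2, -ι (t.1 * t.2.2))

variable {ι s}

theorem pairing_redPoint_bluePoint (hs : s ≠ 0) (t u : F × F × F) :
    pairing (redPoint ι s t) (bluePoint ι s u) =
      ι (t.1 * (u.2.1 - t.2.2) - u.1 * (t.2.1 - u.2.2)) := by
  simp only [pairing, redPoint, bluePoint, map_sub, map_mul]
  field_simp
  ring

theorem generic_ne_zero (hs : NoQuadraticRelation ι s) : s ≠ 0 := by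
  rintro rfl
  simpa using hs 1 0 0 (by simp)

theorem eq_of_pairing_redPoint (hs : NoQuadraticRelation ι s) {t u : F × F × F}
    (ht : t.1 ≠ 0)
    (h : pairing (redPoint ι s t) (redPoint ι s u) = 0) : t = u := by
  obtain ⟨a, x, b⟩ := t
  obtain ⟨a', x', b'⟩ := u
  simp only [pairing, redPoint] at h ht
  obtain ⟨h1, h2, h3⟩ := hs (a' - a) (a * x' - a' * x) (a' * b' - a * b) (by
    simp only [map_sub, map_mul] at h ⊢
    linear_combination h)
  obtain rfl : a' = a := sub_eq_zero.mp h1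
  have hx : x = x' := mul_left_cancel₀ ht (by linear_combination -h2)
  have hb : b = b' := mul_left_cancel₀ ht (by linear_combination -h3)
  rw [hx, hb]

theorem eq_of_pairing_bluePoint (hs : NoQuadraticRelation ι s) {t u : F × F × F}
    (ht : t.1 ≠ 0)
    (h : pairing (bluePoint ι s t) (bluePoint ι s u) = 0) : t = u := by
  have hs0 := generic_ne_zero hs
  obtain ⟨a, x, b⟩ := t
  obtain ⟨a', x', b'⟩ := u
  simp only [pairing, bluePoint] at h ht
  obtain ⟨h1, h2, h3⟩ := hs (a - a') (a' * b' - a * b) (a * x' - a' * x) (by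
    simp only [map_sub, map_mul] at h ⊢
    field_simp at h
    linear_combination h)
  obtain rfl : a = a' := sub_eq_zero.mp h1
  have hx : x = x' := mul_left_cancel₀ ht (by linear_combination -h3)
  have hb : b = b' := mul_left_cancel₀ ht (by linear_combination -h2)
  rw [hx, hb]

theorem redPoint_fst_ne_bluePoint_fst (hs : NoQuadraticRelation ι s) {t u : F × F × F}
    (ht : t.1 ≠ 0) :
    (redPoint ι s t).1 ≠ (bluePoint ι s u).1 := by
  intro h
  have hs0 := generic_ne_zero hs
  simp only [redPoint, bluePoint] at h
  rw [eq_div_iff hs0] at h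
  exact ht (hs 0 t.1 (-u.1) (by rw [map_zero, map_neg]; linear_combination h)).2.1

theorem redPoint_injOn (hs : NoQuadraticRelation ι s) :
    Set.InjOn (redPoint ι s) {t | t.1 ≠ 0} := fun t ht u _ h =>
  eq_of_pairing_redPoint hs ht (by rw [h, pairing]; ring)

theorem bluePoint_injOn (hs : NoQuadraticRelation ι s) :
    Set.InjOn (bluePoint ι s) {t | t.1 ≠ 0} := fun t ht u _ h =>
  eq_of_pairing_bluePoint hs ht (by rw [h, pairing]; ring)

theorem card_sq_mul_mulEnergy_le_card_filter (hs : NoQuadraticRelation ι s)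
    {A : Finset F} (h0 : 0 ∉ A) :
    A.card ^ 2 * A.mulEnergy A ≤
      ((((A ×ˢ (A + A) ×ˢ A).image (redPoint ι s)) ×ˢ
        ((A ×ˢ (A + A) ×ˢ A).image (bluePoint ι s))).filter
          fun pq => pairing pq.1 pq.2 = 0).card := by
  have hs0 := generic_ne_zero hs
  have hA {a : F} (ha : a ∈ A) : a ≠ 0 := fun h => h0 (h ▸ ha)
  rw [sq, ← Finset.card_product, Finset.mulEnergy, ← Finset.card_product]
  refine Finset.card_le_card_of_injOn (fun z =>
    (redPoint ι s (z.2.1.1, z.1.2 + z.2.2.2, z.1.1),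
      bluePoint ι s (z.2.1.2, z.1.1 + z.2.2.1, z.1.2))) ?_ ?_
  · rintro ⟨⟨b, b'⟩, ⟨a, a'⟩, c, c'⟩ hz
    simp only [Finset.coe_product, Finset.coe_filter, Set.mem_prod, Finset.mem_coe,
      Set.mem_ofPred_eq, Finset.mem_product] at hz
    obtain ⟨⟨hb, hb'⟩, ⟨⟨ha, ha'⟩, hc, hc'⟩, h⟩ := hz
    refine Finset.mem_coe.mpr (Finset.mem_filter.mpr ⟨Finset.mem_product.mpr ⟨?_, ?_⟩, ?_⟩)
    · exact Finset.mem_image_of_mem _ (Finset.mem_product.mpr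
        ⟨ha, Finset.mem_product.mpr ⟨Finset.add_mem_add hb' hc', hb⟩⟩)
    · exact Finset.mem_image_of_mem _ (Finset.mem_product.mpr
        ⟨ha', Finset.mem_product.mpr ⟨Finset.add_mem_add hb hc, hb'⟩⟩)
    · rw [pairing_redPoint_bluePoint hs0, map_eq_zero]
      linear_combination h
  · rintro ⟨⟨b₁, b₁'⟩, ⟨a₁, a₁'⟩, c₁, c₁'⟩ h₁ ⟨⟨b₂, b₂'⟩, ⟨a₂, a₂'⟩, c₂, c₂'⟩ h₂ h
    simp only [Finset.coe_product, Finset.coe_filter, Set.mem_prod, Finset.mem_coe,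
      Set.mem_ofPred_eq, Finset.mem_product] at h₁ h₂
    have hr := redPoint_injOn hs (hA h₁.2.1.1.1) (hA h₂.2.1.1.1) (congrArg Prod.fst h)
    have hb := bluePoint_injOn hs (hA h₁.2.1.1.2) (hA h₂.2.1.1.2) (congrArg Prod.snd h)
    simp only [Prod.mk.injEq] at hr hb ⊢
    obtain ⟨rfl, hr, rfl⟩ := hr
    obtain ⟨rfl, hb, rfl⟩ := hb
    simpa using And.intro hb hr

end Application

/-- The sum-product inequality before optimization of the parameters. -/
theorem card_pow_six_le {F : Type*} [Field F] {A : Finset F} (hne : A.Nonempty) (h0 : 0 ∉ A)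
    {e : ℕ} (he : 6 * (A.card ^ 2 * (A + A).card) < (e + 1) ^ 2) (he1 : 1 ≤ e)
    (hF : ∀ i : ℕ, 0 < i → i ≤ 6 * e → (i : F) ≠ 0) :
    A.card ^ 6 ≤ (A * A).card *
      (2 * (15 * e + 2 * (A + A).card) * (2 * (A.card ^ 2 * (A + A).card))) := by
  obtain ⟨K, _, ι, s, hs⟩ := exists_generic_extension F
  have hA {t : F × F × F} (ht : t ∈ A ×ˢ (A + A) ×ˢ A) : t.1 ≠ 0 :=
    fun h => h0 (h ▸ (Finset.mem_product.mp ht).1)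
  set P := A ×ˢ (A + A) ×ˢ A with hP
  set R := P.image (redPoint ι s) with hRdef
  set B := P.image (bluePoint ι s) with hBdef
  have hPcard : P.card = A.card ^ 2 * (A + A).card := by
    rw [hP, Finset.card_product, Finset.card_product]
    ring
  have hRB : ∀ p ∈ R, ∀ q ∈ B, p.1 ≠ q.1 := by
    intro p hp q hq
    obtain ⟨t, ht, rfl⟩ := Finset.mem_image.mp hp
    obtain ⟨u, hu, rfl⟩ := Finset.mem_image.mp hq
    exact redPoint_fst_ne_bluePoint_fst hs (hA ht)
  have hgen : IsGeneric (R ∪ B) := by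
    refine isGeneric_union ?_ ?_ hRB
    · intro p hp q hq h
      obtain ⟨t, ht, rfl⟩ := Finset.mem_image.mp hp
      obtain ⟨u, hu, rfl⟩ := Finset.mem_image.mp hq
      rw [eq_of_pairing_redPoint hs (hA ht) h]
    · intro p hp q hq h
      obtain ⟨t, ht, rfl⟩ := Finset.mem_image.mp hp
      obtain ⟨u, hu, rfl⟩ := Finset.mem_image.mp hq
      rw [eq_of_pairing_bluePoint hs (hA ht) h]
  have hcard : (R ∪ B).card ≤ 2 * (A.card ^ 2 * (A + A).card) := by
    rw [← hPcard, two_mul]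
    exact (Finset.card_union_le _ _).trans
      (add_le_add Finset.card_image_le Finset.card_image_le)
  have hAS : A.card ≤ (A + A).card := Finset.card_le_card_add_left hne
  have hslope : ((R ∪ B).image fun q => q.1).card ≤ 2 * (A + A).card := by
    have hsub : ((R ∪ B).image fun q => q.1) ⊆ A.image ι ∪ A.image fun a => ι a / s := by
      intro m hm
      obtain ⟨p, hp, rfl⟩ := Finset.mem_image.mp hm
      rcases Finset.mem_union.mp hp with hp | hp <;>
        obtain ⟨t, ht, rfl⟩ := Finset.mem_image.mp hp
      · exact Finset.mem_union_left _ (Finset.mem_image_of_mem ι (Finset.mem_product.mp ht).1)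
      · exact Finset.mem_union_right _
          (Finset.mem_image_of_mem (fun a => ι a / s) (Finset.mem_product.mp ht).1)
    refine (Finset.card_le_card hsub).trans ((Finset.card_union_le _ _).trans ?_)
    have h1 : (A.image ι).card ≤ A.card := Finset.card_image_le
    have h2 : (A.image fun a => ι a / s).card ≤ A.card := Finset.card_image_le
    omega
  have hpos : ((R ∪ B).image fun q => q.2.1).card ≤ 2 * (A + A).card := by
    have hsub : ((R ∪ B).image fun q => q.2.1) ⊆
        ((A + A).image fun x => s * ι x) ∪ (A + A).image fun x => ι x + s ^ 2 := by
      intro m hm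
      obtain ⟨p, hp, rfl⟩ := Finset.mem_image.mp hm
      rcases Finset.mem_union.mp hp with hp | hp <;>
        obtain ⟨t, ht, rfl⟩ := Finset.mem_image.mp hp <;>
        have ht2 := (Finset.mem_product.mp (Finset.mem_product.mp ht).2).1
      · exact Finset.mem_union_left _ (Finset.mem_image_of_mem (fun x => s * ι x) ht2)
      · exact Finset.mem_union_right _ (Finset.mem_image_of_mem (fun x => ι x + s ^ 2) ht2)
    refine (Finset.card_le_card hsub).trans ((Finset.card_union_le _ _).trans ?_)
    have h1 : ((A + A).image fun x => s * ι x).card ≤ (A + A).card := Finset.card_image_le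
    have h2 : ((A + A).image fun x => ι x + s ^ 2).card ≤ (A + A).card := Finset.card_image_le
    omega
  have hinc := hgen.sum_card_neighbors_le he1 (k := 2 * (A + A).card) (by
      calc (3 * e + 1) * (R ∪ B).card
          ≤ (3 * (e + 1)) * (2 * (A.card ^ 2 * (A + A).card)) :=
            Nat.mul_le_mul (by omega) hcard
        _ = (e + 1) * (6 * (A.card ^ 2 * (A + A).card)) := by ring
        _ < (e + 1) * (e + 1) ^ 2 := by gcongr
        _ = (e + 1) ^ 3 := by ring)
    (fun i hi hie h => hF i hi hie (ι.injective (by rw [map_natCast, h, map_zero])))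
    hslope hpos
  have hmain : A.card ^ 2 * A.mulEnergy A ≤
      2 * (15 * e + 2 * (A + A).card) * (2 * (A.card ^ 2 * (A + A).card)) :=
    (card_sq_mul_mulEnergy_le_card_filter hs h0).trans
      ((card_filter_pairing_le hRB).trans (hinc.trans (Nat.mul_le_mul_left _ hcard)))
  have henergy : A.card ^ 2 * A.card ^ 2 ≤ (A * A).card * A.mulEnergy A :=
    Finset.le_card_mul_mul_mulEnergy A A
  calc A.card ^ 6 = A.card ^ 2 * (A.card ^ 2 * A.card ^ 2) := by ring
    _ ≤ A.card ^ 2 * ((A * A).card * A.mulEnergy A) := Nat.mul_le_mul_left _ henergy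
    _ = (A * A).card * (A.card ^ 2 * A.mulEnergy A) := by ring
    _ ≤ _ := Nat.mul_le_mul_left _ hmain

theorem natCast_ne_zero_of_forall_charP {F : Type*} [Field F] {N : ℕ}
    (h : ∀ p : ℕ, p.Prime → CharP F p → N < p) (i : ℕ) (hi : 0 < i) (hN : i ≤ N) :
    (i : F) ≠ 0 := by
  intro h0
  obtain ⟨p, hp⟩ := CharP.exists F
  have hdvd := (CharP.cast_eq_zero_iff F p i).mp h0
  rcases CharP.char_is_prime_or_zero F p with hprime | rfl
  · exact absurd (Nat.le_of_dvd hi hdvd) (not_le.mpr (hN.trans_lt (h p hprime hp)))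
  · exact hi.ne' (Nat.eq_zero_of_zero_dvd hdvd)

end LightLine

theorem stmt_6 :
    ∃ c C : ℝ, 0 < c ∧ 0 < C ∧
      ∀ (F : Type) [Field F] (A : Finset F), A.Nonempty →
        (∀ p : ℕ, p.Prime → CharP F p → (A.card : ℝ) ≤ c * (p : ℝ) ^ ((5 : ℝ) / 8)) →
        C * (A.card : ℝ) ^ ((6 : ℝ) / 5) ≤ max ((A + A).card : ℝ) ((A * A).card : ℝ) := by
  refine ⟨1 / 32, 1 / 100, by norm_num, by norm_num, fun F _ A hne hchar => ?_⟩
  by_contra! hlt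
  set y : ℝ := (A.card : ℝ) ^ ((1 : ℝ) / 5) with hy
  have hcard0 : (0 : ℝ) ≤ A.card := Nat.cast_nonneg _
  have hy0 : 0 ≤ y := Real.rpow_nonneg hcard0 _
  have hy5 : (A.card : ℝ) = y ^ 5 := by
    rw [hy, ← Real.rpow_natCast, ← Real.rpow_mul hcard0]
    norm_num
  have hy6 : (A.card : ℝ) ^ ((6 : ℝ) / 5) = y ^ 6 := by
    rw [hy, ← Real.rpow_natCast, ← Real.rpow_mul hcard0]
    norm_num
  rw [hy6, max_lt_iff] at hlt
  have hA2 : 2 ≤ A.card := by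
    by_contra! h
    have h1 : A.card = 1 := by have := hne.card_pos; omega
    have h2 : y = 1 := by rw [hy, h1]; simp
    have h3 : (1 : ℝ) ≤ (A + A).card := by exact_mod_cast (hne.add hne).card_pos
    rw [h2] at hlt
    linarith [hlt.1]
  set A₀ := A.erase 0 with hA₀
  have hsub : A₀ ⊆ A := Finset.erase_subset _ _
  have hn1 : A.card ≤ 2 * A₀.card := by
    have : A.card - 1 ≤ A₀.card := Finset.pred_card_le_card_erase
    omega
  have hne₀ : A₀.Nonempty := Finset.card_pos.mp (by omega)
  have hS : ((A₀ + A₀).card : ℝ) < 1 / 100 * y ^ 6 := lt_of_le_of_lt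
    (by exact_mod_cast Finset.card_le_card (Finset.add_subset_add hsub hsub)) hlt.1
  have hM : ((A₀ * A₀).card : ℝ) < 1 / 100 * y ^ 6 := lt_of_le_of_lt
    (by exact_mod_cast Finset.card_le_card (Finset.mul_subset_mul hsub hsub)) hlt.2
  have hSn : ((A₀ + A₀).card : ℝ) ≤ (A₀.card : ℝ) ^ 2 := by
    rw [sq]
    exact_mod_cast Finset.card_add_le
  have hS1 : 1 ≤ (A₀ + A₀).card := (hne₀.add hne₀).card_pos
  set N := A₀.card ^ 2 * (A₀ + A₀).card with hN
  have hN1 : 1 ≤ N := Nat.mul_pos (pow_pos hne₀.card_pos 2) hS1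
  set n : ℝ := (A₀.card : ℝ) with hn
  set σ : ℝ := ((A₀ + A₀).card : ℝ) with hσ
  have hn0 : 0 ≤ n := Nat.cast_nonneg _
  have hσ0 : 0 ≤ σ := Nat.cast_nonneg _
  have hnpos : 0 < n := Nat.cast_pos.mpr hne₀.card_pos
  clear_value n σ y
  have hny : n ≤ y ^ 5 := by
    rw [← hy5, hn]
    exact_mod_cast Finset.card_le_card hsub
  have hny' : y ^ 5 ≤ 2 * n := by
    rw [← hy5, hn]
    exact_mod_cast hn1
  have he : (Nat.sqrt (6 * N) : ℝ) ≤ n * y ^ 3 / 4 := by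
    refine le_of_sq_le_sq ?_ (by positivity)
    have h1 : ((Nat.sqrt (6 * N) ^ 2 : ℕ) : ℝ) ≤ ((6 * N : ℕ) : ℝ) :=
      Nat.cast_le.mpr (Nat.sqrt_le' _)
    rw [hN] at h1 ⊢
    push_cast at h1
    refine h1.trans ?_
    rw [← hn, ← hσ]
    nlinarith [mul_le_mul_of_nonneg_left hS.le (sq_nonneg n), sq_nonneg (n * y ^ 3)]
  have hσy : σ ≤ n * y ^ 3 / 10 := by
    refine le_of_sq_le_sq ?_ (by positivity)
    nlinarith [mul_le_mul hSn hS.le hσ0 (sq_nonneg n)]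
  have hF := LightLine.natCast_ne_zero_of_forall_charP (F := F) (N := 6 * Nat.sqrt (6 * N)) (by
    intro p hp hcp
    set z : ℝ := (p : ℝ) ^ ((1 : ℝ) / 8) with hz
    have hp0 : (0 : ℝ) ≤ p := Nat.cast_nonneg _
    have hz0 : 0 < z := Real.rpow_pos_of_pos (Nat.cast_pos.mpr hp.pos) _
    have hz8 : (p : ℝ) = z ^ 8 := by
      rw [hz, ← Real.rpow_natCast, ← Real.rpow_mul hp0]
      norm_num
    have hz5 : (p : ℝ) ^ ((5 : ℝ) / 8) = z ^ 5 := by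
      rw [hz, ← Real.rpow_natCast, ← Real.rpow_mul hp0]
      norm_num
    have h1 := hchar p hp hcp
    rw [hz5, hy5] at h1
    have h2 : y ≤ z / 2 := by
      refine le_of_pow_le_pow_left₀ (n := 5) (by norm_num) (by positivity) ?_
      rw [div_pow]
      linarith
    have h3 : y ^ 8 ≤ (z / 2) ^ 8 := pow_le_pow_left₀ hy0 h2 8
    have h4 : n * y ^ 3 ≤ y ^ 8 := by
      calc n * y ^ 3 ≤ y ^ 5 * y ^ 3 := by gcongr
        _ = y ^ 8 := by ring
    have h5 : ((6 * Nat.sqrt (6 * N) : ℕ) : ℝ) < p := by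
      rw [hz8]
      push_cast
      rw [div_pow] at h3
      have : 0 < z ^ 8 := by positivity
      linarith
    exact_mod_cast h5)
  have hmain := LightLine.card_pow_six_le hne₀ (Finset.notMem_erase 0 A)
    (e := Nat.sqrt (6 * N)) (Nat.lt_succ_sqrt' _) (Nat.sqrt_pos.mpr (by omega)) hF
  have hmain' : n ^ 6 ≤ (A₀ * A₀).card *
      (2 * (15 * (Nat.sqrt (6 * N) : ℝ) + 2 * σ) * (2 * (n ^ 2 * σ))) := by
    rw [hn, hσ]
    exact_mod_cast hmain
  have hy1 : 0 < y := by
    rw [hy]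
    exact Real.rpow_pos_of_pos (by exact_mod_cast hne.card_pos) _
  have hμ0 : (0 : ℝ) ≤ (A₀ * A₀).card := Nat.cast_nonneg _
  have he0 : (0 : ℝ) ≤ Nat.sqrt (6 * N) := Nat.cast_nonneg _
  generalize ((A₀ * A₀).card : ℝ) = μ at hM hmain' hμ0
  generalize (Nat.sqrt (6 * N) : ℝ) = e at he hmain' he0
  have hbound : n ^ 6 ≤ n ^ 3 * (16 / 10000 * y ^ 15) := by
    calc n ^ 6 ≤ μ *
        (2 * (15 * e + 2 * σ) * (2 * (n ^ 2 * σ))) := hmain'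
      _ ≤ (1 / 100 * y ^ 6) * (2 * (15 * (n * y ^ 3 / 4) + 2 * (n * y ^ 3 / 10)) *
          (2 * (n ^ 2 * (1 / 100 * y ^ 6)))) := by gcongr
      _ ≤ n ^ 3 * (16 / 10000 * y ^ 15) := by
        have : 0 ≤ n ^ 3 * y ^ 15 := by positivity
        nlinarith
  have h3 : n ^ 3 ≤ 16 / 10000 * y ^ 15 := by
    refine le_of_mul_le_mul_left ?_ (pow_pos hnpos 3)
    linarith [show n ^ 3 * n ^ 3 = n ^ 6 by ring]
  have h4 : (y ^ 5) ^ 3 ≤ (2 * n) ^ 3 := pow_le_pow_left₀ (by positivity) hny' 3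
  have h5 : 0 < y ^ 15 := by positivity
  nlinarith
end
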